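/- Let n ≤ d be positive integers, let A : ℝ^n → ℝ^{d−n} be a compactly supported Lipschitz function with graph Γ, and let dμ = g dH^n|_Γ where C₁^{-1} ≤ g ≤ C₁ on Γ and ‖g − 1‖_{L²(H^n|_Γ)} ≤ C₂‖∇A‖_{L²}. There exist ε₀ = ε₀(C₂) > 0 and c > 0 depending only on n, d, C₁, C₂ such that if ‖∇A‖_∞ ≤ ε₀, then ‖S^⊥μ‖_{L²(μ)} ≥ c‖∇A‖_{L²}. -/

import Mathlib

open MeasureTheory Metric Set
open scoped ENNReal NNReal

noncomputable section

/-- The `s`-Riesz kernel in `ℝ^d`. -/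
def rieszKernel (d : ℕ) (s : ℝ) (x y : EuclideanSpace ℝ (Fin d)) : EuclideanSpace ℝ (Fin d) :=
  ‖x - y‖ ^ (-(s + 1)) • (x - y)

/-- Doubly truncated Riesz transform `R^s_{t,u} μ (x)`. -/
def truncRiesz (d : ℕ) (s : ℝ) (μ : Measure (EuclideanSpace ℝ (Fin d)))
    (x : EuclideanSpace ℝ (Fin d)) (t u : ℝ) : EuclideanSpace ℝ (Fin d) :=
  ∫ y in {y | t < dist x y ∧ dist x y ≤ u}, rieszKernel d s x y ∂μ

/-- The square function `Sμ(x)`, as a value in `ℝ≥0∞`. -/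
def sqFn (d : ℕ) (s : ℝ) (μ : Measure (EuclideanSpace ℝ (Fin d)))
    (x : EuclideanSpace ℝ (Fin d)) : ℝ≥0∞ :=
  (∫⁻ t in Ioi (0:ℝ), ENNReal.ofReal (‖truncRiesz d s μ x t (2*t)‖^2 / t)) ^ (1/2 : ℝ)

/-- The map `Ã : x ↦ (x, A(x))` from `ℝ^n` to `ℝ^d`. -/
def graphMap (n d : ℕ) (hnd : n ≤ d)
    (A : EuclideanSpace ℝ (Fin n) → EuclideanSpace ℝ (Fin (d - n)))
    (x : EuclideanSpace ℝ (Fin n)) : EuclideanSpace ℝ (Fin d) :=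
  (WithLp.equiv 2 (Fin d → ℝ)).symm fun i =>
    if h : (i : ℕ) < n then x ⟨i, h⟩
    else A x ⟨(i : ℕ) - n, by have := i.isLt; omega⟩

/-- The graph `Γ = {(x, A(x)) : x ∈ ℝ^n} ⊂ ℝ^d`. -/
def graphSet (n d : ℕ) (hnd : n ≤ d)
    (A : EuclideanSpace ℝ (Fin n) → EuclideanSpace ℝ (Fin (d - n)))
    : Set (EuclideanSpace ℝ (Fin d)) :=
  Set.range (graphMap n d hnd A)

/-- Orthogonal projection `Π^⊥` of `ℝ^d` onto the last `d - n` coordinates. -/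
def projPerp (n d : ℕ) (x : EuclideanSpace ℝ (Fin d)) : EuclideanSpace ℝ (Fin d) :=
  (WithLp.equiv 2 (Fin d → ℝ)).symm fun i => if (i : ℕ) < n then 0 else x i

/-- The transversal square function `S^⊥μ(x)`. -/
def sqFnPerp (n d : ℕ) (μ : Measure (EuclideanSpace ℝ (Fin d)))
    (x : EuclideanSpace ℝ (Fin d)) : ℝ≥0∞ :=
  (∫⁻ t in Ioi (0:ℝ),
    ENNReal.ofReal (‖projPerp n d (truncRiesz d n μ x t (2*t))‖^2 / t)) ^ (1/2 : ℝ)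

/-- `L²(μ)`-norm of an `ℝ≥0∞`-valued function. -/
def l2Norm {α : Type*} [MeasurableSpace α] (μ : Measure α) (F : α → ℝ≥0∞) : ℝ≥0∞ :=
  (∫⁻ x, (F x) ^ 2 ∂μ) ^ (1/2 : ℝ)

/-- `‖∇A‖_{L²}` for a Lipschitz map `A : ℝ^n → ℝ^m` (the gradient is defined a.e.). -/
def gradL2 (n m : ℕ) (A : EuclideanSpace ℝ (Fin n) → EuclideanSpace ℝ (Fin m)) : ℝ≥0∞ :=
  eLpNorm (fun x => fderiv ℝ A x) 2 volume

/-- The measure `g dH^n|_Γ`. -/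
def graphMeasure (n d : ℕ) (hnd : n ≤ d)
    (A : EuclideanSpace ℝ (Fin n) → EuclideanSpace ℝ (Fin (d - n)))
    (g : EuclideanSpace ℝ (Fin d) → ℝ) : Measure (EuclideanSpace ℝ (Fin d)) :=
  (μH[(n:ℝ)].restrict (graphSet n d hnd A)).withDensity fun z => ENNReal.ofReal (g z)

set_option linter.all false

section core
variable {E F : Type*} [NormedAddCommGroup E] [InnerProductSpace ℝ E] [FiniteDimensional ℝ E]
  [MeasurableSpace E] [BorelSpace E]
  [NormedAddCommGroup F] [InnerProductSpace ℝ F] [FiniteDimensional ℝ F]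
  [MeasurableSpace F] [BorelSpace F]

/-- Gaussian weight. -/
def gs (T : ℝ) (z : E) : ℝ := Real.exp (-(‖z‖ ^ 2) / T)

/-- extended Gaussian weight. -/
def gE (T : ℝ) (z : E) : ℝ≥0∞ := ENNReal.ofReal (gs T z)

lemma gs_pos (T : ℝ) (z : E) : 0 < gs T z := Real.exp_pos _

lemma gs_cont (T : ℝ) : Continuous (gs T : E → ℝ) := by unfold gs; fun_prop

lemma gE_meas (T : ℝ) : Measurable (gE T : E → ℝ≥0∞) :=
  (gs_cont T).measurable.ennreal_ofReal

lemma gs_neg (T : ℝ) (z : E) : gs T (-z) = gs T z := by simp [gs]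

lemma gs_mono {T T' : ℝ} (hT : 0 < T) (h : T ≤ T') (z : E) : gs T z ≤ gs T' z := by
  unfold gs
  apply Real.exp_le_exp.2
  rw [neg_div, neg_div, neg_le_neg_iff]
  gcongr

lemma gs_integrable {T : ℝ} (hT : 0 < T) : Integrable (gs T : E → ℝ) := by
  have h := GaussianFourier.integrable_cexp_neg_mul_sq_norm_add (V := E)
    (b := ((1 / T : ℝ) : ℂ)) (by simpa using hT) 0 0
  have h2 := h.norm
  refine h2.congr (Filter.Eventually.of_forall fun z => ?_)
  simp only [gs]
  rw [Complex.norm_exp]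
  congr 1
  simp [← Complex.ofReal_pow, ← Complex.ofReal_mul, ← Complex.ofReal_inv, ← Complex.ofReal_neg]
  field_simp

lemma lint_gE {T : ℝ} (hT : 0 < T) : ∫⁻ z : E, gE T z < ∞ := by
  have := (gs_integrable (E := E) hT).lintegral_lt_top
  exact this

lemma poly_exp_bound (k : ℕ) (b T : ℝ) (hT : 0 < T) : ∃ C : ℝ, 0 ≤ C ∧ ∀ t : ℝ, 0 ≤ t →
    t ^ k * Real.exp (b * t) * Real.exp (-(t ^ 2) / T) ≤ C * Real.exp (-(t ^ 2) / (2 * T)) := by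
  refine ⟨k.factorial * Real.exp ((b + 1) ^ 2 * T / 2), by positivity, fun t ht => ?_⟩
  have h1 : t ^ k ≤ k.factorial * Real.exp t := by
    have := Real.pow_div_factorial_le_exp t ht k
    rwa [div_le_iff₀' (by positivity)] at this
  calc t ^ k * Real.exp (b * t) * Real.exp (-(t ^ 2) / T)
      ≤ (k.factorial * Real.exp t) * Real.exp (b * t) * Real.exp (-(t ^ 2) / T) := by gcongr
    _ = k.factorial * Real.exp (t + b * t + -(t ^ 2) / T) := by
        rw [Real.exp_add, Real.exp_add]; ring
    _ ≤ k.factorial * Real.exp ((b + 1) ^ 2 * T / 2 + -(t ^ 2) / (2 * T)) := by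
        refine mul_le_mul_of_nonneg_left (Real.exp_le_exp.2 ?_) (by positivity)
        have : (b + 1) ^ 2 * T / 2 + -(t ^ 2) / (2 * T) - (t + b * t + -(t ^ 2) / T)
          = (t - (b + 1) * T) ^ 2 / (2 * T) := by field_simp; ring
        have h3 : 0 ≤ (t - (b + 1) * T) ^ 2 / (2 * T) := by positivity
        linarith
    _ = _ := by rw [Real.exp_add]; ring

lemma poly_gs (k : ℕ) (b T : ℝ) (hT : 0 < T) : ∃ C : ℝ, 0 ≤ C ∧ ∀ z : E,
    ‖z‖ ^ k * Real.exp (b * ‖z‖) * gs T z ≤ C * gs (2 * T) z := by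
  obtain ⟨C, hC, h⟩ := poly_exp_bound k b T hT
  exact ⟨C, hC, fun z => h ‖z‖ (norm_nonneg _)⟩

lemma gs_shift {T : ℝ} (hT : 0 < T) (z v : E) :
    gs T (z + v) ≤ Real.exp (‖v‖ ^ 2 / T) * gs (2 * T) z := by
  unfold gs
  rw [← Real.exp_add]
  apply Real.exp_le_exp.2
  have h1 : ‖z‖ ^ 2 ≤ 2 * ‖z + v‖ ^ 2 + 2 * ‖v‖ ^ 2 := by
    have h := norm_sub_le (z + v) v
    simp only [add_sub_cancel_right] at h
    nlinarith [sq_nonneg (‖z + v‖ - ‖v‖), norm_nonneg z, norm_nonneg v, norm_nonneg (z + v)]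
  have : ‖v‖ ^ 2 / T + -‖z‖ ^ 2 / (2 * T) - -‖z + v‖ ^ 2 / T
     = (2 * ‖z + v‖ ^ 2 + 2 * ‖v‖ ^ 2 - ‖z‖ ^ 2) / (2 * T) := by field_simp; ring
  have h3 : 0 ≤ (2 * ‖z + v‖ ^ 2 + 2 * ‖v‖ ^ 2 - ‖z‖ ^ 2) / (2 * T) := by
    apply div_nonneg <;> linarith
  linarith

/-- product of Gaussians -/
lemma gs_mul_le {T : ℝ} (hT : 0 < T) (z w : E) :
    gs T z * gs T w ≤ gs (2 * T) z * gs (4 * T) (z + w) := by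
  unfold gs
  rw [← Real.exp_add, ← Real.exp_add]
  apply Real.exp_le_exp.2
  have h1 : ‖z + w‖ ^ 2 ≤ 2 * ‖z‖ ^ 2 + 2 * ‖w‖ ^ 2 := by
    have h := norm_add_le z w
    nlinarith [sq_nonneg (‖z‖ - ‖w‖), norm_nonneg z, norm_nonneg w, norm_nonneg (z + w)]
  have : -‖z‖ ^ 2 / (2 * T) + -‖z + w‖ ^ 2 / (4 * T) - (-‖z‖ ^ 2 / T + -‖w‖ ^ 2 / T)
     = (2 * ‖z‖ ^ 2 + 4 * ‖w‖ ^ 2 - ‖z + w‖ ^ 2) / (4 * T) := by field_simp; ring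
  have h3 : 0 ≤ (2 * ‖z‖ ^ 2 + 4 * ‖w‖ ^ 2 - ‖z + w‖ ^ 2) / (4 * T) := by
    apply div_nonneg
    · nlinarith [norm_nonneg w]
    · linarith
  linarith

/-- The quadratic form `‖z‖² + ‖s z‖²`. -/
def qf (s : E →L[ℝ] F) (z : E) : ℝ := ‖z‖ ^ 2 + ‖s z‖ ^ 2

/-- The polar form. -/
def qb (s : E →L[ℝ] F) (z h : E) : ℝ := inner ℝ z h + inner ℝ (s z) (s h)

lemma qf_add (s : E →L[ℝ] F) (z h : E) : qf s (z + h) = qf s z + 2 * qb s z h + qf s h := by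
  simp only [qf, qb, map_add]
  rw [norm_add_sq_real, norm_add_sq_real]; ring

lemma qb_neg (s : E →L[ℝ] F) (z h : E) : qb s z (-h) = - qb s z h := by
  simp only [qb, map_neg, inner_neg_right]; ring

lemma qf_neg (s : E →L[ℝ] F) (h : E) : qf s (-h) = qf s h := by
  simp [qf]

lemma qf_smul (s : E →L[ℝ] F) (c : ℝ) (h : E) : qf s (c • h) = c ^ 2 * qf s h := by
  simp only [qf, map_smul, norm_smul, mul_pow, Real.norm_eq_abs, sq_abs]; ring

lemma qb_smul (s : E →L[ℝ] F) (c : ℝ) (z h : E) : qb s z (c • h) = c * qb s z h := by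
  simp only [qb, map_smul, inner_smul_right]; ring

lemma qb_comm (s : E →L[ℝ] F) (z h : E) : qb s z h = qb s h z := by
  simp only [qb, real_inner_comm]

lemma le_qf (s : E →L[ℝ] F) (z : E) : ‖z‖ ^ 2 ≤ qf s z := by
  simp only [qf]; nlinarith [norm_nonneg (s z)]

lemma norm_s_le {s : E →L[ℝ] F} (hs : ‖s‖ ≤ 1) (z : E) : ‖s z‖ ≤ ‖z‖ :=
  (s.le_of_opNorm_le hs z).trans (by simp)

lemma qf_le {s : E →L[ℝ] F} (hs : ‖s‖ ≤ 1) (z : E) : qf s z ≤ 2 * ‖z‖ ^ 2 := by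
  have := norm_s_le hs z
  simp only [qf]; nlinarith [norm_nonneg (s z)]

lemma abs_qb_le {s : E →L[ℝ] F} (hs : ‖s‖ ≤ 1) (z h : E) : |qb s z h| ≤ 2 * ‖z‖ * ‖h‖ := by
  have h1 := abs_real_inner_le_norm z h
  have h2 := abs_real_inner_le_norm (s z) (s h)
  have h3 : ‖s z‖ * ‖s h‖ ≤ ‖z‖ * ‖h‖ := by
    gcongr <;> exact norm_s_le hs _
  calc |qb s z h| ≤ _ := abs_add_le _ _
    _ ≤ _ := by linarith

/-- Elliptic Gaussian kernel. -/
def kq (s : E →L[ℝ] F) (τ : ℝ) (z : E) : ℝ := Real.exp (-(qf s z) / τ)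

lemma kq_pos (s : E →L[ℝ] F) (τ : ℝ) (z : E) : 0 < kq s τ z := Real.exp_pos _

lemma kq_cont (s : E →L[ℝ] F) (τ : ℝ) : Continuous (kq s τ) := by
  unfold kq qf; fun_prop

lemma kq_le (s : E →L[ℝ] F) {τ : ℝ} (hτ : 0 < τ) (z : E) : kq s τ z ≤ gs τ z := by
  unfold kq gs
  apply Real.exp_le_exp.2
  have := le_qf s z
  gcongr

lemma le_kq {s : E →L[ℝ] F} (hs : ‖s‖ ≤ 1) {τ : ℝ} (hτ : 0 < τ) (z : E) :
    gs (τ / 2) z ≤ kq s τ z := by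
  unfold kq gs
  apply Real.exp_le_exp.2
  have := qf_le hs z
  rw [show -‖z‖ ^ 2 / (τ / 2) = -(2 * ‖z‖ ^ 2) / τ by field_simp]
  gcongr

lemma kq_neg (s : E →L[ℝ] F) (τ : ℝ) (z : E) : kq s τ (-z) = kq s τ z := by
  simp [kq, qf_neg]

lemma kq_add (s : E →L[ℝ] F) (τ : ℝ) (z h : E) :
    kq s τ (z + h) = kq s τ z * Real.exp (-(2 * qb s z h + qf s h) / τ) := by
  unfold kq
  rw [← Real.exp_add, qf_add]; congr 1; ring

lemma abs_exp_sub_one_le_mul (x : ℝ) : |Real.exp x - 1| ≤ |x| * Real.exp |x| := by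
  rcases le_total 0 x with h | h
  · rw [abs_of_nonneg h, abs_of_nonneg (by linarith [Real.one_le_exp h])]
    have h1 := Real.add_one_le_exp (-x)
    have h2 : Real.exp x * Real.exp (-x) = 1 := by rw [← Real.exp_add]; simp
    nlinarith [Real.exp_pos x]
  · rw [abs_of_nonpos h, abs_of_nonpos (by linarith [Real.exp_le_one_iff.2 h])]
    have h1 := Real.add_one_le_exp x
    have h3 : 1 ≤ Real.exp (-x) := Real.one_le_exp (by linarith)
    nlinarith

lemma kq_diff1 (τ : ℝ) (hτ : 0 < τ) : ∃ C : ℝ, 0 ≤ C ∧ ∀ (s : E →L[ℝ] F), ‖s‖ ≤ 1 →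
    ∀ h : E, ‖h‖ ≤ 1 → ∀ z : E, |kq s τ (z + h) - kq s τ z| ≤ C * ‖h‖ * gs (2 * τ) z := by
  obtain ⟨C0, hC0, h0⟩ := poly_gs (E := E) 0 (4 / τ) τ hτ
  obtain ⟨C1, hC1, h1⟩ := poly_gs (E := E) 1 (4 / τ) τ hτ
  refine ⟨(4 / τ * C1 + 2 / τ * C0) * Real.exp (2 / τ), by positivity, fun s hs h hh z => ?_⟩
  rw [kq_add]
  set x := -(2 * qb s z h + qf s h) / τ with hx
  have hxa : |x| ≤ (4 / τ * ‖z‖ + 2 / τ) * ‖h‖ := by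
    rw [hx, abs_div, abs_neg, abs_of_pos hτ, div_le_iff₀ hτ]
    have e : (4 / τ * ‖z‖ + 2 / τ) * ‖h‖ * τ = 4 * ‖z‖ * ‖h‖ + 2 * ‖h‖ := by field_simp
    rw [e]
    have a1 := abs_qb_le hs z h
    have a2 := qf_le hs h
    have a3 := le_qf s h
    calc |2 * qb s z h + qf s h| ≤ |2 * qb s z h| + |qf s h| := abs_add_le _ _
      _ ≤ 4 * ‖z‖ * ‖h‖ + 2 * ‖h‖ := by
        rw [abs_mul, abs_two, abs_of_nonneg (le_trans (sq_nonneg _) a3)]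
        nlinarith [norm_nonneg h]
  have hxb : |x| ≤ 4 / τ * ‖z‖ + 2 / τ := hxa.trans (by
    have : 0 ≤ 4 / τ * ‖z‖ + 2 / τ := by positivity
    nlinarith)
  have e1 : kq s τ z * Real.exp x - kq s τ z = kq s τ z * (Real.exp x - 1) := by ring
  rw [e1, abs_mul, abs_of_pos (kq_pos _ _ _)]
  have g0 := h0 z
  have g1 := h1 z
  simp only [pow_zero, one_mul, pow_one] at g0 g1
  calc kq s τ z * |Real.exp x - 1| ≤ gs τ z * (|x| * Real.exp |x|) := by
        exact mul_le_mul (kq_le s hτ z) (abs_exp_sub_one_le_mul x) (abs_nonneg _) (gs_pos _ _).le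
    _ ≤ gs τ z * (((4 / τ * ‖z‖ + 2 / τ) * ‖h‖) * Real.exp (4 / τ * ‖z‖ + 2 / τ)) := by
        have := (gs_pos τ z).le
        gcongr
    _ = ‖h‖ * Real.exp (2 / τ) * (4 / τ * (‖z‖ * Real.exp (4 / τ * ‖z‖) * gs τ z)
          + 2 / τ * (Real.exp (4 / τ * ‖z‖) * gs τ z)) := by rw [Real.exp_add]; ring
    _ ≤ ‖h‖ * Real.exp (2 / τ) * (4 / τ * (C1 * gs (2 * τ) z)
          + 2 / τ * (C0 * gs (2 * τ) z)) := by gcongr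
    _ = _ := by ring

lemma cosh_bound0 (c : ℝ) (hc : 0 ≤ c) :
    |Real.exp c + Real.exp (-c) - 2| ≤ c ^ 2 * Real.exp c := by
  have key : Real.exp c + Real.exp (-c) - 2 = Real.exp (-c) * (Real.exp c - 1) ^ 2 := by
    have e3 : Real.exp (-c) * Real.exp c = 1 := by rw [← Real.exp_add]; simp
    linear_combination (-Real.exp c + 2) * e3
  rw [key, abs_of_nonneg (by positivity)]
  have h3 := abs_exp_sub_one_le_mul c
  rw [abs_of_nonneg hc, abs_of_nonneg (by linarith [Real.one_le_exp hc])] at h3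
  have h4 : 0 ≤ Real.exp c - 1 := by linarith [Real.one_le_exp hc]
  calc Real.exp (-c) * (Real.exp c - 1)^2
      ≤ Real.exp (-c) * (c * Real.exp c) ^ 2 := by gcongr
    _ = c ^ 2 * Real.exp c := by
      have e3 : Real.exp (-c) * Real.exp c = 1 := by rw [← Real.exp_add]; simp
      linear_combination c ^ 2 * Real.exp c * e3

lemma cosh_bound (c : ℝ) : |Real.exp c + Real.exp (-c) - 2| ≤ c ^ 2 * Real.exp |c| := by
  rcases le_total 0 c with h | h
  · rw [abs_of_nonneg h]; exact cosh_bound0 c h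
  · have := cosh_bound0 (-c) (by linarith)
    rw [neg_neg, add_comm, neg_sq] at this
    rwa [abs_of_nonpos h]

lemma kq_diff2 (τ : ℝ) (hτ : 0 < τ) : ∃ C : ℝ, 0 ≤ C ∧ ∀ (s : E →L[ℝ] F), ‖s‖ ≤ 1 →
    ∀ h : E, ‖h‖ ≤ 1 → ∀ z : E,
    |kq s τ (z + h) + kq s τ (z - h) - 2 * kq s τ z| ≤ C * ‖h‖ ^ 2 * gs (2 * τ) z := by
  obtain ⟨C0, hC0, h0⟩ := poly_gs (E := E) 0 (4 / τ) τ hτ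
  obtain ⟨C2, hC2, h2⟩ := poly_gs (E := E) 2 (4 / τ) τ hτ
  refine ⟨16 / τ ^ 2 * C2 + 4 / τ * C0, by positivity, fun s hs h hh z => ?_⟩
  rw [sub_eq_add_neg z h, kq_add, kq_add, qb_neg, qf_neg]
  set c := 2 * qb s z h / τ with hc
  set q := qf s h / τ with hq
  have hca : |c| ≤ 4 / τ * ‖z‖ * ‖h‖ := by
    rw [hc, abs_div, abs_of_pos hτ, div_le_iff₀ hτ, abs_mul, abs_two]
    have e : 4 / τ * ‖z‖ * ‖h‖ * τ = 2 * (2 * ‖z‖ * ‖h‖) := by field_simp; ring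
    rw [e]
    gcongr
    exact abs_qb_le hs z h
  have hcb : |c| ≤ 4 / τ * ‖z‖ := hca.trans (by
    have : 0 ≤ 4 / τ * ‖z‖ := by positivity
    nlinarith)
  have hq0 : 0 ≤ q := by
    rw [hq]; exact div_nonneg ((sq_nonneg _).trans (le_qf s h)) hτ.le
  have hqb : q ≤ 2 / τ * ‖h‖ ^ 2 := by
    rw [hq, div_le_iff₀ hτ]
    have e : 2 / τ * ‖h‖ ^ 2 * τ = 2 * ‖h‖ ^ 2 := by field_simp
    rw [e]; exact qf_le hs h
  have e1 : kq s τ z * Real.exp (-(2 * qb s z h + qf s h) / τ) +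
      kq s τ z * Real.exp (-(2 * -qb s z h + qf s h) / τ) - 2 * kq s τ z
      = kq s τ z * (Real.exp (-q) * (Real.exp c + Real.exp (-c) - 2) + 2 * (Real.exp (-q) - 1)) := by
    have a1 : -(2 * qb s z h + qf s h) / τ = -q + -c := by rw [hc, hq]; ring
    have a2 : -(2 * -qb s z h + qf s h) / τ = -q + c := by rw [hc, hq]; ring
    rw [a1, a2, Real.exp_add, Real.exp_add]; ring
  rw [e1, abs_mul, abs_of_pos (kq_pos _ _ _)]
  have hE1 : Real.exp (-q) ≤ 1 := Real.exp_le_one_iff.2 (by linarith)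
  have hb : |Real.exp (-q) * (Real.exp c + Real.exp (-c) - 2) + 2 * (Real.exp (-q) - 1)|
      ≤ (16 / τ ^ 2 * ‖z‖ ^ 2 * ‖h‖ ^ 2 + 4 / τ * ‖h‖ ^ 2) * Real.exp (4 / τ * ‖z‖) := by
    have t1 : |Real.exp (-q) * (Real.exp c + Real.exp (-c) - 2)| ≤
        16 / τ ^ 2 * ‖z‖ ^ 2 * ‖h‖ ^ 2 * Real.exp (4 / τ * ‖z‖) := by
      rw [abs_mul, abs_of_pos (Real.exp_pos _)]
      calc Real.exp (-q) * |Real.exp c + Real.exp (-c) - 2|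
          ≤ 1 * (c ^ 2 * Real.exp |c|) := by
            gcongr
            exact cosh_bound c
        _ ≤ 1 * ((4 / τ * ‖z‖ * ‖h‖) ^ 2 * Real.exp (4 / τ * ‖z‖)) := by
            rw [← sq_abs c]
            gcongr
        _ = _ := by ring
    have t2 : |2 * (Real.exp (-q) - 1)| ≤ 4 / τ * ‖h‖ ^ 2 * Real.exp (4 / τ * ‖z‖) := by
      rw [abs_mul, abs_two, abs_of_nonpos (by linarith)]
      have t3 := Real.add_one_le_exp (-q)
      have t4 : 1 ≤ Real.exp (4 / τ * ‖z‖) := Real.one_le_exp (by positivity)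
      calc 2 * -(Real.exp (-q) - 1) ≤ 2 * q := by linarith
        _ ≤ 4 / τ * ‖h‖ ^ 2 := by
          have : 4 / τ * ‖h‖ ^ 2 = 2 * (2 / τ * ‖h‖ ^ 2) := by ring
          linarith
        _ ≤ _ := by
          have : 0 ≤ 4 / τ * ‖h‖ ^ 2 := by positivity
          nlinarith
    calc _ ≤ _ := abs_add_le _ _
      _ ≤ _ := add_le_add t1 t2
      _ = _ := by ring
  have g0 := h0 z
  have g2 := h2 z
  simp only [pow_zero, one_mul] at g0
  calc _ ≤ gs τ z * ((16 / τ ^ 2 * ‖z‖ ^ 2 * ‖h‖ ^ 2 + 4 / τ * ‖h‖ ^ 2) * Real.exp (4 / τ * ‖z‖)) := by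
        have := (gs_pos τ z).le
        gcongr
        exact kq_le s hτ z
    _ = ‖h‖ ^ 2 * (16 / τ ^ 2 * (‖z‖ ^ 2 * Real.exp (4 / τ * ‖z‖) * gs τ z)
          + 4 / τ * (Real.exp (4 / τ * ‖z‖) * gs τ z)) := by ring
    _ ≤ ‖h‖ ^ 2 * (16 / τ ^ 2 * (C2 * gs (2 * τ) z)
          + 4 / τ * (C0 * gs (2 * τ) z)) := by gcongr
    _ = _ := by ring


/-- A kernel with Gaussian bounds for itself and its first and second differences. -/
structure GK (C T : ℝ) (k : E → ℝ) : Prop where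
  hC : 0 ≤ C
  cont : Continuous k
  b0 : ∀ z, |k z| ≤ C * gs T z
  b1 : ∀ h : E, ‖h‖ ≤ 1 → ∀ z, |k (z + h) - k z| ≤ C * ‖h‖ * gs T z
  b2 : ∀ h : E, ‖h‖ ≤ 1 → ∀ z, |k (z + h) + k (z - h) - 2 * k z| ≤ C * ‖h‖ ^ 2 * gs T z

lemma GK.mono {C T C' T' : ℝ} {k : E → ℝ} (hk : GK C T k) (hC : C ≤ C') (hT0 : 0 < T)
    (hT : T ≤ T') : GK C' T' k := by
  have hc := hk.hC
  have hm := fun z : E => gs_mono hT0 hT z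
  have hp := fun z : E => (gs_pos T z).le
  refine ⟨hk.hC.trans hC, hk.cont, fun z => (hk.b0 z).trans ?_, fun h hh z => (hk.b1 h hh z).trans ?_,
    fun h hh z => (hk.b2 h hh z).trans ?_⟩
  · exact mul_le_mul hC (hm z) (hp z) (hc.trans hC)
  · exact mul_le_mul (by gcongr) (hm z) (hp z) (by have := hc.trans hC; positivity)
  · exact mul_le_mul (by gcongr) (hm z) (hp z) (by have := hc.trans hC; positivity)

lemma GK.smul {C T : ℝ} {k : E → ℝ} (hk : GK C T k) (c : ℝ) : GK (|c| * C) T (fun z => c * k z) := by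
  refine ⟨mul_nonneg (abs_nonneg _) hk.hC, hk.cont.const_mul c, fun z => ?_, fun h hh z => ?_,
    fun h hh z => ?_⟩
  · rw [abs_mul, mul_assoc]
    exact mul_le_mul_of_nonneg_left (hk.b0 z) (abs_nonneg _)
  · rw [← mul_sub, abs_mul, mul_assoc, mul_assoc, ← mul_assoc C]
    exact mul_le_mul_of_nonneg_left (hk.b1 h hh z) (abs_nonneg _)
  · rw [show c * k (z + h) + c * k (z - h) - 2 * (c * k z) = c * (k (z + h) + k (z - h) - 2 * k z) by ring,
      abs_mul, mul_assoc, mul_assoc, ← mul_assoc C]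
    exact mul_le_mul_of_nonneg_left (hk.b2 h hh z) (abs_nonneg _)

lemma GK.add {C C' T : ℝ} {k k' : E → ℝ} (hk : GK C T k) (hk' : GK C' T k') :
    GK (C + C') T (fun z => k z + k' z) := by
  refine ⟨add_nonneg hk.hC hk'.hC, hk.cont.add hk'.cont, fun z => ?_, fun h hh z => ?_,
    fun h hh z => ?_⟩
  · refine (abs_add_le _ _).trans ((add_le_add (hk.b0 z) (hk'.b0 z)).trans (le_of_eq (by ring)))
  · rw [show k (z + h) + k' (z + h) - (k z + k' z) = (k (z + h) - k z) + (k' (z + h) - k' z) by ring]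
    refine (abs_add_le _ _).trans ((add_le_add (hk.b1 h hh z) (hk'.b1 h hh z)).trans (le_of_eq (by ring)))
  · rw [show k (z + h) + k' (z + h) + (k (z - h) + k' (z - h)) - 2 * (k z + k' z)
      = (k (z + h) + k (z - h) - 2 * k z) + (k' (z + h) + k' (z - h) - 2 * k' z) by ring]
    refine (abs_add_le _ _).trans ((add_le_add (hk.b2 h hh z) (hk'.b2 h hh z)).trans (le_of_eq (by ring)))

lemma kq_GK (τ : ℝ) (hτ : 0 < τ) : ∃ C : ℝ, 0 ≤ C ∧ ∀ (s : E →L[ℝ] F), ‖s‖ ≤ 1 →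
    GK C (2 * τ) (kq s τ) := by
  obtain ⟨C1, hC1, h1⟩ := kq_diff1 (E := E) (F := F) τ hτ
  obtain ⟨C2, hC2, h2⟩ := kq_diff2 (E := E) (F := F) τ hτ
  refine ⟨1 + C1 + C2, by positivity, fun s hs => ⟨by positivity, kq_cont s τ, fun z => ?_,
    fun h hh z => (h1 s hs h hh z).trans ?_, fun h hh z => (h2 s hs h hh z).trans ?_⟩⟩
  · rw [abs_of_pos (kq_pos _ _ _)]
    refine (kq_le s hτ z).trans ((gs_mono (T' := 2 * τ) hτ (by linarith) z).trans ?_)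
    have := gs_pos (2 * τ) z
    nlinarith
  · have := (gs_pos (2 * τ) z).le
    gcongr; linarith
  · have := (gs_pos (2 * τ) z).le
    gcongr; linarith

lemma GK.integ {C T : ℝ} {k : E → ℝ} (hk : GK C T k) (ρ : Measure E) {f : E → F}
    (hf : AEStronglyMeasurable f ρ) (hi : Integrable (fun y => gs T y * ‖f y‖) ρ) (h : E) (hh : ‖h‖ ≤ 1) : Integrable (fun y => k (h - y) • f y) ρ := by
  refine (hi.const_mul (2 * C)).mono' ?_ (Filter.Eventually.of_forall fun y => ?_)
  · have : Continuous fun y => k (h - y) := hk.cont.comp (by fun_prop)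
    exact this.aestronglyMeasurable.smul hf
  · have h0 := hk.b0 (-y)
    have h1 := hk.b1 h hh (-y)
    rw [gs_neg] at h0 h1
    rw [show -y + h = h - y by abel] at h1
    rw [norm_smul, Real.norm_eq_abs, ← mul_assoc]
    refine mul_le_mul_of_nonneg_right ?_ (norm_nonneg _)
    have : |k (h - y)| ≤ |k (h - y) - k (-y)| + |k (-y)| := by
      have := abs_add_le (k (h - y) - k (-y)) (k (-y)); simpa using this
    have hg := gs_pos T y
    have : C * ‖h‖ * gs T y ≤ C * gs T y := by
      have := mul_nonneg hk.hC hg.le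
      nlinarith
    linarith

lemma GK.conv0 {C T : ℝ} {k : E → ℝ} (hk : GK C T k) (ρ : Measure E) {f : E → F}
    (hf : AEStronglyMeasurable f ρ) (hi : Integrable (fun y => gs T y * ‖f y‖) ρ) : ‖∫ y, k (0 - y) • f y ∂ρ‖ ≤ C * ∫ y, gs T y * ‖f y‖ ∂ρ := by
  rw [← integral_const_mul]
  refine norm_integral_le_of_norm_le (hi.const_mul _) (Filter.Eventually.of_forall fun y => ?_)
  rw [norm_smul, Real.norm_eq_abs, ← mul_assoc, zero_sub]
  have := hk.b0 (-y)
  rw [gs_neg] at this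
  exact mul_le_mul_of_nonneg_right this (norm_nonneg _)

lemma GK.conv1 {C T : ℝ} {k : E → ℝ} (hk : GK C T k) (ρ : Measure E) {f : E → F}
    (hf : AEStronglyMeasurable f ρ) (hi : Integrable (fun y => gs T y * ‖f y‖) ρ) (h : E) (hh : ‖h‖ ≤ 1) :
    ‖(∫ y, k (h - y) • f y ∂ρ) - ∫ y, k (0 - y) • f y ∂ρ‖ ≤ C * ‖h‖ * ∫ y, gs T y * ‖f y‖ ∂ρ := by
  rw [← integral_sub (hk.integ ρ hf hi h hh) (hk.integ ρ hf hi 0 (by simp)), ← integral_const_mul]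
  refine norm_integral_le_of_norm_le (hi.const_mul _) (Filter.Eventually.of_forall fun y => ?_)
  rw [← sub_smul, norm_smul, Real.norm_eq_abs, ← mul_assoc, zero_sub]
  have := hk.b1 h hh (-y)
  rw [gs_neg, show -y + h = h - y by abel] at this
  exact mul_le_mul_of_nonneg_right this (norm_nonneg _)

lemma GK.conv2 {C T : ℝ} {k : E → ℝ} (hk : GK C T k) (ρ : Measure E) {f : E → F}
    (hf : AEStronglyMeasurable f ρ) (hi : Integrable (fun y => gs T y * ‖f y‖) ρ) (h : E) (hh : ‖h‖ ≤ 1) :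
    ‖(∫ y, k (h - y) • f y ∂ρ) + (∫ y, k (-h - y) • f y ∂ρ) - (2 : ℝ) • ∫ y, k (0 - y) • f y ∂ρ‖
      ≤ C * ‖h‖ ^ 2 * ∫ y, gs T y * ‖f y‖ ∂ρ := by
  have i1 := hk.integ ρ hf hi h hh
  have i2 := hk.integ ρ hf hi (-h) (by simpa using hh)
  have i3 := hk.integ ρ hf hi 0 (by simp)
  have e0 : (∫ y, k (h - y) • f y ∂ρ) + (∫ y, k (-h - y) • f y ∂ρ) - (2 : ℝ) • ∫ y, k (0 - y) • f y ∂ρ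
      = ∫ y, (k (h - y) • f y + k (-h - y) • f y - (2:ℝ) • k (0 - y) • f y) ∂ρ := by
    rw [integral_sub (f := fun y => k (h - y) • f y + k (-h - y) • f y)
      (g := fun y => (2:ℝ) • k (0 - y) • f y) (i1.add i2) (i3.smul _), integral_add i1 i2,
      integral_smul]
  rw [e0, ← integral_const_mul]
  refine norm_integral_le_of_norm_le (hi.const_mul _) (Filter.Eventually.of_forall fun y => ?_)
  have e : k (h - y) • f y + k (-h - y) • f y - (2:ℝ) • k (0 - y) • f y
    = (k (h - y) + k (-h - y) - 2 * k (-y)) • f y := by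
    rw [zero_sub]; module
  rw [e, norm_smul, Real.norm_eq_abs, ← mul_assoc]
  have := hk.b2 h hh (-y)
  rw [gs_neg, show -y + h = h - y by abel, show -y - h = -h - y by abel] at this
  exact mul_le_mul_of_nonneg_right this (norm_nonneg _)

lemma integ_dom {K : ℝ≥0} {ν : Measure E} (hν : ν ≤ K • volume) {G : Type*} [NormedAddCommGroup G]
    {f : E → G} (hf : Integrable f) : Integrable f ν :=
  (hf.smul_measure_nnreal (c := K)).mono_measure hν

lemma integral_dom {K : ℝ≥0} {ν : Measure E} (hν : ν ≤ K • volume) {f : E → ℝ} (h0 : ∀ y, 0 ≤ f y)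
    (hf : Integrable f) : ∫ y, f y ∂ν ≤ K * ∫ y, f y := by
  have := integral_mono_measure hν (Filter.Eventually.of_forall h0) (hf.smul_measure_nnreal (c := K))
  rwa [integral_smul_nnreal_measure, NNReal.smul_def, smul_eq_mul] at this

/-- Gaussian times affine growth is integrable. -/
lemma gs_growth {T : ℝ} (hT : 0 < T) {G : Type*} [NormedAddCommGroup G] {f : E → G}
    (hf : Continuous f) {C : ℝ} (hb : ∀ y, ‖f y‖ ≤ C * (1 + ‖y‖)) :
    Integrable (fun y => gs T y * ‖f y‖) := by
  obtain ⟨C1, hC1, h1⟩ := poly_gs (E := E) 1 0 T hT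
  have i := ((gs_integrable (E := E) hT).const_mul C).add
    ((gs_integrable (E := E) (T := 2 * T) (by linarith)).const_mul (C * C1))
  have hC : 0 ≤ C := by have := (norm_nonneg _).trans (hb 0); simpa using this
  refine i.mono' ?_ (Filter.Eventually.of_forall fun y => ?_)
  · exact ((gs_cont T).mul hf.norm).aestronglyMeasurable
  · have g := gs_pos T y
    have h1y := h1 y
    simp only [pow_one, zero_mul, Real.exp_zero, mul_one] at h1y
    rw [Real.norm_of_nonneg (by positivity)]
    calc gs T y * ‖f y‖ ≤ gs T y * (C * (1 + ‖y‖)) := by gcongr; exact hb y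
      _ = C * gs T y + C * (‖y‖ * gs T y) := by ring
      _ ≤ C * gs T y + C * (C1 * gs (2 * T) y) := by gcongr
      _ = _ := by simp only [Pi.add_apply]; ring


/-- Gaussian truncations of the transversal transform. -/
def FG (A : E → F) (ν : Measure E) (τ : ℝ) (x : E) : F :=
  ∫ y, Real.exp (-(‖x - y‖ ^ 2 + ‖A x - A y‖ ^ 2) / τ) • (A x - A y) ∂ν

/-- the constant `2^{-n-1}` -/
def cD (E : Type*) [NormedAddCommGroup E] [InnerProductSpace ℝ E] : ℝ :=
  ((2 : ℝ) ^ (Module.finrank ℝ E + 1))⁻¹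

lemma cD_pos : 0 < cD E := by unfold cD; positivity

lemma cD_le : cD E ≤ 1 := by
  unfold cD
  exact inv_le_one_of_one_le₀ (one_le_pow₀ (by norm_num))

/-- Two-scale combination. -/
def FD (A : E → F) (ν : Measure E) (τ : ℝ) (x : E) : F :=
  FG A ν τ x - cD E • FG A ν (4 * τ) x

/-- Standing hypotheses at a point (the origin). -/
structure Su (K : ℝ≥0) (ν : Measure E) (ε : ℝ) (A : E → F) (s : E →L[ℝ] F) : Prop where
  hν : ν ≤ K • volume
  hν' : volume ≤ K • ν
  ε0 : 0 ≤ ε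
  ε1 : ε ≤ 1
  lip : ∀ x y, ‖A x - A y‖ ≤ ε * ‖x - y‖
  hs : ‖s‖ ≤ ε
  A0 : A 0 = 0

/-- deviation from the linear map -/
def av (A : E → F) (s : E →L[ℝ] F) (y : E) : F := A y - s y

def Wf (s : E →L[ℝ] F) (ν : Measure E) (τ : ℝ) (x : E) : ℝ := ∫ y, kq s τ (x - y) ∂ν
def Vf (A : E → F) (s : E →L[ℝ] F) (ν : Measure E) (τ : ℝ) (x : E) : F :=
  ∫ y, kq s τ (x - y) • av A s y ∂ν
def bf (s : E →L[ℝ] F) (ν : Measure E) (τ : ℝ) (x : E) : F :=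
  ∫ y, kq s τ (x - y) • s (x - y) ∂ν
def ef (A : E → F) (s : E →L[ℝ] F) (ν : Measure E) (τ : ℝ) (x : E) : F :=
  FG A ν τ x - Wf s ν τ x • av A s x + Vf A s ν τ x - bf s ν τ x
def Mf (A : E → F) (s : E →L[ℝ] F) (T : ℝ) (x : E) : ℝ := ∫ y, gs T (x - y) * ‖av A s y‖

section
variable {K : ℝ≥0} {ν : Measure E} {ε : ℝ} {A : E → F} {s : E →L[ℝ] F}

lemma lip_cont (h : ∀ x y, ‖A x - A y‖ ≤ ε * ‖x - y‖) : Continuous A := by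
  have : LipschitzWith ε.toNNReal A := LipschitzWith.of_dist_le_mul fun x y => by
    rw [dist_eq_norm, dist_eq_norm]
    exact (h x y).trans (mul_le_mul_of_nonneg_right (Real.le_coe_toNNReal ε) (norm_nonneg _))
  exact this.continuous

lemma Su.contA (h : Su K ν ε A s) : Continuous A := lip_cont h.lip

lemma Su.conta (h : Su K ν ε A s) : Continuous (av A s) := by
  have := h.contA
  unfold av; fun_prop

lemma Su.hs1 (h : Su K ν ε A s) : ‖s‖ ≤ 1 := h.hs.trans h.ε1

lemma Su.nA (h : Su K ν ε A s) (y : E) : ‖A y‖ ≤ ‖y‖ := by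
  have := h.lip y 0
  rw [h.A0, sub_zero, sub_zero] at this
  nlinarith [h.ε1, norm_nonneg y]

lemma Su.na (h : Su K ν ε A s) (y : E) : ‖av A s y‖ ≤ 2 * (1 + ‖y‖) := by
  have h1 := norm_sub_le (A y) (s y)
  have h2 := norm_s_le h.hs1 y
  have h3 := h.nA y
  unfold av; linarith

lemma Su.a0 (h : Su K ν ε A s) : av A s 0 = 0 := by simp [av, h.A0]

/-- integrability of a Gaussian kernel against something of affine growth -/
lemma conv_integrable {T C C' : ℝ} (hT : 0 < T) {k : E → ℝ} (hk : Continuous k)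
    (hkb : ∀ z, |k z| ≤ C * gs T z) {f : E → F} (hf : Continuous f)
    (hb : ∀ y, ‖f y‖ ≤ C' * (1 + ‖y‖)) (x : E) : Integrable (fun y => k (x - y) • f y) := by
  have i := gs_growth (T := 2 * T) (by linarith) hf hb
  have hC : 0 ≤ C := by
    have := (abs_nonneg _).trans (hkb 0)
    exact nonneg_of_mul_nonneg_left this (gs_pos _ _)
  refine (i.const_mul (C * Real.exp (‖x‖ ^ 2 / T))).mono' ?_ (Filter.Eventually.of_forall fun y => ?_)
  · have : Continuous fun y => k (x - y) := hk.comp (by fun_prop)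
    exact (this.smul hf).aestronglyMeasurable
  · rw [norm_smul, Real.norm_eq_abs]
    have h1 := hkb (x - y)
    have h2 := gs_shift hT (-y) x
    rw [gs_neg, show -y + x = x - y by abel] at h2
    calc |k (x - y)| * ‖f y‖ ≤ (C * (Real.exp (‖x‖ ^ 2 / T) * gs (2 * T) y)) * ‖f y‖ := by
          gcongr
          exact h1.trans (by gcongr)
      _ = _ := by ring

lemma affine_of_norm {f : E → F} {C C' : ℝ} (hC : 0 ≤ C) (hC' : 0 ≤ C') (h : ∀ y, ‖f y‖ ≤ C + C' * ‖y‖) (y : E) :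
    ‖f y‖ ≤ (C + C') * (1 + ‖y‖) := by
  have := h y
  nlinarith [norm_nonneg y, mul_nonneg hC (norm_nonneg y)]

lemma kq_abs_le (s : E →L[ℝ] F) {τ : ℝ} (hτ : 0 < τ) (z : E) : |kq s τ z| ≤ 1 * gs τ z := by
  rw [abs_of_pos (kq_pos _ _ _), one_mul]; exact kq_le s hτ z

lemma kq_integrable (s : E →L[ℝ] F) {τ : ℝ} (hτ : 0 < τ) (x : E) :
    Integrable (fun y => kq s τ (x - y)) := by
  have h := conv_integrable (F := ℝ) hτ (kq_cont s τ) (kq_abs_le s hτ) (f := fun _ => (1:ℝ)) (C' := 1)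
    continuous_const (fun y => by simp) x
  simpa using h

lemma kqs_integrable (s : E →L[ℝ] F) {τ : ℝ} (hτ : 0 < τ) (x : E) :
    Integrable (fun y => kq s τ (x - y) • s (x - y)) := by
  refine conv_integrable hτ (kq_cont s τ) (kq_abs_le s hτ) (f := fun y => s (x - y))
    (C' := ‖s‖ * ‖x‖ + ‖s‖) (by fun_prop) ?_ x
  refine affine_of_norm (by positivity) (by positivity) fun y => ?_
  have h1 := s.le_opNorm (x - y)
  have h2 := norm_sub_le x y
  nlinarith [norm_nonneg s]

lemma Su.kqa_integrable (h : Su K ν ε A s) {τ : ℝ} (hτ : 0 < τ) (x : E) :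
    Integrable (fun y => kq s τ (x - y) • av A s y) :=
  conv_integrable hτ (kq_cont s τ) (kq_abs_le s hτ) h.conta h.na x

lemma Su.M_integrable (h : Su K ν ε A s) {T : ℝ} (hT : 0 < T) (x : E) :
    Integrable (fun y => gs T (x - y) * ‖av A s y‖) := by
  have := conv_integrable (F := ℝ) (C := 1) hT (gs_cont T) (fun z => by
    rw [abs_of_pos (gs_pos _ _), one_mul]) (f := fun y => ‖av A s y‖) h.conta.norm
    (fun y => by rw [norm_norm]; exact h.na y) x
  simpa using this

lemma abs_exp_neg_sub (p q m : ℝ) (hp : m ≤ p) (hq : m ≤ q) :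
    |Real.exp (-p) - Real.exp (-q)| ≤ |p - q| * Real.exp (-m) := by
  wlog hpq : p ≤ q generalizing p q
  · rw [abs_sub_comm, abs_sub_comm p q]
    exact this q p hq hp (by linarith)
  have h1 : Real.exp (-q) ≤ Real.exp (-p) := Real.exp_le_exp.2 (by linarith)
  have h2 : Real.exp (-p) ≤ Real.exp (-m) := Real.exp_le_exp.2 (by linarith)
  rw [abs_of_nonneg (by linarith), abs_of_nonpos (by linarith)]
  have h3 : Real.exp (-q) = Real.exp (-p) * Real.exp (p - q) := by rw [← Real.exp_add]; ring_nf
  have h4 := Real.add_one_le_exp (p - q)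
  rw [h3]
  have := Real.exp_pos (-p)
  nlinarith

lemma Su.ker_diff (h : Su K ν ε A s) {τ : ℝ} (hτ : 0 < τ) (x y : E) :
    |Real.exp (-(‖x - y‖ ^ 2 + ‖A x - A y‖ ^ 2) / τ) - kq s τ (x - y)| ≤
      2 / τ * ε * ‖x - y‖ * (‖av A s x‖ + ‖av A s y‖) * gs τ (x - y) := by
  set z := x - y with hz
  have hA : A x - A y = s z + (av A s x - av A s y) := by
    simp only [av, hz, map_sub]; abel
  set al := av A s x - av A s y with hal
  have haln : ‖al‖ ≤ ‖av A s x‖ + ‖av A s y‖ := norm_sub_le _ _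
  have hL := h.lip x y
  rw [← hz] at hL
  have hsz : ‖s z‖ ≤ ε * ‖z‖ := s.le_of_opNorm_le h.hs z
  unfold kq gs
  rw [neg_div, neg_div, neg_div]
  refine (abs_exp_neg_sub _ _ (‖z‖ ^ 2 / τ) ?_ ?_).trans ?_
  · gcongr; nlinarith [norm_nonneg (A x - A y)]
  · gcongr; exact le_qf s z
  · refine mul_le_mul_of_nonneg_right ?_ (Real.exp_pos _).le
    rw [← sub_div, abs_div, abs_of_pos hτ, div_le_iff₀ hτ]
    have e : 2 / τ * ε * ‖z‖ * (‖av A s x‖ + ‖av A s y‖) * τ =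
      2 * ε * ‖z‖ * (‖av A s x‖ + ‖av A s y‖) := by field_simp
    rw [e]
    have e2 : ‖z‖ ^ 2 + ‖A x - A y‖ ^ 2 - qf s z = (‖A x - A y‖ - ‖s z‖) * (‖A x - A y‖ + ‖s z‖) := by
      simp only [qf]; ring
    rw [e2, abs_mul]
    have h5 : |‖A x - A y‖ - ‖s z‖| ≤ ‖al‖ := by
      have := abs_norm_sub_norm_le (A x - A y) (s z)
      rwa [hA, add_sub_cancel_left, ← hA] at this
    have h6 : |‖A x - A y‖ + ‖s z‖| ≤ 2 * ε * ‖z‖ := by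
      rw [abs_of_nonneg (by positivity)]; linarith
    calc |‖A x - A y‖ - ‖s z‖| * |‖A x - A y‖ + ‖s z‖| ≤ (‖av A s x‖ + ‖av A s y‖) * (2 * ε * ‖z‖) := by
          apply mul_le_mul (h5.trans haln) h6 (abs_nonneg _) (by positivity)
      _ = _ := by ring

lemma Su.FG_integrable (h : Su K ν ε A s) {τ : ℝ} (hτ : 0 < τ) (x : E) :
    Integrable (fun y => Real.exp (-(‖x - y‖ ^ 2 + ‖A x - A y‖ ^ 2) / τ) • (A x - A y)) := by
  have hc := h.contA
  have i := conv_integrable (F := F) (C := 1) hτ (gs_cont τ) (fun z => by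
    rw [abs_of_pos (gs_pos _ _), one_mul]) (f := fun y => A x - A y) (by fun_prop)
    (C' := ‖A x‖ + 1) (affine_of_norm (norm_nonneg _) zero_le_one fun y => by
      have := norm_sub_le (A x) (A y)
      have := h.nA y
      linarith) x
  refine i.norm.mono' ?_ (Filter.Eventually.of_forall fun y => ?_)
  · apply Continuous.aestronglyMeasurable; fun_prop
  · rw [norm_smul, norm_smul]
    refine mul_le_mul_of_nonneg_right ?_ (norm_nonneg _)
    rw [Real.norm_of_nonneg (Real.exp_pos _).le, Real.norm_of_nonneg (gs_pos _ _).le]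
    unfold gs
    apply Real.exp_le_exp.2
    gcongr
    nlinarith [norm_nonneg (A x - A y)]

lemma gs_int_sub (T : ℝ) (x : E) : ∫ y, gs T (x - y) = ∫ y : E, gs T y :=
  integral_sub_left_eq_self (fun y => gs T y) volume x

lemma Su.ef_bound (K : ℝ≥0) (τ : ℝ) (hτ : 0 < τ) : ∃ C : ℝ, 0 ≤ C ∧
    ∀ (ν : Measure E) (ε : ℝ) (A : E → F) (s : E →L[ℝ] F), Su K ν ε A s → ∀ x,
    ‖ef A s ν τ x‖ ≤ C * ε ^ 2 * (‖av A s x‖ + Mf A s (2 * τ) x) := by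
  obtain ⟨C2, hC2, h2⟩ := poly_gs (E := E) 2 0 τ hτ
  set J := ∫ y : E, gs (2 * τ) y with hJ
  have hJ0 : 0 ≤ J := integral_nonneg fun y => (gs_pos _ _).le
  refine ⟨2 / τ * C2 * K * (J + 1), by positivity, fun ν ε A s h x => ?_⟩
  have hε := h.ε0
  have i1 := integ_dom h.hν (h.FG_integrable hτ x)
  have i2 : Integrable (fun y => kq s τ (x - y) • av A s x) ν :=
    (integ_dom h.hν (kq_integrable s hτ x)).smul_const _
  have i3 := integ_dom h.hν (h.kqa_integrable hτ x)
  have i4 := integ_dom h.hν (kqs_integrable s hτ x)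
  have e : ef A s ν τ x = ∫ y, (Real.exp (-(‖x - y‖ ^ 2 + ‖A x - A y‖ ^ 2) / τ) - kq s τ (x - y)) •
      (A x - A y) ∂ν := by
    unfold ef FG Wf Vf bf
    rw [← integral_smul_const, ← integral_sub' i1 i2]
    rw [← integral_add' (i1.sub i2) i3]
    rw [← integral_sub' ((i1.sub i2).add i3) i4]
    congr 1; ext y
    simp only [Pi.sub_apply, Pi.add_apply, av, map_sub]
    module
  rw [e]
  have im : Integrable (fun y => gs (2 * τ) (x - y) * (‖av A s x‖ + ‖av A s y‖)) := by
    have := ((kq_integrable (0 : E →L[ℝ] F) (τ := 2 * τ) (by linarith) x).mul_const ‖av A s x‖).add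
      (h.M_integrable (T := 2 * τ) (by linarith) x)
    refine this.congr (Filter.Eventually.of_forall fun y => ?_)
    simp [kq, qf, gs]; ring
  have hle : ‖∫ y, (Real.exp (-(‖x - y‖ ^ 2 + ‖A x - A y‖ ^ 2) / τ) - kq s τ (x - y)) •
      (A x - A y) ∂ν‖ ≤ ∫ y, 2 / τ * C2 * ε ^ 2 * (gs (2 * τ) (x - y) * (‖av A s x‖ + ‖av A s y‖)) ∂ν := by
    refine norm_integral_le_of_norm_le ((integ_dom h.hν im).const_mul _)
      (Filter.Eventually.of_forall fun y => ?_)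
    rw [norm_smul, Real.norm_eq_abs]
    have g2 := h2 (x - y)
    simp only [zero_mul, Real.exp_zero, mul_one] at g2
    calc _ ≤ (2 / τ * ε * ‖x - y‖ * (‖av A s x‖ + ‖av A s y‖) * gs τ (x - y)) * (ε * ‖x - y‖) := by
          apply mul_le_mul (h.ker_diff hτ x y) (h.lip x y) (norm_nonneg _)
          have := (gs_pos τ (x - y)).le
          positivity
      _ = 2 / τ * ε ^ 2 * (‖av A s x‖ + ‖av A s y‖) * (‖x - y‖ ^ 2 * gs τ (x - y)) := by ring
      _ ≤ 2 / τ * ε ^ 2 * (‖av A s x‖ + ‖av A s y‖) * (C2 * gs (2 * τ) (x - y)) := by gcongr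
      _ = _ := by ring
  refine hle.trans ?_
  rw [integral_const_mul]
  have h7 := integral_dom h.hν (f := fun y => gs (2 * τ) (x - y) * (‖av A s x‖ + ‖av A s y‖))
    (fun y => by have := (gs_pos (2 * τ) (x - y)).le; positivity) im
  have h8 : ∫ y, gs (2 * τ) (x - y) * (‖av A s x‖ + ‖av A s y‖) = J * ‖av A s x‖ + Mf A s (2 * τ) x := by
    rw [hJ, ← gs_int_sub _ x, Mf, ← integral_mul_const, ← integral_add]
    · congr 1; ext y; ring
    · apply Integrable.mul_const
      have := kq_integrable (0 : E →L[ℝ] F) (τ := 2 * τ) (by linarith) x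
      refine this.congr (Filter.Eventually.of_forall fun y => ?_)
      simp [kq, qf, gs]
    · exact h.M_integrable (by linarith) x
  rw [h8] at h7
  have hM : 0 ≤ Mf A s (2 * τ) x := integral_nonneg fun y => by
    have := (gs_pos (2 * τ) (x - y)).le; positivity
  calc _ ≤ 2 / τ * C2 * ε ^ 2 * (K * (J * ‖av A s x‖ + Mf A s (2 * τ) x)) := by gcongr
    _ ≤ 2 / τ * C2 * ε ^ 2 * (K * ((J + 1) * ‖av A s x‖ + (J + 1) * Mf A s (2 * τ) x)) := by
      gcongr
      · linarith
      · nlinarith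
    _ = _ := by ring
end


lemma isml {α : Type*} [MeasurableSpace α] {μ : Measure α} {f : α → F} (c : ℝ) (hf : Integrable f μ) :
    Integrable (fun y => c • f y) μ := hf.smul c

/-- mass of the elliptic Gaussian -/
def Jq (s : E →L[ℝ] F) (σ : ℝ) : ℝ := ∫ z, kq s σ z

/-- scaling weight -/
def pw (E : Type*) [NormedAddCommGroup E] [InnerProductSpace ℝ E] (τ : ℝ) : ℝ :=
  τ * (Real.sqrt τ) ^ (Module.finrank ℝ E)

lemma pw_pos {τ : ℝ} (h : 0 < τ) : 0 < pw E τ := by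
  unfold pw; have := Real.sqrt_pos.2 h; positivity

lemma pw_four {τ : ℝ} (h : 0 < τ) : cD E * pw E (4 * τ) = 2 * pw E τ := by
  unfold cD pw
  rw [Real.sqrt_mul (by norm_num), show (4:ℝ) = 2 ^ 2 by norm_num, Real.sqrt_sq (by norm_num), mul_pow,
    pow_succ]
  field_simp

lemma kq_int0 (s : E →L[ℝ] F) {τ : ℝ} (hτ : 0 < τ) : Integrable (kq s τ) := by
  refine (gs_integrable hτ).mono' (kq_cont s τ).aestronglyMeasurable
    (Filter.Eventually.of_forall fun z => ?_)
  rw [Real.norm_eq_abs]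
  simpa using kq_abs_le s hτ z

lemma Jq_ge {s : E →L[ℝ] F} (hs : ‖s‖ ≤ 1) {σ : ℝ} (hσ : 0 < σ) :
    ∫ z : E, gs (σ / 2) z ≤ Jq s σ :=
  integral_mono (gs_integrable (by linarith)) (kq_int0 s hσ) fun z => le_kq hs hσ z

lemma gsint_pos {σ : ℝ} (hσ : 0 < σ) : 0 < ∫ z : E, gs σ z := by
  rw [integral_pos_iff_support_of_nonneg (fun z => (gs_pos _ _).le) (gs_integrable hσ)]
  have : Function.support (gs σ : E → ℝ) = univ := by
    ext z; simp [(gs_pos σ z).ne']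
  rw [this]
  exact isOpen_univ.measure_pos _ univ_nonempty

lemma Jq_scale (s : E →L[ℝ] F) {σ : ℝ} (hσ : 0 < σ) :
    Jq s σ = (Real.sqrt σ) ^ (Module.finrank ℝ E) * Jq s 1 := by
  have hq := Real.sqrt_pos.2 hσ
  have h := Measure.integral_comp_smul (volume : Measure E) (kq s σ) (Real.sqrt σ)
  have e : ∀ z, kq s σ (Real.sqrt σ • z) = kq s 1 z := fun z => by
    unfold kq
    rw [qf_smul, Real.sq_sqrt hσ.le]
    congr 1; field_simp
  simp only [e, smul_eq_mul] at h
  unfold Jq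
  rw [h, abs_of_pos (by positivity)]
  field_simp

lemma kq_square (s : E →L[ℝ] F) {σ τ : ℝ} (hσ : 0 < σ) (hτ : 0 < τ) (z u : E) :
    kq s σ (z - u) * kq s τ u
      = kq s (σ + τ) z * kq s (σ * τ / (σ + τ)) (u - (τ / (σ + τ)) • z) := by
  unfold kq
  rw [← Real.exp_add, ← Real.exp_add]
  congr 1
  have hst : 0 < σ + τ := by linarith
  rw [sub_eq_add_neg z u, sub_eq_add_neg u, qf_add, qf_add, qb_neg, qf_neg, qf_neg, qf_smul, qb_neg,
    qb_smul, qb_comm s u z]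
  field_simp
  ring

lemma kq_s_odd (s : E →L[ℝ] F) (τ : ℝ) : ∫ v, kq s τ v • s v = 0 := by
  have h := integral_neg_eq_self (fun v => kq s τ v • s v) volume
  simp only [kq_neg, map_neg, smul_neg, integral_neg] at h
  have h2 : (2:ℝ) • ∫ v, kq s τ v • s v = 0 := by
    rw [two_smul]; nth_rewrite 1 [← h]; simp
  exact (smul_eq_zero.1 h2).resolve_left two_ne_zero

lemma kq_s_int (s : E →L[ℝ] F) {τ : ℝ} (hτ : 0 < τ) : Integrable fun v => kq s τ v • s v := by
  have := (kqs_integrable s hτ 0).neg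
  refine this.congr (Filter.Eventually.of_forall fun v => ?_)
  simp [kq_neg]

lemma inner_conv (s : E →L[ℝ] F) {σ τ : ℝ} (hσ : 0 < σ) (hτ : 0 < τ) (z w : E) :
    ∫ y, kq s σ (z - y) • kq s τ (y - w) • s (y - w)
      = (Jq s σ * pw E τ / pw E (σ + τ)) • kq s (σ + τ) (z - w) • s (z - w) := by
  have hst : 0 < σ + τ := by linarith
  have hpi : 0 < σ * τ / (σ + τ) := by positivity
  rw [← integral_add_right_eq_self _ w]
  simp only [add_sub_cancel_right, show ∀ u, z - (u + w) = (z - w) - u from fun u => by abel]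
  set Z := z - w
  simp only [smul_smul, kq_square s hσ hτ Z]
  rw [← integral_add_right_eq_self _ ((τ / (σ + τ)) • Z)]
  simp only [add_sub_cancel_right, map_add, map_smul, smul_add]
  rw [integral_add]
  · simp only [← smul_smul]
    rw [integral_smul, kq_s_odd, smul_zero, zero_add, integral_smul, integral_smul_const]
    change _ • Jq s (σ * τ / (σ + τ)) • _ = _
    simp only [smul_smul]
    congr 1
    rw [Jq_scale s hpi, Jq_scale s hσ, pw, pw, Real.sqrt_div (by positivity), Real.sqrt_mul hσ.le]
    have := Real.sqrt_pos.2 hst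
    rw [div_pow, mul_pow]
    field_simp
  · simp only [← smul_smul]
    exact isml _ (kq_s_int s hpi)
  · simp only [← smul_smul]
    exact isml _ ((kq_int0 s hpi).smul_const _)

lemma kqs_norm_le {s : E →L[ℝ] F} (hs : ‖s‖ ≤ 1) {τ : ℝ} (hτ : 0 < τ) :
    ∃ C : ℝ, 0 ≤ C ∧ ∀ v : E, ∀ s : E →L[ℝ] F, ‖s‖ ≤ 1 → ‖kq s τ v • s v‖ ≤ C * gs (2 * τ) v := by
  obtain ⟨C, hC, h⟩ := poly_gs (E := E) 1 0 τ hτ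
  refine ⟨C, hC, fun v s hs => ?_⟩
  rw [norm_smul, Real.norm_eq_abs, abs_of_pos (kq_pos _ _ _)]
  have h1 := h v
  simp only [pow_one, zero_mul, Real.exp_zero, mul_one] at h1
  calc kq s τ v * ‖s v‖ ≤ gs τ v * ‖v‖ :=
        mul_le_mul (kq_le s hτ v) (norm_s_le hs v) (norm_nonneg _) (gs_pos _ _).le
    _ ≤ _ := by linarith

lemma gs_sub_int {T : ℝ} (hT : 0 < T) (x : E) : Integrable (fun y => gs T (x - y)) :=
  (gs_integrable hT).comp_sub_left x

lemma bf_bound (K : ℝ≥0) {τ : ℝ} (hτ : 0 < τ) : ∃ C : ℝ, 0 ≤ C ∧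
    ∀ (ν : Measure E) (s : E →L[ℝ] F), ν ≤ K • volume → ‖s‖ ≤ 1 →
      ∀ x, ∫ y, ‖kq s τ (x - y) • s (x - y)‖ ∂ν ≤ C := by
  obtain ⟨C, hC, h⟩ := kqs_norm_le (E := E) (F := F) (s := 0) (by simp) hτ
  refine ⟨K * (C * ∫ y : E, gs (2 * τ) y), ?_, fun ν s hν hs x => ?_⟩
  · have := gsint_pos (E := E) (σ := 2 * τ) (by linarith)
    positivity
  · refine (integral_dom hν (fun _ => norm_nonneg _) (kqs_integrable s hτ x).norm).trans ?_
    gcongr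
    rw [← gs_int_sub _ x, ← integral_const_mul]
    exact integral_mono (kqs_integrable s hτ x).norm ((gs_sub_int (by linarith) x).const_mul C)
      fun y => h (x - y) s hs

section
variable {K : ℝ≥0} {ν : Measure E} [SFinite ν] {s : E →L[ℝ] F}

lemma bf_meas (τ : ℝ) : StronglyMeasurable (bf s ν τ) := by
  have hc : Continuous (fun p : E × E => kq s τ (p.1 - p.2) • s (p.1 - p.2)) := by
    have := kq_cont s τ
    exact (this.comp (by fun_prop)).smul (by fun_prop)
  exact hc.stronglyMeasurable.integral_prod_right'

lemma conv_prod_int (hν : ν ≤ K • volume) (hs : ‖s‖ ≤ 1) {σ τ : ℝ} (hσ : 0 < σ) (hτ : 0 < τ) (z : E) :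
    Integrable (fun p : E × E => kq s σ (z - p.1) • kq s τ (p.1 - p.2) • s (p.1 - p.2))
      (volume.prod ν) := by
  have hc : Continuous (fun p : E × E => kq s σ (z - p.1) • kq s τ (p.1 - p.2) • s (p.1 - p.2)) := by
    have h1 := kq_cont s τ
    have h2 := kq_cont s σ
    exact (h2.comp (by fun_prop)).smul ((h1.comp (by fun_prop)).smul (by fun_prop))
  obtain ⟨C, hC, hb⟩ := bf_bound (E := E) (F := F) K hτ
  rw [integrable_prod_iff hc.aestronglyMeasurable]
  refine ⟨Filter.Eventually.of_forall fun y => ?_, ?_⟩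
  · exact isml (kq s σ (z - y)) (integ_dom hν (kqs_integrable s hτ y))
  · refine ((kq_integrable s hσ z).mul_const C).mono'
      hc.aestronglyMeasurable.norm.integral_prod_right' (Filter.Eventually.of_forall fun y => ?_)
    simp only
    rw [Real.norm_of_nonneg (integral_nonneg fun _ => norm_nonneg _)]
    simp only [norm_smul (kq s σ (z - y)), integral_const_mul]
    rw [Real.norm_of_nonneg (kq_pos _ _ _).le]
    exact mul_le_mul_of_nonneg_left (hb ν s hν hs y) (kq_pos _ _ _).le

lemma conv_bf_int (hν : ν ≤ K • volume) (hs : ‖s‖ ≤ 1) {σ τ : ℝ} (hσ : 0 < σ) (hτ : 0 < τ) (z : E) :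
    Integrable (fun y => kq s σ (z - y) • bf s ν τ y) := by
  have := (conv_prod_int hν hs hσ hτ z).integral_prod_left
  refine this.congr (Filter.Eventually.of_forall fun y => ?_)
  simp only [bf, integral_smul]

lemma semigroup (hν : ν ≤ K • volume) (hs : ‖s‖ ≤ 1) {σ τ : ℝ} (hσ : 0 < σ) (hτ : 0 < τ) (z : E) :
    ∫ y, kq s σ (z - y) • bf s ν τ y = (Jq s σ * pw E τ / pw E (σ + τ)) • bf s ν (σ + τ) z := by
  have h := integral_integral_swap (f := fun y w => kq s σ (z - y) • kq s τ (y - w) • s (y - w))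
    (conv_prod_int hν hs hσ hτ z)
  simp only [inner_conv s hσ hτ] at h
  rw [integral_smul] at h
  unfold bf
  rw [← h]
  congr 1; ext y
  rw [integral_smul]

def bD (s : E →L[ℝ] F) (ν : Measure E) (τ : ℝ) (x : E) : F := bf s ν τ x - cD E • bf s ν (4 * τ) x

lemma semigroupD (hν : ν ≤ K • volume) (hs : ‖s‖ ≤ 1) {σ τ : ℝ} (hσ : 0 < σ) (hτ : 0 < τ) (z : E) :
    ∫ y, kq s σ (z - y) • bD s ν τ y = (Jq s σ * pw E τ) • ((pw E (σ + τ))⁻¹ • bf s ν (σ + τ) z -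
      (2 * (pw E (σ + 4 * τ))⁻¹) • bf s ν (σ + 4 * τ) z) := by
  have h1 := conv_bf_int hν hs hσ hτ z
  have h2 := conv_bf_int hν hs hσ (τ := 4 * τ) (by linarith) z
  have e : ∀ y, kq s σ (z - y) • bD s ν τ y = kq s σ (z - y) • bf s ν τ y -
      cD E • (kq s σ (z - y) • bf s ν (4 * τ) y) := fun y => by
    unfold bD; module
  simp only [e]
  rw [integral_sub h1 (isml _ h2), integral_smul, semigroup hν hs hσ hτ,
    semigroup hν hs hσ (by linarith), smul_sub, smul_smul, smul_smul, smul_smul]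
  congr 1
  congr 1
  have := pw_four (E := E) hτ
  calc cD E * (Jq s σ * pw E (4 * τ) / pw E (σ + 4 * τ))
      = (cD E * pw E (4 * τ)) * (Jq s σ / pw E (σ + 4 * τ)) := by ring
    _ = _ := by rw [this]; ring

lemma conv_bD_int (hν : ν ≤ K • volume) (hs : ‖s‖ ≤ 1) {σ τ : ℝ} (hσ : 0 < σ) (hτ : 0 < τ) (z : E) :
    Integrable (fun y => kq s σ (z - y) • bD s ν τ y) := by
  have h1 := conv_bf_int hν hs hσ hτ z
  have h2 := conv_bf_int hν hs hσ (τ := 4 * τ) (by linarith) z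
  refine (h1.sub (h2.smul (cD E))).congr (Filter.Eventually.of_forall fun y => ?_)
  simp only [Pi.sub_apply, Pi.smul_apply, bD]
  module

def H1 (s : E →L[ℝ] F) (N : ℝ) (z : E) : ℝ :=
  (-(pw E N / (Jq s (N - 1) * pw E 1))) * kq s (N - 1) z +
    (-(2 * pw E N / (Jq s (N + 2) * pw E 1))) * kq s (N + 2) z
def H2 (s : E →L[ℝ] F) (N : ℝ) (z : E) : ℝ :=
  (2 * pw E N / (Jq s (N - 2) * pw E 2)) * kq s (N - 2) z

lemma b_repr (hν : ν ≤ K • volume) (hs : ‖s‖ ≤ 1) {N : ℝ} (hN : 2 < N) (z : E) :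
    bf s ν N z = (∫ y, H1 s N (z - y) • bD s ν 1 y) + ∫ y, H2 s N (z - y) • bD s ν 2 y := by
  have hJ : ∀ σ : ℝ, 0 < σ → 0 < Jq s σ := fun σ h =>
    (gsint_pos (E := E) (σ := σ / 2) (by linarith)).trans_le (Jq_ge hs h)
  have j1 := hJ (N - 1) (by linarith)
  have j2 := hJ (N + 2) (by linarith)
  have j3 := hJ (N - 2) (by linarith)
  have p0 := pw_pos (E := E) (τ := N) (by linarith)
  have p1 := pw_pos (E := E) (τ := 1) (by linarith)
  have p2 := pw_pos (E := E) (τ := 2) (by linarith)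
  have i1 := conv_bD_int hν hs (σ := N - 1) (τ := 1) (by linarith) (by norm_num) z
  have i2 := conv_bD_int hν hs (σ := N + 2) (τ := 1) (by linarith) (by norm_num) z
  simp only [H1, H2, add_smul, ← smul_smul]
  rw [integral_add (isml _ i1) (isml _ i2), integral_smul, integral_smul, integral_smul,
    semigroupD hν hs (by linarith) (by norm_num), semigroupD hν hs (by linarith) (by norm_num),
    semigroupD hν hs (by linarith) (by norm_num)]
  rw [show N - 1 + 1 = N by ring, show N - 1 + 4 * 1 = N + 3 by ring, show N + 2 + 1 = N + 3 by ring,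
    show N + 2 + 4 * 1 = N + 6 by ring, show N - 2 + 2 = N by ring, show N - 2 + 4 * 2 = N + 6 by ring]
  simp only [smul_smul]
  have e1 : -(pw E N / (Jq s (N - 1) * pw E 1)) * (Jq s (N - 1) * pw E 1) = - pw E N := by field_simp
  have e2 : -(2 * pw E N / (Jq s (N + 2) * pw E 1)) * (Jq s (N + 2) * pw E 1) = - 2 * pw E N := by
    field_simp
  have e3 : (2 * pw E N / (Jq s (N - 2) * pw E 2)) * (Jq s (N - 2) * pw E 2) = 2 * pw E N := by
    field_simp
  rw [e1, e2, e3]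
  have e4 : bf s ν N z = (pw E N * (pw E N)⁻¹) • bf s ν N z := by
    rw [mul_inv_cancel₀ p0.ne', one_smul]
  conv_lhs => rw [e4]
  module
end

lemma H_GK {N : ℝ} (hN : 2 < N) : ∃ C : ℝ, 0 ≤ C ∧ ∀ (s : E →L[ℝ] F), ‖s‖ ≤ 1 →
    GK C (2 * (N + 2)) (H1 s N) ∧ GK C (2 * (N + 2)) (H2 s N) := by
  obtain ⟨c1, hc1, g1⟩ := kq_GK (E := E) (F := F) (N - 1) (by linarith)
  obtain ⟨c2, hc2, g2⟩ := kq_GK (E := E) (F := F) (N + 2) (by linarith)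
  obtain ⟨c3, hc3, g3⟩ := kq_GK (E := E) (F := F) (N - 2) (by linarith)
  have j1 := gsint_pos (E := E) (σ := (N - 1) / 2) (by linarith)
  have j2 := gsint_pos (E := E) (σ := (N + 2) / 2) (by linarith)
  have j3 := gsint_pos (E := E) (σ := (N - 2) / 2) (by linarith)
  set J1 := ∫ z : E, gs ((N - 1) / 2) z
  set J2 := ∫ z : E, gs ((N + 2) / 2) z
  set J3 := ∫ z : E, gs ((N - 2) / 2) z
  have p0 := pw_pos (E := E) (τ := N) (by linarith)
  have p1 := pw_pos (E := E) (τ := 1) (by linarith)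
  have p2 := pw_pos (E := E) (τ := 2) (by linarith)
  refine ⟨(pw E N / (J1 * pw E 1)) * c1 + (2 * pw E N / (J2 * pw E 1)) * c2 +
    (2 * pw E N / (J3 * pw E 2)) * c3, by positivity, fun s hs => ?_⟩
  have k1 : J1 ≤ Jq s (N - 1) := Jq_ge hs (by linarith)
  have k2 : J2 ≤ Jq s (N + 2) := Jq_ge hs (by linarith)
  have k3 : J3 ≤ Jq s (N - 2) := Jq_ge hs (by linarith)
  have k1' := j1.trans_le k1
  have k2' := j2.trans_le k2
  have k3' := j3.trans_le k3
  have a1 := (((g1 s hs).smul (-(pw E N / (Jq s (N - 1) * pw E 1)))).mono (T' := 2 * (N + 2))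
    (C' := (pw E N / (J1 * pw E 1)) * c1) ?_ (by linarith) (by linarith))
  have a2 := (((g2 s hs).smul (-(2 * pw E N / (Jq s (N + 2) * pw E 1)))).mono (T' := 2 * (N + 2))
    (C' := (2 * pw E N / (J2 * pw E 1)) * c2) ?_ (by linarith) (by linarith))
  have a3 := (((g3 s hs).smul (2 * pw E N / (Jq s (N - 2) * pw E 2))).mono (T' := 2 * (N + 2))
    (C' := (2 * pw E N / (J3 * pw E 2)) * c3) ?_ (by linarith) (by linarith))
  · constructor
    · exact (a1.add a2).mono (by have : 0 ≤ (2 * pw E N / (J3 * pw E 2)) * c3 := by positivity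
                                 linarith) (by linarith) le_rfl
    · refine a3.mono ?_ (by linarith) le_rfl
      have : 0 ≤ (pw E N / (J1 * pw E 1)) * c1 + (2 * pw E N / (J2 * pw E 1)) * c2 := by positivity
      linarith
  · rw [abs_of_nonneg (by positivity)]; gcongr
  · rw [abs_neg, abs_of_nonneg (by positivity)]; gcongr
  · rw [abs_neg, abs_of_nonneg (by positivity)]; gcongr


lemma Mf_nonneg (A : E → F) (s : E →L[ℝ] F) (T : ℝ) (x : E) : 0 ≤ Mf A s T x :=
  integral_nonneg fun y => mul_nonneg (gs_pos _ _).le (norm_nonneg _)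

lemma Mf_zero (A : E → F) (s : E →L[ℝ] F) (T : ℝ) : Mf A s T 0 = ∫ y, gs T y * ‖av A s y‖ := by
  simp [Mf, gs_neg]

section
variable {K : ℝ≥0} {ν : Measure E} {ε : ℝ} {A : E → F} {s : E →L[ℝ] F}

lemma Su.Mf_mono (h : Su K ν ε A s) {T T' : ℝ} (hT : 0 < T) (hTT : T ≤ T') (x : E) :
    Mf A s T x ≤ Mf A s T' x :=
  integral_mono (h.M_integrable hT x) (h.M_integrable (hT.trans_le hTT) x) fun y =>
    mul_le_mul_of_nonneg_right (gs_mono hT hTT _) (norm_nonneg _)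

lemma Su.Mf_shift (h : Su K ν ε A s) {T : ℝ} (hT : 0 < T) (x : E) (hx : ‖x‖ ≤ 1) :
    Mf A s T x ≤ Real.exp (1 / T) * Mf A s (2 * T) 0 := by
  unfold Mf
  rw [← integral_const_mul]
  refine integral_mono (h.M_integrable hT x) ((h.M_integrable (by linarith) 0).const_mul _) fun y => ?_
  have h2 := gs_shift hT (0 - y) x
  rw [show 0 - y + x = x - y by abel] at h2
  have h3 : Real.exp (‖x‖ ^ 2 / T) ≤ Real.exp (1 / T) := by
    apply Real.exp_le_exp.2
    gcongr
    nlinarith [norm_nonneg x]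
  have := (gs_pos (2 * T) (0 - y)).le
  calc gs T (x - y) * ‖av A s y‖ ≤ (Real.exp (1 / T) * gs (2 * T) (0 - y)) * ‖av A s y‖ := by
        gcongr
        exact h2.trans (by gcongr)
    _ = _ := by ring

lemma Su.Mf_conv (h : Su K ν ε A s) {T : ℝ} (hT : 0 < T) (z : E) :
    gs T z * Mf A s T z ≤ gs (2 * T) z * Mf A s (4 * T) 0 := by
  rw [Mf_zero]
  unfold Mf
  rw [← integral_const_mul, ← integral_const_mul]
  have i := h.M_integrable (T := 4 * T) (by linarith) 0
  simp only [zero_sub, gs_neg] at i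
  refine integral_mono ((h.M_integrable hT z).const_mul _) (i.const_mul _) fun y => ?_
  have := gs_mul_le hT z (y - z)
  rw [add_sub_cancel, ← neg_sub z y, gs_neg] at this
  simp only
  rw [← mul_assoc, ← mul_assoc]
  exact mul_le_mul_of_nonneg_right this (norm_nonneg _)

lemma Su.Mf_meas (h : Su K ν ε A s) (T : ℝ) : StronglyMeasurable (Mf A s T) := by
  have hc : Continuous (fun p : E × E => gs T (p.1 - p.2) * ‖av A s p.2‖) := by
    have h1 := gs_cont (E := E) T
    have h2 := h.conta
    exact (h1.comp (by fun_prop)).mul ((h2.comp continuous_snd).norm)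
  exact hc.stronglyMeasurable.integral_prod_right'

lemma Su.gsM_int (h : Su K ν ε A s) {T : ℝ} (hT : 0 < T) : Integrable fun z => gs T z * Mf A s T z := by
  refine ((gs_integrable (E := E) (T := 2 * T) (by linarith)).mul_const (Mf A s (4 * T) 0)).mono'
    ((gs_cont T).stronglyMeasurable.mul (h.Mf_meas T)).aestronglyMeasurable
    (Filter.Eventually.of_forall fun z => ?_)
  rw [Real.norm_of_nonneg (mul_nonneg (gs_pos _ _).le (Mf_nonneg _ _ _ _))]
  exact h.Mf_conv hT z

lemma Su.gsM_le (h : Su K ν ε A s) {T : ℝ} (hT : 0 < T) :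
    ∫ z, gs T z * Mf A s T z ≤ (∫ z : E, gs (2 * T) z) * Mf A s (4 * T) 0 := by
  rw [← integral_mul_const]
  exact integral_mono (h.gsM_int hT) ((gs_integrable (by linarith)).mul_const _) fun z => h.Mf_conv hT z

def WD (s : E →L[ℝ] F) (ν : Measure E) (τ : ℝ) (x : E) : ℝ := Wf s ν τ x - cD E * Wf s ν (4 * τ) x
def VD (A : E → F) (s : E →L[ℝ] F) (ν : Measure E) (τ : ℝ) (x : E) : F :=
  Vf A s ν τ x - cD E • Vf A s ν (4 * τ) x
def eD (A : E → F) (s : E →L[ℝ] F) (ν : Measure E) (τ : ℝ) (x : E) : F :=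
  ef A s ν τ x - cD E • ef A s ν (4 * τ) x

lemma FD_decomp (τ : ℝ) (x : E) :
    WD s ν τ x • av A s x = (VD A s ν τ x - bD s ν τ x) + (FD A ν τ x - eD A s ν τ x) := by
  unfold WD VD bD FD eD ef
  module

lemma eD_bound (K : ℝ≥0) (τ : ℝ) (hτ : 0 < τ) : ∃ C : ℝ, 0 ≤ C ∧
    ∀ (ν : Measure E) (ε : ℝ) (A : E → F) (s : E →L[ℝ] F), Su K ν ε A s → ∀ x,
    ‖eD A s ν τ x‖ ≤ C * ε ^ 2 * (‖av A s x‖ + Mf A s (8 * τ) x) := by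
  obtain ⟨C1, hC1, h1⟩ := Su.ef_bound (E := E) (F := F) K τ hτ
  obtain ⟨C2, hC2, h2⟩ := Su.ef_bound (E := E) (F := F) K (4 * τ) (by linarith)
  refine ⟨C1 + C2, by positivity, fun ν ε A s h x => ?_⟩
  have b1 := h1 ν ε A s h x
  have b2 := h2 ν ε A s h x
  have m1 := h.Mf_mono (T := 2 * τ) (T' := 8 * τ) (by linarith) (by linarith) x
  rw [show 2 * (4 * τ) = 8 * τ by ring] at b2
  have hc : ‖cD E • ef A s ν (4 * τ) x‖ ≤ ‖ef A s ν (4 * τ) x‖ := by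
    rw [norm_smul, Real.norm_of_nonneg cD_pos.le]
    have := cD_le (E := E)
    nlinarith [norm_nonneg (ef A s ν (4 * τ) x)]
  have b1' : C1 * ε ^ 2 * (‖av A s x‖ + Mf A s (2 * τ) x) ≤ C1 * ε ^ 2 * (‖av A s x‖ + Mf A s (8 * τ) x) := by
    gcongr
  have := norm_sub_le (ef A s ν τ x) (cD E • ef A s ν (4 * τ) x)
  unfold eD
  linarith

lemma Wf_le (hν : ν ≤ K • volume) {τ : ℝ} (hτ : 0 < τ) (x : E) : Wf s ν τ x ≤ K * Jq s τ := by
  have := integral_dom hν (fun y => (kq_pos s τ (x - y)).le) (kq_integrable s hτ x)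
  refine this.trans (le_of_eq ?_)
  rw [integral_sub_left_eq_self (fun y => kq s τ y) volume x]; rfl

lemma Wf_nonneg (τ : ℝ) (x : E) : 0 ≤ Wf s ν τ x := integral_nonneg fun y => (kq_pos _ _ _).le

lemma Jq_le (s : E →L[ℝ] F) {τ : ℝ} (hτ : 0 < τ) : Jq s τ ≤ ∫ z : E, gs τ z :=
  integral_mono (kq_int0 s hτ) (gs_integrable hτ) fun z => kq_le s hτ z

lemma Su.Vf_le (h : Su K ν ε A s) {τ : ℝ} (hτ : 0 < τ) (x : E) :
    ‖Vf A s ν τ x‖ ≤ K * Mf A s τ x := by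
  refine le_trans ?_ (integral_dom h.hν (fun y => mul_nonneg (gs_pos _ _).le (norm_nonneg _))
    (h.M_integrable hτ x))
  refine norm_integral_le_of_norm_le (integ_dom h.hν (h.M_integrable hτ x))
    (Filter.Eventually.of_forall fun y => ?_)
  rw [norm_smul, Real.norm_of_nonneg (kq_pos _ _ _).le]
  exact mul_le_mul_of_nonneg_right (kq_le s hτ _) (norm_nonneg _)

lemma bD_bound (K : ℝ≥0) (τ : ℝ) (hτ : 0 < τ) : ∃ C : ℝ, 0 ≤ C ∧
    ∀ (ν : Measure E) (ε : ℝ) (A : E → F) (s : E →L[ℝ] F), Su K ν ε A s → ∀ x,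
    ‖bD s ν τ x‖ ≤ ‖FD A ν τ x‖ + C * (‖av A s x‖ + Mf A s (8 * τ) x) := by
  obtain ⟨C1, hC1, h1⟩ := eD_bound (E := E) (F := F) K τ hτ
  set J := ∫ z : E, gs τ z
  set J4 := ∫ z : E, gs (4 * τ) z
  have hJ : 0 < J := gsint_pos hτ
  have hJ4 : 0 < J4 := gsint_pos (by linarith)
  refine ⟨C1 + K * (J + J4) + 2 * K, by positivity, fun ν ε A s h x => ?_⟩
  have b1 := h1 ν ε A s h x
  have hε : ε ^ 2 ≤ 1 := pow_le_one₀ h.ε0 h.ε1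
  have m1 := h.Mf_mono (T := τ) (T' := 8 * τ) (by linarith) (by linarith) x
  have m2 := h.Mf_mono (T := 4 * τ) (T' := 8 * τ) (by linarith) (by linarith) x
  have v1 := h.Vf_le hτ x
  have v2 := h.Vf_le (τ := 4 * τ) (by linarith) x
  have w1 := Wf_le (s := s) h.hν hτ x
  have w2 := Wf_le (s := s) h.hν (τ := 4 * τ) (by linarith) x
  have w3 := Wf_nonneg (s := s) (ν := ν) τ x
  have w4 := Wf_nonneg (s := s) (ν := ν) (4 * τ) x
  have j1 : Jq s τ ≤ J := Jq_le s hτ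
  have j2 : Jq s (4 * τ) ≤ J4 := Jq_le s (by linarith)
  have c0 := cD_pos (E := E)
  have c1 := cD_le (E := E)
  have hM := Mf_nonneg A s (8 * τ) x
  have hWD : |WD s ν τ x| ≤ K * (J + J4) := by
    unfold WD
    have : |Wf s ν τ x - cD E * Wf s ν (4 * τ) x| ≤ Wf s ν τ x + Wf s ν (4 * τ) x := by
      rw [abs_le]; constructor <;> nlinarith
    have h5 : (K:ℝ) * Jq s τ ≤ K * J := by gcongr
    have h6 : (K:ℝ) * Jq s (4 * τ) ≤ K * J4 := by gcongr
    linarith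
  have hVD : ‖VD A s ν τ x‖ ≤ 2 * K * Mf A s (8 * τ) x := by
    unfold VD
    have := norm_sub_le (Vf A s ν τ x) (cD E • Vf A s ν (4 * τ) x)
    have hc : ‖cD E • Vf A s ν (4 * τ) x‖ ≤ ‖Vf A s ν (4 * τ) x‖ := by
      rw [norm_smul, Real.norm_of_nonneg cD_pos.le]
      nlinarith [norm_nonneg (Vf A s ν (4 * τ) x)]
    have h5 : (K:ℝ) * Mf A s τ x ≤ K * Mf A s (8 * τ) x := by gcongr
    have h6 : (K:ℝ) * Mf A s (4 * τ) x ≤ K * Mf A s (8 * τ) x := by gcongr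
    linarith
  have e : bD s ν τ x = VD A s ν τ x + (FD A ν τ x - eD A s ν τ x) - WD s ν τ x • av A s x := by
    rw [FD_decomp]; abel
  have heD : ‖eD A s ν τ x‖ ≤ C1 * (‖av A s x‖ + Mf A s (8 * τ) x) := by
    refine b1.trans ?_
    gcongr
    nlinarith
  rw [e]
  calc _ ≤ ‖VD A s ν τ x‖ + (‖FD A ν τ x‖ + ‖eD A s ν τ x‖) + ‖WD s ν τ x • av A s x‖ :=
        (norm_sub_le _ _).trans (add_le_add ((norm_add_le _ _).trans
          (add_le_add le_rfl (norm_sub_le _ _))) le_rfl)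
    _ ≤ 2 * K * Mf A s (8 * τ) x + (‖FD A ν τ x‖ + C1 * (‖av A s x‖ + Mf A s (8 * τ) x))
        + K * (J + J4) * ‖av A s x‖ := by
      rw [norm_smul, Real.norm_eq_abs]; gcongr
    _ ≤ _ := by
      have n1 : 0 ≤ K * (J + J4) * Mf A s (8 * τ) x := by positivity
      have n2 : 0 ≤ (K:ℝ) * ‖av A s x‖ := by positivity
      nlinarith

/-- Tame functions: controlled first and second differences at the origin. -/
structure Tame (X : ℝ) (u : E → F) : Prop where
  d1 : ∀ h : E, ‖h‖ ≤ 1 → ‖u h - u 0‖ ≤ X * ‖h‖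
  d2 : ∀ h : E, ‖h‖ ≤ 1 → ‖u h + u (-h) - (2:ℝ) • u 0‖ ≤ X * ‖h‖ ^ 2

lemma Tame.add {X Y : ℝ} {u v : E → F} (hu : Tame X u) (hv : Tame Y v) :
    Tame (X + Y) (fun x => u x + v x) := by
  refine ⟨fun h hh => ?_, fun h hh => ?_⟩
  · rw [show u h + v h - (u 0 + v 0) = (u h - u 0) + (v h - v 0) by abel, add_mul]
    exact (norm_add_le _ _).trans (add_le_add (hu.d1 h hh) (hv.d1 h hh))
  · rw [show u h + v h + (u (-h) + v (-h)) - (2:ℝ) • (u 0 + v 0) =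
      (u h + u (-h) - (2:ℝ) • u 0) + (v h + v (-h) - (2:ℝ) • v 0) by module, add_mul]
    exact (norm_add_le _ _).trans (add_le_add (hu.d2 h hh) (hv.d2 h hh))

lemma Tame.smul {X : ℝ} {u : E → F} (hu : Tame X u) (c : ℝ) : Tame (|c| * X) (fun x => c • u x) := by
  refine ⟨fun h hh => ?_, fun h hh => ?_⟩
  · rw [← smul_sub, norm_smul, mul_assoc]
    exact mul_le_mul_of_nonneg_left (hu.d1 h hh) (norm_nonneg _)
  · rw [show c • u h + c • u (-h) - (2:ℝ) • c • u 0 = c • (u h + u (-h) - (2:ℝ) • u 0) by module,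
      norm_smul, mul_assoc]
    exact mul_le_mul_of_nonneg_left (hu.d2 h hh) (norm_nonneg _)

lemma Tame.mono {X Y : ℝ} {u : E → F} (hu : Tame X u) (h : X ≤ Y) : Tame Y u :=
  ⟨fun h hh => (hu.d1 h hh).trans (by gcongr), fun h hh => (hu.d2 h hh).trans (by gcongr)⟩

lemma GK.tame {C T : ℝ} {k : E → ℝ} (hk : GK C T k) (ρ : Measure E) {f : E → F}
    (hf : AEStronglyMeasurable f ρ) (hi : Integrable (fun y => gs T y * ‖f y‖) ρ) :
    Tame (C * ∫ y, gs T y * ‖f y‖ ∂ρ) (fun x => ∫ y, k (x - y) • f y ∂ρ) :=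
  ⟨fun h hh => (hk.conv1 ρ hf hi h hh).trans (le_of_eq (by ring)),
   fun h hh => (hk.conv2 ρ hf hi h hh).trans (le_of_eq (by ring))⟩

/-- The final algebraic step. -/
lemma final_alg {ap am Np Nm N0 Ep Em E0 : F} {Wp Wm η c X t : ℝ} (hη : 0 < η)
    (hp : Wp • ap = Np + Ep) (hm : Wm • am = Nm + Em) (h0 : N0 + E0 = 0) (hWp : η ≤ |Wp|)
    (hWm : η ≤ |Wm|) (hW : |Wp - Wm| ≤ c * t) (ht0 : 0 ≤ t) (ht1 : t ≤ 1) (hc : 0 ≤ c) (hX : 0 ≤ X)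
    (hN2 : ‖Np + Nm - (2:ℝ) • N0‖ ≤ X * t ^ 2) (hN1 : ‖Nm - N0‖ ≤ X * t) :
    ‖ap + am‖ ≤ (2 * η⁻¹ + c * (η⁻¹) ^ 2) * (X * t ^ 2 + ‖E0‖ + ‖Ep‖ + ‖Em‖) := by
  have hWp0 : Wp ≠ 0 := by intro h; rw [h, abs_zero] at hWp; linarith
  have hWm0 : Wm ≠ 0 := by intro h; rw [h, abs_zero] at hWm; linarith
  have ep : ap = Wp⁻¹ • (Np + Ep) := by rw [← hp, smul_smul, inv_mul_cancel₀ hWp0, one_smul]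
  have em : am = Wm⁻¹ • (Nm + Em) := by rw [← hm, smul_smul, inv_mul_cancel₀ hWm0, one_smul]
  have e : ap + am = Wp⁻¹ • ((Np + Nm - (2:ℝ) • N0) - (2:ℝ) • E0) + (Wm⁻¹ - Wp⁻¹) • ((Nm - N0) - E0)
      + Wp⁻¹ • Ep + Wm⁻¹ • Em := by
    have : N0 = -E0 := eq_neg_of_add_eq_zero_left h0
    rw [ep, em, this]; module
  have i1 : |Wp⁻¹| ≤ η⁻¹ := by rw [abs_inv]; gcongr
  have i2 : |Wm⁻¹| ≤ η⁻¹ := by rw [abs_inv]; gcongr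
  have i3 : |Wm⁻¹ - Wp⁻¹| ≤ c * t * (η⁻¹) ^ 2 := by
    have : Wm⁻¹ - Wp⁻¹ = (Wp - Wm) * (Wm⁻¹ * Wp⁻¹) := by field_simp
    rw [this, abs_mul, abs_mul, sq]
    gcongr
  have hi : 0 < η⁻¹ := inv_pos.2 hη
  rw [e]
  calc _ ≤ ‖Wp⁻¹ • ((Np + Nm - (2:ℝ) • N0) - (2:ℝ) • E0)‖ + ‖(Wm⁻¹ - Wp⁻¹) • ((Nm - N0) - E0)‖
      + ‖Wp⁻¹ • Ep‖ + ‖Wm⁻¹ • Em‖ := norm_add₄_le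
    _ ≤ η⁻¹ * (X * t ^ 2 + 2 * ‖E0‖) + (c * t * (η⁻¹) ^ 2) * (X * t + ‖E0‖) + η⁻¹ * ‖Ep‖ + η⁻¹ * ‖Em‖ := by
      simp only [norm_smul, Real.norm_eq_abs]
      have n1 : ‖(Np + Nm - (2:ℝ) • N0) - (2:ℝ) • E0‖ ≤ X * t ^ 2 + 2 * ‖E0‖ := by
        refine (norm_sub_le _ _).trans ?_
        rw [norm_smul, Real.norm_of_nonneg (by norm_num : (0:ℝ) ≤ 2)]
        linarith
      have n2 : ‖(Nm - N0) - E0‖ ≤ X * t + ‖E0‖ := (norm_sub_le _ _).trans (by linarith)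
      gcongr
    _ ≤ _ := by
      have a1 : c * t * (η⁻¹) ^ 2 * ‖E0‖ ≤ c * 1 * (η⁻¹) ^ 2 * ‖E0‖ := by gcongr
      have a2 : 0 ≤ c * η⁻¹ ^ 2 * ‖Ep‖ := by positivity
      have a3 : 0 ≤ c * η⁻¹ ^ 2 * ‖Em‖ := by positivity
      have a4 : 0 ≤ η⁻¹ * ‖Ep‖ := by positivity
      have a5 : 0 ≤ η⁻¹ * ‖Em‖ := by positivity
      have a6 : 0 ≤ η⁻¹ * (X * t ^ 2) := by positivity
      nlinarith
end


section
variable {K : ℝ≥0} {ν : Measure E} {ε : ℝ} {A : E → F} {s : E →L[ℝ] F}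

lemma FG_meas [SFinite ν] (hA : Continuous A) (τ : ℝ) : StronglyMeasurable (FG A ν τ) := by
  have hc : Continuous (fun p : E × E => Real.exp (-(‖p.1 - p.2‖ ^ 2 + ‖A p.1 - A p.2‖ ^ 2) / τ) •
      (A p.1 - A p.2)) := by fun_prop
  exact hc.stronglyMeasurable.integral_prod_right'

lemma FD_meas [SFinite ν] (hA : Continuous A) (τ : ℝ) : StronglyMeasurable (FD A ν τ) :=
  (FG_meas hA τ).sub ((FG_meas hA (4 * τ)).const_smul _)

lemma FG_bdd (hν : ν ≤ K • volume) (hε : ε ≤ 1) (hlip : ∀ x y, ‖A x - A y‖ ≤ ε * ‖x - y‖)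
    {τ : ℝ} (hτ : 0 < τ) : ∃ C : ℝ, ∀ x, ‖FG A ν τ x‖ ≤ C := by
  obtain ⟨C, hC, h⟩ := poly_gs (E := E) 1 0 τ hτ
  have hi := (gs_integrable (E := E) (T := 2 * τ) (by linarith))
  refine ⟨K * ∫ y : E, C * gs (2 * τ) y, fun x => ?_⟩
  rw [← integral_sub_left_eq_self (fun y => C * gs (2 * τ) y) volume x]
  have hi2 : Integrable (fun y => C * gs (2 * τ) (x - y)) :=
    (gs_sub_int (by linarith) x).const_mul C
  refine le_trans ?_ (integral_dom hν (fun y => mul_nonneg hC (gs_pos _ _).le) hi2)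
  refine norm_integral_le_of_norm_le (integ_dom hν hi2) (Filter.Eventually.of_forall fun y => ?_)
  rw [norm_smul, Real.norm_of_nonneg (Real.exp_pos _).le]
  have h1 := h (x - y)
  simp only [pow_one, zero_mul, Real.exp_zero, mul_one] at h1
  have h2 : Real.exp (-(‖x - y‖ ^ 2 + ‖A x - A y‖ ^ 2) / τ) ≤ gs τ (x - y) := by
    unfold gs
    apply Real.exp_le_exp.2
    gcongr
    nlinarith [norm_nonneg (A x - A y)]
  have h3 : ‖A x - A y‖ ≤ ‖x - y‖ := (hlip x y).trans (by nlinarith [norm_nonneg (x - y)])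
  calc _ ≤ gs τ (x - y) * ‖x - y‖ := mul_le_mul h2 h3 (norm_nonneg _) (gs_pos _ _).le
    _ ≤ _ := by linarith

lemma gs_bdd_int {T : ℝ} (hT : 0 < T) {f : E → F} (hf : StronglyMeasurable f) {C : ℝ}
    (hb : ∀ x, ‖f x‖ ≤ C) : Integrable fun y => gs T y * ‖f y‖ := by
  refine ((gs_integrable (E := E) hT).mul_const C).mono'
    ((gs_cont T).stronglyMeasurable.mul hf.norm).aestronglyMeasurable
    (Filter.Eventually.of_forall fun y => ?_)
  rw [Real.norm_of_nonneg (mul_nonneg (gs_pos _ _).le (norm_nonneg _))]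
  exact mul_le_mul_of_nonneg_left (hb y) (gs_pos _ _).le

lemma gsFD_int [SFinite ν] (hν : ν ≤ K • volume) (hε : ε ≤ 1)
    (hlip : ∀ x y, ‖A x - A y‖ ≤ ε * ‖x - y‖) {τ T : ℝ} (hτ : 0 < τ) (hT : 0 < T) :
    Integrable fun y => gs T y * ‖FD A ν τ y‖ := by
  obtain ⟨C1, h1⟩ := FG_bdd hν hε hlip hτ
  obtain ⟨C2, h2⟩ := FG_bdd hν hε hlip (τ := 4 * τ) (by linarith)
  refine gs_bdd_int hT (FD_meas (lip_cont hlip) τ) (C := C1 + cD E * C2) fun x => ?_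
  refine (norm_sub_le _ _).trans (add_le_add (h1 x) ?_)
  rw [norm_smul, Real.norm_of_nonneg cD_pos.le]
  exact mul_le_mul_of_nonneg_left (h2 x) cD_pos.le

lemma bD_meas [SFinite ν] (τ : ℝ) : StronglyMeasurable (bD s ν τ) :=
  (bf_meas τ).sub ((bf_meas (4 * τ)).const_smul _)

lemma gsbD_int [SFinite ν] (hν : ν ≤ K • volume) (hs : ‖s‖ ≤ 1) {τ T : ℝ} (hτ : 0 < τ) (hT : 0 < T) :
    Integrable fun y => gs T y * ‖bD s ν τ y‖ := by
  obtain ⟨C1, hC1, h1⟩ := bf_bound (E := E) (F := F) K hτ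
  obtain ⟨C2, hC2, h2⟩ := bf_bound (E := E) (F := F) K (τ := 4 * τ) (by linarith)
  refine gs_bdd_int hT (bD_meas τ) (C := C1 + cD E * C2) fun x => ?_
  refine (norm_sub_le _ _).trans (add_le_add
    ((norm_integral_le_integral_norm _).trans (h1 ν s hν hs x)) ?_)
  rw [norm_smul, Real.norm_of_nonneg cD_pos.le]
  exact mul_le_mul_of_nonneg_left ((norm_integral_le_integral_norm _).trans (h2 ν s hν hs x)) cD_pos.le
end

lemma gsbD_bound (K : ℝ≥0) {τ T : ℝ} (hτ : 0 < τ) (hT : 8 * τ ≤ T) : ∃ C : ℝ, 0 ≤ C ∧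
    ∀ (ν : Measure E) [SFinite ν] (ε : ℝ) (A : E → F) (s : E →L[ℝ] F), Su K ν ε A s →
    ∫ y, gs T y * ‖bD s ν τ y‖ ≤ (∫ y, gs T y * ‖FD A ν τ y‖) + C * Mf A s (4 * T) 0 := by
  obtain ⟨C1, hC1, h1⟩ := bD_bound (E := E) (F := F) K τ hτ
  have hT0 : 0 < T := by linarith
  have hJ := gsint_pos (E := E) (σ := 2 * T) (by linarith)
  refine ⟨C1 * (1 + ∫ z : E, gs (2 * T) z), by positivity, fun ν _ ε A s h => ?_⟩
  have i1 := gsFD_int h.hν h.ε1 h.lip hτ hT0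
  have i2 := h.M_integrable hT0 0
  simp only [zero_sub, gs_neg] at i2
  have i3 := h.gsM_int hT0
  have i4 : Integrable (fun y => C1 * (gs T y * ‖av A s y‖ + gs T y * Mf A s T y)) :=
    (i2.add i3).const_mul C1
  have step : ∫ y, gs T y * ‖bD s ν τ y‖ ≤
      ∫ y, (gs T y * ‖FD A ν τ y‖ + C1 * (gs T y * ‖av A s y‖ + gs T y * Mf A s T y)) := by
    refine integral_mono (gsbD_int h.hν h.hs1 hτ hT0) (i1.add i4) fun y => ?_
    have := h1 ν ε A s h y
    have hm := h.Mf_mono (T := 8 * τ) (by linarith) hT y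
    have hg := gs_pos T y
    simp only
    calc gs T y * ‖bD s ν τ y‖ ≤ gs T y * (‖FD A ν τ y‖ + C1 * (‖av A s y‖ + Mf A s T y)) := by
          gcongr
          refine this.trans ?_
          gcongr
      _ = _ := by ring
  have e : ∫ y, (gs T y * ‖FD A ν τ y‖ + C1 * (gs T y * ‖av A s y‖ + gs T y * Mf A s T y))
      = (∫ y, gs T y * ‖FD A ν τ y‖) + C1 * (Mf A s T 0 + ∫ y, gs T y * Mf A s T y) := by
    rw [integral_add i1 i4, integral_const_mul]
    congr 2
    rw [Mf_zero]
    exact integral_add i2 i3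
  rw [e] at step
  refine step.trans ?_
  have m1 := h.Mf_mono hT0 (T' := 4 * T) (by linarith) 0
  have m2 := h.gsM_le hT0
  have : C1 * (Mf A s T 0 + ∫ y, gs T y * Mf A s T y) ≤
    C1 * (Mf A s (4 * T) 0 + (∫ z : E, gs (2 * T) z) * Mf A s (4 * T) 0) := by gcongr
  linarith

/-- weighted average of the two small-scale quantities -/
def Ph (A : E → F) (ν : Measure E) (T : ℝ) : ℝ :=
  (∫ y, gs T y * ‖FD A ν 1 y‖) + ∫ y, gs T y * ‖FD A ν 2 y‖

lemma gsnorm_nonneg (T : ℝ) (f : E → F) : 0 ≤ ∫ y, gs T y * ‖f y‖ :=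
  integral_nonneg fun y => mul_nonneg (gs_pos _ _).le (norm_nonneg _)

lemma Ph_nonneg (A : E → F) (ν : Measure E) (T : ℝ) : 0 ≤ Ph A ν T :=
  add_nonneg (gsnorm_nonneg _ _) (gsnorm_nonneg _ _)

lemma b_tame (K : ℝ≥0) {N T : ℝ} (hN : 2 < N) (hT : 2 * (N + 6) ≤ T) : ∃ C : ℝ, 0 ≤ C ∧
    ∀ (ν : Measure E) [SFinite ν] (ε : ℝ) (A : E → F) (s : E →L[ℝ] F), Su K ν ε A s →
    Tame (C * (Mf A s (4 * T) 0 + Ph A ν T)) (bf s ν N) := by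
  obtain ⟨C, hC, hH⟩ := H_GK (E := E) (F := F) hN
  obtain ⟨C1, hC1, h1⟩ := gsbD_bound (E := E) (F := F) K (τ := 1) (T := T) (by norm_num) (by linarith)
  obtain ⟨C2, hC2, h2⟩ := gsbD_bound (E := E) (F := F) K (τ := 2) (T := T) (by norm_num) (by linarith)
  refine ⟨C * (1 + C1 + C2), by positivity, fun ν _ ε A s h => ?_⟩
  obtain ⟨k1, k2⟩ := hH s h.hs1
  have k1 := k1.mono le_rfl (by linarith) (show 2 * (N + 2) ≤ T by linarith)
  have k2 := k2.mono le_rfl (by linarith) (show 2 * (N + 2) ≤ T by linarith)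
  have t1 := k1.tame volume (bD_meas (s := s) (ν := ν) 1).aestronglyMeasurable
    (gsbD_int h.hν h.hs1 (by norm_num) (by linarith))
  have t2 := k2.tame volume (bD_meas (s := s) (ν := ν) 2).aestronglyMeasurable
    (gsbD_int h.hν h.hs1 (by norm_num) (by linarith))
  have t := t1.add t2
  rw [show (fun x => (∫ y, H1 s N (x - y) • bD s ν 1 y) + ∫ y, H2 s N (x - y) • bD s ν 2 y) = bf s ν N
    from funext fun x => (b_repr h.hν h.hs1 hN x).symm] at t
  refine t.mono ?_
  have b1 := h1 ν ε A s h
  have b2 := h2 ν ε A s h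
  have hM := Mf_nonneg A s (4 * T) 0
  have n1 := Ph_nonneg A ν T
  have hle : (∫ y, gs T y * ‖bD s ν 1 y‖) + ∫ y, gs T y * ‖bD s ν 2 y‖ ≤
    Ph A ν T + (C1 + C2) * Mf A s (4 * T) 0 := by unfold Ph; linarith
  calc _ = C * ((∫ y, gs T y * ‖bD s ν 1 y‖) + ∫ y, gs T y * ‖bD s ν 2 y‖) := by ring
    _ ≤ C * (Ph A ν T + (C1 + C2) * Mf A s (4 * T) 0) := by gcongr
    _ ≤ C * ((1 + C1 + C2) * (Mf A s (4 * T) 0 + Ph A ν T)) := by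
      gcongr
      nlinarith [mul_nonneg hC1 n1, mul_nonneg hC2 n1]
    _ = _ := by ring

lemma V_tame (K : ℝ≥0) {N T : ℝ} (hN : 0 < N) (hT : 2 * N ≤ T) : ∃ C : ℝ, 0 ≤ C ∧
    ∀ (ν : Measure E) (ε : ℝ) (A : E → F) (s : E →L[ℝ] F), Su K ν ε A s →
    Tame (C * Mf A s T 0) (Vf A s ν N) := by
  obtain ⟨C, hC, hk⟩ := kq_GK (E := E) (F := F) N hN
  refine ⟨C * K, by positivity, fun ν ε A s h => ?_⟩
  have k1 := (hk s h.hs1).mono le_rfl (by linarith) hT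
  have i2 := h.M_integrable (T := T) (by linarith) 0
  simp only [zero_sub, gs_neg] at i2
  have t := k1.tame ν h.conta.aestronglyMeasurable (integ_dom h.hν i2)
  refine t.mono ?_
  have := integral_dom h.hν (fun y => mul_nonneg (gs_pos _ _).le (norm_nonneg _)) i2
  rw [Mf_zero, mul_assoc]
  gcongr

lemma W_tame (K : ℝ≥0) {N : ℝ} (hN : 0 < N) : ∃ C : ℝ, 0 ≤ C ∧
    ∀ (ν : Measure E) (s : E →L[ℝ] F), ν ≤ K • volume → ‖s‖ ≤ 1 → Tame C (Wf s ν N) := by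
  obtain ⟨C, hC, hk⟩ := kq_GK (E := E) (F := F) N hN
  have hJ := gsint_pos (E := E) (σ := 2 * N) (by linarith)
  refine ⟨C * (K * ∫ y : E, gs (2 * N) y), by positivity, fun ν s hν hs => ?_⟩
  have i2 : Integrable (fun y : E => gs (2 * N) y * ‖(1:ℝ)‖) := by
    simpa using gs_integrable (E := E) (T := 2 * N) (by linarith)
  have t := (hk s hs).tame ν (f := fun _ => (1:ℝ)) aestronglyMeasurable_const (integ_dom hν i2)
  have := integral_dom hν (fun y => mul_nonneg (gs_pos _ _).le (norm_nonneg _)) i2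
  simp only [norm_one, mul_one, smul_eq_mul] at t this
  exact t.mono (by gcongr)

lemma fin_num {Cn Ce X8 M P t e2 ah am f0 fp fm E0 Ep Em : ℝ} (hCn : 0 ≤ Cn) (hCe : 0 ≤ Ce) (hX : 0 ≤ X8)
    (hM : 0 ≤ M) (hP : 0 ≤ P) (ht : 0 ≤ t) (ht1 : t ≤ 1) (he : 0 ≤ e2) (hah : 0 ≤ ah) (ham : 0 ≤ am)
    (hf0 : 0 ≤ f0) (hfp : 0 ≤ fp) (hfm : 0 ≤ fm)
    (e0 : E0 ≤ f0 + Ce * e2 * (X8 * M)) (ep : Ep ≤ fp + Ce * e2 * (ah + X8 * M))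
    (em : Em ≤ fm + Ce * e2 * (am + X8 * M)) :
    Cn * (M + P) * t + E0 + Ep + Em ≤
      (1 + Cn + 3 * Ce * X8 + Ce) * ((t + e2) * M + e2 * (ah + am) + P + (f0 + fp + fm)) := by
  have q1 : Cn * (M + P) * t ≤ Cn * (t * M + P) := by
    have : P * t ≤ P := by nlinarith
    nlinarith
  have r1 : Cn * (t * M + P) ≤ Cn * ((t + e2) * M + e2 * (ah + am) + P + (f0 + fp + fm)) := by
    apply mul_le_mul_of_nonneg_left _ hCn
    have : 0 ≤ e2 * M + e2 * (ah + am) + (f0 + fp + fm) := by positivity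
    linarith
  have r2 : f0 + fp + fm ≤ 1 * ((t + e2) * M + e2 * (ah + am) + P + (f0 + fp + fm)) := by
    have : 0 ≤ (t + e2) * M + e2 * (ah + am) + P := by positivity
    linarith
  have r3 : 3 * Ce * X8 * (e2 * M) ≤
      3 * Ce * X8 * ((t + e2) * M + e2 * (ah + am) + P + (f0 + fp + fm)) := by
    apply mul_le_mul_of_nonneg_left _ (by positivity)
    have : 0 ≤ t * M + e2 * (ah + am) + P + (f0 + fp + fm) := by positivity
    linarith
  have r4 : Ce * (e2 * (ah + am)) ≤ Ce * ((t + e2) * M + e2 * (ah + am) + P + (f0 + fp + fm)) := by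
    apply mul_le_mul_of_nonneg_left _ hCe
    have : 0 ≤ (t + e2) * M + P + (f0 + fp + fm) := by positivity
    linarith
  linarith

set_option maxHeartbeats 1000000 in
lemma P_at (K : ℝ≥0) {τ T η : ℝ} (hτ : 4 ≤ τ) (hT : 2 * (4 * τ + 6) ≤ T) (hη : 0 < η) :
    ∃ C δ : ℝ, 0 ≤ C ∧ 0 < δ ∧ δ ≤ 1 ∧
    ∀ (ν : Measure E) [SFinite ν] (ε : ℝ) (A : E → F) (s : E →L[ℝ] F), Su K ν ε A s →
    2 * η ≤ |WD s ν τ 0| → ∀ h : E, ‖h‖ ≤ δ →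
    ‖av A s h + av A s (-h)‖ ≤ C * ((‖h‖ ^ 2 + ε ^ 2) * Mf A s (4 * T) 0
      + ε ^ 2 * (‖av A s h‖ + ‖av A s (-h)‖) + Ph A ν T
      + (‖FD A ν τ 0‖ + ‖FD A ν τ h‖ + ‖FD A ν τ (-h)‖)) := by
  have hτ0 : 0 < τ := by linarith
  have hT0 : 0 < T := by linarith
  obtain ⟨Cb1, hCb1, hb1⟩ := b_tame (E := E) (F := F) K (N := τ) (T := T) (by linarith) (by linarith)
  obtain ⟨Cb2, hCb2, hb2⟩ := b_tame (E := E) (F := F) K (N := 4 * τ) (T := T) (by linarith) (by linarith)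
  obtain ⟨Cv1, hCv1, hv1⟩ := V_tame (E := E) (F := F) K (N := τ) (T := 4 * T) (by linarith) (by linarith)
  obtain ⟨Cv2, hCv2, hv2⟩ := V_tame (E := E) (F := F) K (N := 4 * τ) (T := 4 * T) (by linarith) (by linarith)
  obtain ⟨Cw1, hCw1, hw1⟩ := W_tame (E := E) (F := F) K (N := τ) (by linarith)
  obtain ⟨Cw2, hCw2, hw2⟩ := W_tame (E := E) (F := F) K (N := 4 * τ) (by linarith)
  obtain ⟨Ce, hCe, he⟩ := eD_bound (E := E) (F := F) K τ hτ0
  set Cw := Cw1 + Cw2 with hCwdef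
  have hCw : 0 ≤ Cw := by positivity
  set Cn := Cb1 + Cb2 + Cv1 + Cv2 with hCn
  have hCn0 : 0 ≤ Cn := by positivity
  set L := 2 * η⁻¹ + (2 * Cw) * (η⁻¹) ^ 2 with hL
  have hL0 : 0 ≤ L := by positivity
  set X8 := Real.exp (1 / (8 * τ)) with hX8
  have hX80 : 0 < X8 := Real.exp_pos _
  refine ⟨L * (1 + Cn + 3 * Ce * X8 + Ce), min 1 (η / (Cw + 1)), by positivity, by positivity,
    min_le_left _ _, fun ν _ ε A s hS hW h hh => ?_⟩
  have hh1 : ‖h‖ ≤ 1 := hh.trans (min_le_left _ _)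
  have hh2 : Cw * ‖h‖ ≤ η := by
    have : ‖h‖ ≤ η / (Cw + 1) := hh.trans (min_le_right _ _)
    rw [le_div_iff₀ (by positivity)] at this
    nlinarith [norm_nonneg h]
  have hh1' : ‖-h‖ ≤ 1 := by simpa using hh1
  have hc1 : |cD E| ≤ 1 := by rw [abs_of_pos cD_pos]; exact cD_le
  have hc0 : |-cD E| ≤ 1 := by rw [abs_neg]; exact hc1
  set M := Mf A s (4 * T) 0 with hM
  have hM0 : 0 ≤ M := Mf_nonneg _ _ _ _
  set P := Ph A ν T with hP
  have hP0 : 0 ≤ P := Ph_nonneg _ _ _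
  -- tameness of W
  have tW : Tame Cw (WD s ν τ) := by
    have t := (hw1 ν s hS.hν hS.hs1).add ((hw2 ν s hS.hν hS.hs1).smul (-cD E))
    have e : (fun x => Wf s ν τ x + (-cD E) • Wf s ν (4 * τ) x) = WD s ν τ := by
      ext x; simp only [WD, smul_eq_mul]; ring
    rw [e] at t
    exact t.mono (by nlinarith)
  have tV : Tame ((Cv1 + Cv2) * M) (VD A s ν τ) := by
    have t := (hv1 ν ε A s hS).add ((hv2 ν ε A s hS).smul (-cD E))
    have e : (fun x => Vf A s ν τ x + (-cD E) • Vf A s ν (4 * τ) x) = VD A s ν τ := by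
      ext x; simp only [VD]; module
    rw [e] at t
    refine t.mono ?_
    have : |-cD E| * (Cv2 * M) ≤ 1 * (Cv2 * M) := by gcongr
    linarith
  have tb : Tame ((Cb1 + Cb2) * (M + P)) (bD s ν τ) := by
    have t := (hb1 ν ε A s hS).add ((hb2 ν ε A s hS).smul (-cD E))
    have e : (fun x => bf s ν τ x + (-cD E) • bf s ν (4 * τ) x) = bD s ν τ := by
      ext x; simp only [bD]; module
    rw [e] at t
    refine t.mono ?_
    have : |-cD E| * (Cb2 * (M + P)) ≤ 1 * (Cb2 * (M + P)) := by gcongr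
    linarith
  have tN : Tame (Cn * (M + P)) (fun x => VD A s ν τ x - bD s ν τ x) := by
    have t := tV.add (tb.smul (-1))
    have e : (fun x => VD A s ν τ x + (-1 : ℝ) • bD s ν τ x) = fun x => VD A s ν τ x - bD s ν τ x := by
      ext x; module
    rw [e] at t
    refine t.mono ?_
    rw [abs_neg, abs_one, one_mul, hCn]
    nlinarith [mul_nonneg (add_nonneg hCv1 hCv2) hP0]
  have w1 := tW.d1 h hh1
  have w2 := tW.d1 (-h) hh1'
  rw [Real.norm_eq_abs] at w1 w2
  rw [norm_neg] at w2
  have hE : ∀ v : E, ‖v‖ ≤ 1 → ‖FD A ν τ v - eD A s ν τ v‖ ≤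
      ‖FD A ν τ v‖ + Ce * ε ^ 2 * (‖av A s v‖ + X8 * M) := fun v hv => by
    refine (norm_sub_le _ _).trans (add_le_add le_rfl ((he ν ε A s hS v).trans ?_))
    have m1 := hS.Mf_shift (T := 8 * τ) (by linarith) v hv
    have m2 := hS.Mf_mono (T := 2 * (8 * τ)) (T' := 4 * T) (by linarith) (by linarith) 0
    gcongr
    exact m1.trans (by gcongr)
  have key := final_alg (ap := av A s h) (am := av A s (-h)) (Np := VD A s ν τ h - bD s ν τ h)
    (Nm := VD A s ν τ (-h) - bD s ν τ (-h)) (N0 := VD A s ν τ 0 - bD s ν τ 0)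
    (Ep := FD A ν τ h - eD A s ν τ h) (Em := FD A ν τ (-h) - eD A s ν τ (-h))
    (E0 := FD A ν τ 0 - eD A s ν τ 0) (Wp := WD s ν τ h) (Wm := WD s ν τ (-h)) (η := η) (c := 2 * Cw)
    (X := Cn * (M + P)) (t := ‖h‖) hη (FD_decomp τ h) (FD_decomp τ (-h))
    (by rw [← FD_decomp, hS.a0, smul_zero])
    (by have := abs_sub_abs_le_abs_sub (WD s ν τ 0) (WD s ν τ h)
        rw [abs_sub_comm] at this; linarith)
    (by have := abs_sub_abs_le_abs_sub (WD s ν τ 0) (WD s ν τ (-h))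
        rw [abs_sub_comm (WD s ν τ 0) (WD s ν τ (-h))] at this; linarith)
    (by have := abs_sub_le (WD s ν τ h) (WD s ν τ 0) (WD s ν τ (-h))
        rw [abs_sub_comm (WD s ν τ 0) (WD s ν τ (-h))] at this; linarith)
    (norm_nonneg _) hh1 (by positivity) (by positivity) (tN.d2 h hh1)
    (by have := tN.d1 (-h) hh1'; rwa [norm_neg] at this)
  refine key.trans ?_
  rw [← hL, mul_assoc L]
  refine mul_le_mul_of_nonneg_left ?_ hL0
  have e0 := hE 0 (by simp)
  have ep := hE h hh1
  have em := hE (-h) hh1'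
  rw [hS.a0, norm_zero, zero_add] at e0
  exact fin_num hCn0 hCe hX80.le hM0 hP0 (sq_nonneg _) (pow_le_one₀ (norm_nonneg _) hh1) (sq_nonneg ε)
    (norm_nonneg _) (norm_nonneg _) (norm_nonneg _) (norm_nonneg _) (norm_nonneg _) e0 ep em

lemma Wf_ge {K : ℝ≥0} {ν : Measure E} {s : E →L[ℝ] F} (hν' : volume ≤ K • ν) (hν : ν ≤ K • volume)
    {τ : ℝ} (hτ : 0 < τ) (x : E) : Jq s τ ≤ K * Wf s ν τ x := by
  have i := (integ_dom hν (kq_integrable s hτ x)).smul_measure_nnreal (c := K)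
  have := integral_mono_measure hν' (Filter.Eventually.of_forall fun y => (kq_pos s τ (x - y)).le) i
  rw [integral_smul_nnreal_measure, NNReal.smul_def, smul_eq_mul,
    integral_sub_left_eq_self (fun y => kq s τ y) volume x] at this
  exact this

/-- selection of a good scale -/
lemma selection (K : ℝ≥0) (hK : 1 ≤ K) : ∃ (L : ℕ) (η : ℝ), 0 < η ∧
    ∀ (ν : Measure E) (ε : ℝ) (A : E → F) (s : E →L[ℝ] F), Su K ν ε A s →
    ∃ j ∈ Finset.range L, 2 * η ≤ |WD s ν (4 ^ (j + 1)) 0| := by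
  have hK0 : (0:ℝ) < K := by exact_mod_cast (zero_lt_one.trans_le hK)
  obtain ⟨L, hL⟩ := pow_unbounded_of_one_lt (2 * (K:ℝ) ^ 2) (by norm_num : (1:ℝ) < 2)
  have hJ := gsint_pos (E := E) (σ := 1 / 2) (by norm_num)
  set J0 := ∫ z : E, gs (1 / 2) z
  refine ⟨L, J0 / (8 * K), by positivity, fun ν ε A s h => ?_⟩
  by_contra hcon
  push Not at hcon
  have hJ1 : J0 ≤ Jq s 1 := Jq_ge h.hs1 (by norm_num)
  set q := Jq s 1 with hq
  set n := Module.finrank ℝ E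
  have hsq : ∀ j : ℕ, Real.sqrt (4 ^ j) = 2 ^ j := fun j => by
    rw [show (4:ℝ) ^ j = (2 ^ j) ^ 2 by rw [← pow_mul, mul_comm, pow_mul]; norm_num]
    exact Real.sqrt_sq (by positivity)
  set w : ℕ → ℝ := fun j => Wf s ν (4 ^ j) 0 / (2 ^ j) ^ n with hw
  have hp : ∀ j : ℕ, (0:ℝ) < (2 ^ j) ^ n := fun j => by positivity
  have hwlow : ∀ j, q / K ≤ w j := fun j => by
    have := Wf_ge (s := s) h.hν' h.hν (τ := 4 ^ j) (by positivity) 0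
    rw [Jq_scale s (by positivity), hsq] at this
    rw [hw]; simp only
    rw [div_le_div_iff₀ hK0 (hp j)]
    linarith
  have hwup : ∀ j, w j ≤ K * q := fun j => by
    have := Wf_le (s := s) h.hν (τ := 4 ^ j) (by positivity) 0
    rw [Jq_scale s (by positivity), hsq] at this
    rw [hw]; simp only
    rw [div_le_iff₀ (hp j)]
    linarith
  have hWD : ∀ j, WD s ν (4 ^ j) 0 = (2 ^ j) ^ n * (w j - w (j + 1) / 2) := fun j => by
    have e1 : (4:ℝ) * 4 ^ j = 4 ^ (j + 1) := by ring
    have e2 : cD E = ((2:ℝ) ^ (n + 1))⁻¹ := rfl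
    rw [hw, WD, e1, e2]; simp only
    rw [pow_succ (2:ℝ) j, mul_pow, pow_succ (2:ℝ) n]
    field_simp
  have hstep : ∀ j < L, 2 * (w (j + 1) - q / (2 * K)) ≤ w (j + 2) - q / (2 * K) := fun j hj => by
    have h1 := hcon j (Finset.mem_range.2 hj)
    rw [hWD, abs_mul, abs_of_pos (hp _)] at h1
    have h2 : |w (j + 1) - w (j + 1 + 1) / 2| < 2 * (J0 / (8 * K)) := by
      refine lt_of_le_of_lt ?_ h1
      have : (1:ℝ) ≤ (2 ^ (j + 1)) ^ n := one_le_pow₀ (one_le_pow₀ (by norm_num))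
      nlinarith [abs_nonneg (w (j + 1) - w (j + 1 + 1) / 2)]
    have h3 : 2 * (J0 / (8 * K)) ≤ q / (4 * K) := by
      rw [show 2 * (J0 / (8 * (K:ℝ))) = J0 / (4 * K) by field_simp; norm_num]
      gcongr
    have h4 := (abs_lt.1 h2).2
    have e : q / (2 * (K:ℝ)) = 2 * (q / (4 * K)) := by field_simp; norm_num
    rw [e]
    change _ ≤ w (j + 1 + 1) - _
    linarith
  have hiter : ∀ j ≤ L, 2 ^ j * (q / (2 * K)) ≤ w (j + 1) - q / (2 * K) := by
    intro j
    induction j with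
    | zero =>
      intro _
      have := hwlow 1
      have e : q / (K:ℝ) = 2 * (q / (2 * K)) := by field_simp
      rw [e] at this
      simp only [pow_zero, one_mul, zero_add]
      linarith
    | succ j ih =>
      intro hj
      have h1 := ih (by omega)
      have h2 := hstep j (by omega)
      rw [pow_succ]
      change _ ≤ w (j + 2) - _
      linarith
  have h1 := hiter L le_rfl
  have h2 := hwup (L + 1)
  have hq0 : 0 < q := hJ.trans_le hJ1
  have h3 : 2 ^ L * (q / (2 * K)) ≤ K * q := by
    have : 0 < q / (2 * (K:ℝ)) := by positivity
    linarith
  have h4 : (2 * (K:ℝ) ^ 2) * (q / (2 * K)) < 2 ^ L * (q / (2 * K)) := by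
    apply mul_lt_mul_of_pos_right hL; positivity
  have h5 : (2 * (K:ℝ) ^ 2) * (q / (2 * K)) = K * q := by field_simp
  linarith


lemma P_origin (K : ℝ≥0) (hK : 1 ≤ K) : ∃ (L : ℕ) (T C δ : ℝ), 0 < T ∧ 0 ≤ C ∧ 0 < δ ∧ δ ≤ 1 ∧
    ∀ (ν : Measure E) [SFinite ν] (ε : ℝ) (A : E → F) (s : E →L[ℝ] F), Su K ν ε A s →
    ∀ h : E, ‖h‖ ≤ δ →
    ‖av A s h + av A s (-h)‖ ≤ C * ((‖h‖ ^ 2 + ε ^ 2) * Mf A s (4 * T) 0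
      + ε ^ 2 * (‖av A s h‖ + ‖av A s (-h)‖) + Ph A ν T
      + ∑ j ∈ Finset.range L, (‖FD A ν (4 ^ (j + 1)) 0‖ + ‖FD A ν (4 ^ (j + 1)) h‖
          + ‖FD A ν (4 ^ (j + 1)) (-h)‖)) := by
  obtain ⟨L, η, hη, hsel⟩ := selection (E := E) (F := F) K hK
  set T : ℝ := 2 * (4 * 4 ^ L + 6) with hT
  have key : ∀ j : ℕ, ∃ C δ : ℝ, 0 ≤ C ∧ 0 < δ ∧ δ ≤ 1 ∧ (j < L →
    ∀ (ν : Measure E) [SFinite ν] (ε : ℝ) (A : E → F) (s : E →L[ℝ] F), Su K ν ε A s →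
    2 * η ≤ |WD s ν (4 ^ (j + 1)) 0| → ∀ h : E, ‖h‖ ≤ δ →
    ‖av A s h + av A s (-h)‖ ≤ C * ((‖h‖ ^ 2 + ε ^ 2) * Mf A s (4 * T) 0
      + ε ^ 2 * (‖av A s h‖ + ‖av A s (-h)‖) + Ph A ν T
      + (‖FD A ν (4 ^ (j + 1)) 0‖ + ‖FD A ν (4 ^ (j + 1)) h‖ + ‖FD A ν (4 ^ (j + 1)) (-h)‖))) := by
    intro j
    by_cases hj : j < L
    · have h1 : (4:ℝ) ^ (j + 1) ≤ 4 ^ L := pow_le_pow_right₀ (by norm_num) hj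
      have h2 : (4:ℝ) ^ 1 ≤ 4 ^ (j + 1) := pow_le_pow_right₀ (by norm_num) (by omega)
      obtain ⟨C, δ, a, b, c, d⟩ := P_at (E := E) (F := F) K (τ := 4 ^ (j + 1)) (T := T) (η := η)
        (by linarith) (by rw [hT]; linarith) hη
      exact ⟨C, δ, a, b, c, fun _ => d⟩
    · exact ⟨0, 1, le_rfl, one_pos, le_rfl, fun h => absurd h hj⟩
  choose C δ hC hδ hδ1 hkey using key
  have hmin : ∀ m : ℕ, ∃ d : ℝ, 0 < d ∧ d ≤ 1 ∧ ∀ j < m, d ≤ δ j := by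
    intro m
    induction m with
    | zero => exact ⟨1, one_pos, le_rfl, fun j hj => absurd hj (Nat.not_lt_zero j)⟩
    | succ m ih =>
      obtain ⟨d, hd, hd1, h⟩ := ih
      refine ⟨min d (δ m), lt_min hd (hδ m), (min_le_left _ _).trans hd1, fun j hj => ?_⟩
      rcases Nat.lt_succ_iff_lt_or_eq.1 hj with h' | h'
      · exact (min_le_left _ _).trans (h j h')
      · subst h'; exact min_le_right _ _
  obtain ⟨d, hd, hd1, hdj⟩ := hmin L
  have hT0 : 0 < T := by positivity
  refine ⟨L, T, ∑ j ∈ Finset.range L, C j, d, hT0, Finset.sum_nonneg fun j _ => hC j, hd, hd1, ?_⟩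
  intro ν _ ε A s hS h hh
  obtain ⟨j, hj, hW⟩ := hsel ν ε A s hS
  have hjL := Finset.mem_range.1 hj
  refine (hkey j hjL ν ε A s hS hW h (hh.trans (hdj j hjL))).trans ?_
  have hM := Mf_nonneg A s (4 * T) 0
  have hP := Ph_nonneg A ν T
  refine mul_le_mul (Finset.single_le_sum (f := C) (fun i _ => hC i) hj) ?_ (by positivity)
    (Finset.sum_nonneg fun j _ => hC j)
  refine add_le_add le_rfl ?_
  exact Finset.single_le_sum (f := fun j => (‖FD A ν (4 ^ (j + 1)) 0‖ + ‖FD A ν (4 ^ (j + 1)) h‖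
          + ‖FD A ν (4 ^ (j + 1)) (-h)‖)) (fun i _ => by positivity) hj

lemma FD_translate (A : E → F) (ν : Measure E) (τ : ℝ) (x z : E) :
    FD (fun y => A (x + y) - A x) (ν.map (fun y => y - x)) τ z = FD A ν τ (x + z) := by
  have : ∀ τ, FG (fun y => A (x + y) - A x) (ν.map (fun y => y - x)) τ z = FG A ν τ (x + z) := by
    intro τ
    unfold FG
    rw [(measurableEmbedding_subRight x).integral_map]
    refine integral_congr_ae (Filter.Eventually.of_forall fun y => ?_)
    simp only [add_sub_cancel, sub_sub_sub_cancel_right]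
    rw [show z - (y - x) = x + z - y by abel]
  simp only [FD, this]

lemma P_x (K : ℝ≥0) (hK : 1 ≤ K) : ∃ (L : ℕ) (T C δ : ℝ), 0 < T ∧ 0 ≤ C ∧ 0 < δ ∧ δ ≤ 1 ∧
    ∀ (ν : Measure E) [SFinite ν] (ε : ℝ) (A : E → F), ν ≤ K • volume → volume ≤ K • ν → 0 ≤ ε → ε ≤ 1 →
    (∀ x y, ‖A x - A y‖ ≤ ε * ‖x - y‖) → ∀ (x : E) (s : E →L[ℝ] F), ‖s‖ ≤ ε →
    ∀ h : E, ‖h‖ ≤ δ →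
    ‖A (x + h) + A (x - h) - (2:ℝ) • A x‖ ≤ C * ((‖h‖ ^ 2 + ε ^ 2) * (∫ y, gs (4 * T) y * ‖A (x + y) - A x - s y‖)
      + ε ^ 2 * (‖A (x + h) - A x - s h‖ + ‖A (x - h) - A x - s (-h)‖)
      + ((∫ y, gs T y * ‖FD A ν 1 (x + y)‖) + ∫ y, gs T y * ‖FD A ν 2 (x + y)‖)
      + ∑ j ∈ Finset.range L, (‖FD A ν (4 ^ (j + 1)) x‖ + ‖FD A ν (4 ^ (j + 1)) (x + h)‖
          + ‖FD A ν (4 ^ (j + 1)) (x - h)‖)) := by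
  obtain ⟨L, T, C, δ, hT, hC, hδ, hδ1, key⟩ := P_origin (E := E) (F := F) K hK
  refine ⟨L, T, C, δ, hT, hC, hδ, hδ1, fun ν _ ε A hν hν' h0 h1 hlip x s hs h hh => ?_⟩
  have hm : Measurable (fun y : E => y - x) := by fun_prop
  have hvol : (volume : Measure E).map (fun y => y - x) = volume :=
    (measurePreserving_sub_right volume x).map_eq
  have hS : Su K (ν.map (fun y => y - x)) ε (fun y => A (x + y) - A x) s := by
    refine ⟨?_, ?_, h0, h1, ?_, hs, by simp⟩
    · have := Measure.map_mono hν hm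
      rwa [Measure.map_smul, hvol] at this
    · have := Measure.map_mono hν' hm
      rwa [Measure.map_smul, hvol] at this
    · intro a b
      have := hlip (x + a) (x + b)
      simpa using this
  have := key (ν.map (fun y => y - x)) ε _ s hS h hh
  rw [Mf_zero] at this
  simp only [Ph, FD_translate, av, add_zero] at this
  rw [← sub_eq_add_neg] at this
  refine le_trans (le_of_eq ?_) this
  rw [map_neg]
  congr 1
  module


lemma e_add_sq (a b : ℝ≥0∞) : (a + b) ^ 2 ≤ 2 * (a ^ 2 + b ^ 2) := by
  rcases eq_or_ne a ∞ with rfl | ha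
  · simp
  rcases eq_or_ne b ∞ with rfl | hb
  · simp
  lift a to ℝ≥0 using ha
  lift b to ℝ≥0 using hb
  have := add_sq_le (a := a) (b := b)
  exact_mod_cast this

lemma cs_pt {α : Type*} [MeasurableSpace α] (ρ : Measure α) {k f : α → ℝ≥0∞} (hk : Measurable k)
    (hf : Measurable f) : (∫⁻ a, k a * f a ∂ρ) ^ 2 ≤ (∫⁻ a, k a ∂ρ) * ∫⁻ a, k a * f a ^ 2 ∂ρ := by
  have h := ENNReal.lintegral_mul_le_Lp_mul_Lq (ρ.withDensity k) (p := 2) (q := 2)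
    Real.HolderConjugate.two_two (f := fun _ => 1) (g := f) aemeasurable_const hf.aemeasurable
  rw [lintegral_withDensity_eq_lintegral_mul ρ hk (measurable_const.mul hf),
    lintegral_withDensity_eq_lintegral_mul ρ hk (by fun_prop),
    lintegral_withDensity_eq_lintegral_mul ρ hk (by fun_prop)] at h
  simp only [Pi.mul_apply, one_mul, ENNReal.rpow_two, one_pow, mul_one] at h
  calc _ ≤ ((∫⁻ a, k a ∂ρ) ^ (1 / (2:ℝ)) * (∫⁻ a, k a * f a ^ 2 ∂ρ) ^ (1 / (2:ℝ))) ^ 2 := by gcongr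
    _ = _ := by
      rw [mul_pow, ← ENNReal.rpow_natCast, ← ENNReal.rpow_natCast, ← ENNReal.rpow_mul, ← ENNReal.rpow_mul]
      norm_num

lemma cs_int {α β : Type*} [MeasurableSpace α] [MeasurableSpace β] (ρ : Measure α) [SFinite ρ]
    (m : Measure β) [SFinite m] {k : α → ℝ≥0∞}
    {f : α → β → ℝ≥0∞} (hk : Measurable k) (hf : Measurable (Function.uncurry f)) :
    ∫⁻ x, (∫⁻ a, k a * f a x ∂ρ) ^ 2 ∂m ≤ (∫⁻ a, k a ∂ρ) * ∫⁻ a, k a * (∫⁻ x, f a x ^ 2 ∂m) ∂ρ := by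
  calc _ ≤ ∫⁻ x, (∫⁻ a, k a ∂ρ) * (∫⁻ a, k a * f a x ^ 2 ∂ρ) ∂m := by
        refine lintegral_mono fun x => cs_pt ρ hk ?_
        exact hf.comp measurable_prodMk_right
    _ = (∫⁻ a, k a ∂ρ) * ∫⁻ x, (∫⁻ a, k a * f a x ^ 2 ∂ρ) ∂m := by
        rw [lintegral_const_mul]
        refine Measurable.lintegral_prod_right' (f := fun p : β × α => k p.2 * f p.2 p.1 ^ 2) ?_
        exact (hk.comp measurable_snd).mul ((hf.comp measurable_swap).pow_const 2)
    _ = _ := by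
        congr 1
        rw [lintegral_lintegral_swap]
        · refine lintegral_congr fun a => ?_
          rw [lintegral_const_mul]
          exact (hf.comp measurable_prodMk_left).pow_const 2
        · exact ((hk.comp measurable_snd).mul ((hf.comp measurable_swap).pow_const 2)).aemeasurable

/-- second difference -/
def D2 (A : E → F) (y x : E) : F := A (x + y) + A (x - y) - (2:ℝ) • A x

def DD (A : E → F) (y : E) : ℝ≥0∞ := ∫⁻ x, ‖D2 A y x‖ₑ ^ 2

def UU (A : E → F) : ℝ≥0∞ := ∫⁻ y, gE 2 y * DD A y

/-- normalised Gaussian -/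
def phi (y : E) : ℝ := (∫ z : E, gs 1 z)⁻¹ * gs 1 y

def psi (z w : E) : ℝ := (4 * (inner ℝ w z) ^ 2 - 2 * ‖z‖ ^ 2) * phi w

/-- slope -/
def sl (A : E → F) (x : E) : E →L[ℝ] F :=
  ∫ y, phi y • (innerSL ℝ ((2:ℝ) • y)).smulRight (A (x + y))

lemma phi_cont : Continuous (phi : E → ℝ) := continuous_const.mul (gs_cont 1)
lemma phi_pos (y : E) : 0 < phi y := mul_pos (inv_pos.2 (gsint_pos one_pos)) (gs_pos _ _)
lemma phi_integrable : Integrable (phi : E → ℝ) := (gs_integrable one_pos).const_mul _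
lemma phi_int : ∫ y : E, phi y = 1 := by
  unfold phi
  rw [integral_const_mul]
  exact inv_mul_cancel₀ (gsint_pos one_pos).ne'
lemma phi_neg (y : E) : phi (-y) = phi y := by simp [phi, gs_neg]

lemma phi_poly (k : ℕ) : ∃ C : ℝ, 0 ≤ C ∧ ∀ y : E, ‖y‖ ^ k * phi y ≤ C * gs 2 y := by
  obtain ⟨C, hC, h⟩ := poly_gs (E := E) k 0 1 one_pos
  have hJ := gsint_pos (E := E) (σ := 1) one_pos
  refine ⟨(∫ z : E, gs 1 z)⁻¹ * C, by positivity, fun y => ?_⟩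
  have := h y
  simp only [zero_mul, Real.exp_zero, mul_one] at this
  unfold phi
  calc _ = (∫ z : E, gs 1 z)⁻¹ * (‖y‖ ^ k * gs 1 y) := by ring
    _ ≤ (∫ z : E, gs 1 z)⁻¹ * (C * gs 2 y) := by gcongr
    _ = _ := by ring

lemma psi_cont (z : E) : Continuous (psi z) := by
  have := phi_cont (E := E)
  unfold psi; fun_prop
lemma psi_neg (z w : E) : psi z (-w) = psi z w := by simp [psi, phi_neg]

lemma psi_bound : ∃ C : ℝ, 0 ≤ C ∧ ∀ z w : E, |psi z w| ≤ C * ‖z‖ ^ 2 * gs 2 w := by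
  obtain ⟨C0, hC0, h0⟩ := phi_poly (E := E) 0
  obtain ⟨C2, hC2, h2⟩ := phi_poly (E := E) 2
  refine ⟨4 * C2 + 2 * C0, by positivity, fun z w => ?_⟩
  have h0 := h0 w
  have h2 := h2 w
  have hp := phi_pos w
  rw [pow_zero, one_mul] at h0
  have hi : (inner ℝ w z) ^ 2 ≤ ‖w‖ ^ 2 * ‖z‖ ^ 2 := by
    rw [← mul_pow]; apply sq_le_sq'
    · have := neg_le_of_abs_le (abs_real_inner_le_norm w z); linarith
    · exact real_inner_le_norm w z
  unfold psi
  rw [abs_mul, abs_of_pos hp]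
  calc _ ≤ (4 * (‖w‖ ^ 2 * ‖z‖ ^ 2) + 2 * ‖z‖ ^ 2) * phi w := by
        gcongr
        rw [abs_le]; constructor <;> nlinarith [sq_nonneg (inner ℝ w z : ℝ), sq_nonneg ‖z‖]
    _ = ‖z‖ ^ 2 * (4 * (‖w‖ ^ 2 * phi w) + 2 * phi w) := by ring
    _ ≤ ‖z‖ ^ 2 * (4 * (C2 * gs 2 w) + 2 * (C0 * gs 2 w)) := by gcongr
    _ = _ := by ring

lemma psi_integrable (z : E) : Integrable (psi z) := by
  obtain ⟨C, hC, h⟩ := psi_bound (E := E)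
  exact ((gs_integrable (E := E) (T := 2) (by norm_num)).const_mul (C * ‖z‖ ^ 2)).mono'
    (psi_cont z).aestronglyMeasurable (Filter.Eventually.of_forall fun w => h z w)

lemma taylor1 (a b e : ℝ) : Real.exp (-(a - 2 * b + e)) - Real.exp (-a) - 2 * b * Real.exp (-a) =
    ∫ t in (0:ℝ)..1, (1 - t) * ((4 * (b - t * e) ^ 2 - 2 * e) * Real.exp (-(a - 2 * b * t + e * t ^ 2))) := by
  have hd : ∀ t : ℝ, HasDerivAt (fun t => ((1 - t) * (2 * (b - t * e)) + 1) *
      Real.exp (-(a - 2 * b * t + e * t ^ 2)))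
      ((1 - t) * ((4 * (b - t * e) ^ 2 - 2 * e) * Real.exp (-(a - 2 * b * t + e * t ^ 2)))) t := by
    intro t
    have h1 : HasDerivAt (fun t : ℝ => -(a - 2 * b * t + e * t ^ 2)) (2 * (b - t * e)) t := by
      have := (((hasDerivAt_id' t).const_mul (2 * b)).const_sub a).add (((hasDerivAt_id' t).pow 2).const_mul e)
      exact this.neg.congr_deriv (by norm_num; ring)
    have h2 : HasDerivAt (fun t : ℝ => (1 - t) * (2 * (b - t * e)) + 1)
        (-(2 * (b - t * e)) + (1 - t) * (-(2 * e))) t := by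
      have := (((hasDerivAt_id' t).const_sub 1).mul
        ((((hasDerivAt_id' t).mul_const e).const_sub b).const_mul 2)).add_const 1
      exact this.congr_deriv (by ring)
    exact (h2.mul h1.exp).congr_deriv (by ring)
  rw [intervalIntegral.integral_eq_sub_of_hasDerivAt (fun t _ => hd t)
    ((by fun_prop : Continuous _).intervalIntegrable _ _)]
  norm_num
  ring

lemma taylor_phi (z y : E) : phi (y - z) - phi y - 2 * inner ℝ y z * phi y =
    ∫ t in (0:ℝ)..1, (1 - t) * psi z (y - t • z) := by
  have hn : ∀ t : ℝ, ‖y - t • z‖ ^ 2 = ‖y‖ ^ 2 - 2 * inner ℝ y z * t + ‖z‖ ^ 2 * t ^ 2 := fun t => by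
    rw [norm_sub_sq_real, inner_smul_right, norm_smul, mul_pow, Real.norm_eq_abs, sq_abs]; ring
  have h := taylor1 (‖y‖ ^ 2) (inner ℝ y z) (‖z‖ ^ 2)
  have h1 := hn 1
  rw [one_smul] at h1
  obtain ⟨c, hc⟩ : ∃ c : ℝ, ∀ w : E, phi w = c * Real.exp (-(‖w‖ ^ 2)) :=
    ⟨_, fun w => by unfold phi; congr 1; unfold gs; rw [div_one]⟩
  have e : ∀ t : ℝ, (1 - t) * psi z (y - t • z) = c * ((1 - t) * ((4 * (inner ℝ y z - t * ‖z‖ ^ 2) ^ 2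
      - 2 * ‖z‖ ^ 2) * Real.exp (-(‖y‖ ^ 2 - 2 * inner ℝ y z * t + ‖z‖ ^ 2 * t ^ 2)))) := fun t => by
    unfold psi
    rw [hc, hn, inner_sub_left, inner_smul_left, real_inner_self_eq_norm_sq]
    simp only [conj_trivial]
    ring
  simp only [e]
  rw [intervalIntegral.integral_const_mul, ← h, hc, hc, h1]
  rw [show ‖y‖ ^ 2 - 2 * inner ℝ y z * 1 + ‖z‖ ^ 2 * 1 ^ 2 = ‖y‖ ^ 2 - 2 * inner ℝ y z + ‖z‖ ^ 2 by ring]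
  ring


section
variable {A : E → F} {B : ℝ}

lemma bint {α : Type*} [MeasurableSpace α] {m : Measure α} {k : α → ℝ} (hk : Integrable k m) {f : α → F}
    (hf : AEStronglyMeasurable f m) (hb : ∀ x, ‖f x‖ ≤ B) : Integrable (fun y => k y • f y) m := by
  refine (hk.norm.mul_const B).mono' (hk.aestronglyMeasurable.smul hf)
    (Filter.Eventually.of_forall fun y => ?_)
  rw [norm_smul]
  exact mul_le_mul_of_nonneg_left (hb y) (norm_nonneg _)

lemma D2_cont (hA : Continuous A) : Continuous (fun p : E × E => D2 A p.1 p.2) := by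
  unfold D2; fun_prop

lemma even_conv (hA : Continuous A) (hb : ∀ x, ‖A x‖ ≤ B) {k : E → ℝ} (hk : Integrable k)
    (he : ∀ y, k (-y) = k y) (x : E) :
    ∫ y, k y • A (x + y) = (1/2 : ℝ) • (∫ y, k y • D2 A y x) + (∫ y, k y) • A x := by
  have i1 : Integrable (fun y => k y • A (x + y)) :=
    bint hk (by fun_prop : Continuous fun y => A (x + y)).aestronglyMeasurable fun y => hb _
  have i2 : Integrable (fun y => k y • A (x - y)) :=
    bint hk (by fun_prop : Continuous fun y => A (x - y)).aestronglyMeasurable fun y => hb _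
  have i3 : Integrable (fun y => k y • (2:ℝ) • A x) := hk.smul_const _
  have e2 : ∫ y, k y • A (x - y) = ∫ y, k y • A (x + y) := by
    rw [← integral_neg_eq_self]
    simp only [he, sub_neg_eq_add]
  have : ∫ y, k y • D2 A y x = (∫ y, k y • A (x + y)) + (∫ y, k y • A (x - y)) - ∫ y, k y • (2:ℝ) • A x := by
    have i4 : Integrable (fun y => k y • A (x + y) + k y • A (x - y)) := i1.add i2
    rw [← integral_add i1 i2, ← integral_sub i4 i3]
    congr 1; ext y; simp only [D2]; module
  rw [this, e2, integral_smul_const]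
  module

lemma phiw_integrable : Integrable (fun y : E => ‖y‖ * phi y) := by
  obtain ⟨C, hC, h⟩ := phi_poly (E := E) 1
  refine ((gs_integrable (E := E) (T := 2) (by norm_num)).const_mul C).mono'
    (continuous_norm.mul phi_cont).aestronglyMeasurable (Filter.Eventually.of_forall fun w => ?_)
  have := h w
  rw [pow_one] at this
  rwa [Real.norm_of_nonneg (mul_nonneg (norm_nonneg _) (phi_pos _).le)]

lemma phiz_integrable (z : E) : Integrable (fun y : E => 2 * inner ℝ y z * phi y) := by
  refine (phiw_integrable.const_mul (2 * ‖z‖)).mono' ?_ (Filter.Eventually.of_forall fun w => ?_)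
  · have := phi_cont (E := E)
    exact (by fun_prop : Continuous fun y : E => 2 * inner ℝ y z * phi y).aestronglyMeasurable
  · rw [norm_mul, norm_mul, Real.norm_of_nonneg (phi_pos w).le, Real.norm_eq_abs, Real.norm_eq_abs, abs_two]
    have := abs_real_inner_le_norm w z
    have := phi_pos w
    calc _ ≤ 2 * (‖w‖ * ‖z‖) * phi w := by gcongr
      _ = _ := by ring

lemma sl_apply (hA : Continuous A) (hb : ∀ x, ‖A x‖ ≤ B) (x z : E) :
    sl A x z = ∫ y, (2 * inner ℝ y z * phi y) • A (x + y) := by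
  have hi : Integrable (fun y => phi y • (innerSL ℝ ((2:ℝ) • y)).smulRight (A (x + y))) := by
    refine (phiw_integrable.const_mul (2 * B)).mono' ?_ (Filter.Eventually.of_forall fun y => ?_)
    · have : Continuous fun y : E => phi y • (ContinuousLinearMap.smulRightL ℝ E F (innerSL ℝ ((2:ℝ) • y)) (A (x + y))) := by
        have := phi_cont (E := E)
        fun_prop
      exact this.aestronglyMeasurable
    · rw [norm_smul, ContinuousLinearMap.norm_smulRight_apply, innerSL_apply_norm, norm_smul,
        Real.norm_of_nonneg (phi_pos y).le, Real.norm_of_nonneg (by norm_num : (0:ℝ) ≤ 2)]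
      have := phi_pos y
      have := hb (x + y)
      calc _ ≤ phi y * (2 * ‖y‖ * B) := by gcongr
        _ = _ := by ring
  unfold sl
  rw [ContinuousLinearMap.integral_apply hi]
  congr 1; ext y
  simp only [ContinuousLinearMap.smul_apply, ContinuousLinearMap.smulRight_apply, innerSL_apply_apply,
    inner_smul_left, smul_smul]
  congr 1
  simp only [conj_trivial]
  ring

lemma Kz_conv (hA : Continuous A) (hb : ∀ x, ‖A x‖ ≤ B) (x z : E) :
    ∫ y, (phi (y - z) - phi y - 2 * inner ℝ y z * phi y) • A (x + y) =
      ∫ t in Ioc (0:ℝ) 1, (1 - t) • ∫ w, psi z w • A (x + t • z + w) := by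
  have hB : 0 ≤ B := (norm_nonneg _).trans (hb 0)
  obtain ⟨C, hC, hpsi⟩ := psi_bound (E := E)
  have hpc := psi_cont z
  have hi : Integrable (Function.uncurry fun (y : E) (t : ℝ) => ((1 - t) * psi z (y - t • z)) • A (x + y))
      (volume.prod (volume.restrict (Ioc (0:ℝ) 1))) := by
    have hd := (((gs_integrable (E := E) (T := 4) (by norm_num)).const_mul
      (C * ‖z‖ ^ 2 * Real.exp (‖z‖ ^ 2 / 2) * B))).comp_fst (volume.restrict (Ioc (0:ℝ) 1))
    refine hd.mono' ?_ ?_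
    · exact (by fun_prop : Continuous fun p : E × ℝ => ((1 - p.2) * psi z (p.1 - p.2 • z)) •
        A (x + p.1)).aestronglyMeasurable
    · have hae : ∀ᵐ p : E × ℝ ∂(volume.prod (volume.restrict (Ioc (0:ℝ) 1))), p.2 ∈ Ioc (0:ℝ) 1 :=
        Measure.quasiMeasurePreserving_snd.ae (ae_restrict_mem measurableSet_Ioc)
      filter_upwards [hae] with p hp
      obtain ⟨y, t⟩ := p
      simp only [Function.uncurry_apply_pair] at hp ⊢
      obtain ⟨h0, h1⟩ := hp
      rw [norm_smul, norm_mul, Real.norm_of_nonneg (by linarith : 0 ≤ 1 - t), Real.norm_eq_abs]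
      have g1 := gs_shift (E := E) (T := 2) (by norm_num) y (-(t • z))
      rw [← sub_eq_add_neg, norm_neg, norm_smul, Real.norm_of_nonneg h0.le] at g1
      norm_num at g1
      have g2 : Real.exp ((t * ‖z‖) ^ 2 / 2) ≤ Real.exp (‖z‖ ^ 2 / 2) := by
        apply Real.exp_le_exp.2
        gcongr
        nlinarith [norm_nonneg z]
      have g4 := gs_pos 4 y
      calc (1 - t) * |psi z (y - t • z)| * ‖A (x + y)‖
          ≤ 1 * (C * ‖z‖ ^ 2 * (Real.exp (‖z‖ ^ 2 / 2) * gs 4 y)) * B := by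
            gcongr
            · linarith
            · refine (hpsi z _).trans ?_
              gcongr
              exact g1.trans (by gcongr)
            · exact hb _
        _ = _ := by ring
  have e1 : ∀ y, (phi (y - z) - phi y - 2 * inner ℝ y z * phi y) • A (x + y) =
      ∫ t in Ioc (0:ℝ) 1, ((1 - t) * psi z (y - t • z)) • A (x + y) := fun y => by
    rw [integral_smul_const, taylor_phi, intervalIntegral.integral_of_le zero_le_one]
  simp only [e1]
  rw [integral_integral_swap hi]
  refine integral_congr_ae (Filter.Eventually.of_forall fun t => ?_)
  simp only
  rw [← integral_add_right_eq_self _ (t • z), ← integral_smul]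
  congr 1; ext w
  simp only [add_sub_cancel_right, smul_smul]
  rw [show x + (w + t • z) = x + t • z + w by abel]

lemma Kz_split (hA : Continuous A) (hb : ∀ x, ‖A x‖ ≤ B) (x z : E) :
    ∫ y, (phi (y - z) - phi y - 2 * inner ℝ y z * phi y) • A (x + y) =
      (∫ y, phi y • A (x + z + y)) - (∫ y, phi y • A (x + y)) - sl A x z := by
  have hc : AEStronglyMeasurable (fun y => A (x + y)) volume :=
    (by fun_prop : Continuous fun y => A (x + y)).aestronglyMeasurable
  have hp1 : Integrable (fun y : E => phi (y - z)) := phi_integrable.comp_sub_right z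
  have i1 := bint hp1 hc fun y => hb _
  have i2 := bint phi_integrable hc fun y => hb _
  have i3 := bint (phiz_integrable z) hc fun y => hb _
  have e : ∫ y, phi y • A (x + z + y) = ∫ y, phi (y - z) • A (x + y) := by
    rw [← integral_add_right_eq_self (fun y => phi (y - z) • A (x + y)) z]
    congr 1; ext y
    rw [add_sub_cancel_right, show x + (y + z) = x + z + y by abel]
  have i4 : Integrable (fun y => phi (y - z) • A (x + y) - phi y • A (x + y)) := i1.sub i2
  rw [e, sl_apply hA hb, ← integral_sub i1 i2, ← integral_sub i4 i3]
  congr 1; ext y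
  simp only [sub_smul]

lemma phiz_int (z : E) : ∫ y : E, 2 * inner ℝ y z * phi y = 0 := by
  have : ∫ y : E, 2 * inner ℝ y z * phi y = - ∫ y : E, 2 * inner ℝ y z * phi y := by
    conv_lhs => rw [← integral_neg_eq_self]
    rw [← integral_neg]
    congr 1; ext y
    rw [phi_neg, inner_neg_left]; ring
  linarith

lemma psi_int (z : E) : ∫ w, psi z w = 0 := by
  have h1 := Kz_conv (E := E) (F := ℝ) (A := fun _ => 1) (B := 1) continuous_const (fun x => by simp) 0 z
  have hp1 : Integrable (fun y : E => phi (y - z)) := phi_integrable.comp_sub_right z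
  simp only [smul_eq_mul, mul_one] at h1
  have i4 : Integrable (fun y : E => phi (y - z) - phi y) := hp1.sub phi_integrable
  rw [integral_sub i4 (phiz_integrable z), integral_sub hp1 phi_integrable,
    integral_sub_right_eq_self] at h1
  rw [phiz_int, integral_mul_const, ← intervalIntegral.integral_of_le zero_le_one] at h1
  have h3 : ∫ t in (0:ℝ)..1, (1 - t) = 1 / 2 := by
    rw [intervalIntegral.integral_sub (by simp) (by simp)]
    simp; norm_num
  rw [h3] at h1
  linarith

/-- the representation of the deviation -/
lemma dev_repr (hA : Continuous A) (hb : ∀ x, ‖A x‖ ≤ B) (x z : E) :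
    A (x + z) - A x - sl A x z = -((1/2 : ℝ) • (∫ y, phi y • D2 A y (x + z)))
      + (1/2 : ℝ) • (∫ y, phi y • D2 A y x)
      + ∫ t in Ioc (0:ℝ) 1, (1 - t) • ((1/2:ℝ) • ∫ w, psi z w • D2 A w (x + t • z)) := by
  have h1 := Kz_split hA hb x z
  rw [Kz_conv hA hb x z, even_conv hA hb phi_integrable phi_neg, even_conv hA hb phi_integrable phi_neg,
    phi_int] at h1
  have h2 : ∀ t : ℝ, ∫ w, psi z w • A (x + t • z + w) = (1/2:ℝ) • ∫ w, psi z w • D2 A w (x + t • z) := fun t => by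
    rw [even_conv hA hb (psi_integrable z) (psi_neg z), psi_int, zero_smul, add_zero]
  simp only [h2] at h1
  rw [h1]
  module

lemma sl_bound : ∃ C : ℝ, 0 ≤ C ∧ ∀ (A : E → F) (B ε : ℝ), (∀ x, ‖A x‖ ≤ B) → 0 ≤ ε →
    (∀ x y, ‖A x - A y‖ ≤ ε * ‖x - y‖) → ∀ x, ‖sl A x‖ ≤ C * ε := by
  obtain ⟨C, hC, h2⟩ := phi_poly (E := E) 2
  have hJ := gsint_pos (E := E) (σ := 2) (by norm_num)
  refine ⟨2 * (C * ∫ y : E, gs 2 y), by positivity, fun A B ε hb hε hlip x => ?_⟩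
  have hA := lip_cont hlip
  refine ContinuousLinearMap.opNorm_le_bound _ (by positivity) fun z => ?_
  have e : sl A x z = ∫ y, (2 * inner ℝ y z * phi y) • (A (x + y) - A x) := by
    rw [sl_apply hA hb]
    have h0 : ∫ y : E, (2 * inner ℝ y z * phi y) • A x = 0 := by
      rw [integral_smul_const, phiz_int, zero_smul]
    have hc : AEStronglyMeasurable (fun y => A (x + y)) volume :=
      (by fun_prop : Continuous fun y => A (x + y)).aestronglyMeasurable
    simp only [smul_sub]
    rw [integral_sub (bint (phiz_integrable z) hc fun y => hb _) ((phiz_integrable z).smul_const _), h0, sub_zero]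
  rw [e]
  have hg := ((gs_integrable (E := E) (T := 2) (by norm_num)).const_mul (2 * ‖z‖ * ε * C))
  refine (norm_integral_le_of_norm_le hg (Filter.Eventually.of_forall fun y => ?_)).trans (le_of_eq ?_)
  · have hp := phi_pos y
    have h3 := hlip (x + y) x
    rw [add_sub_cancel_left] at h3
    rw [norm_smul, norm_mul, norm_mul, Real.norm_of_nonneg hp.le, Real.norm_eq_abs, Real.norm_eq_abs, abs_two]
    calc 2 * |inner ℝ y z| * phi y * ‖A (x + y) - A x‖ ≤ 2 * (‖y‖ * ‖z‖) * phi y * (ε * ‖y‖) := by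
          gcongr
          exact abs_real_inner_le_norm y z
      _ = 2 * ‖z‖ * ε * (‖y‖ ^ 2 * phi y) := by ring
      _ ≤ 2 * ‖z‖ * ε * (C * gs 2 y) := mul_le_mul_of_nonneg_left (h2 y) (by positivity)
      _ = _ := by ring
  · rw [integral_const_mul]; ring
end


/-- averaged second difference -/
def uA (A : E → F) (x : E) : ℝ≥0∞ := ∫⁻ w, gE 2 w * ‖D2 A w x‖ₑ

/-- deviation -/
def dev (A : E → F) (x z : E) : F := A (x + z) - A x - sl A x z

section
variable {A : E → F} {B : ℝ}

lemma uA_meas (hA : Continuous A) : Measurable (uA A) := by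
  refine Measurable.lintegral_prod_right' (f := fun p : E × E => gE 2 p.2 * ‖D2 A p.2 p.1‖ₑ) ?_
  have h1 := (D2_cont hA).measurable.comp measurable_swap
  exact ((gE_meas 2).comp measurable_snd).mul h1.enorm

lemma uA_sq (hA : Continuous A) : ∫⁻ x, uA A x ^ 2 ≤ (∫⁻ w : E, gE 2 w) * UU A := by
  refine cs_int volume volume (gE_meas 2) (f := fun w x => ‖D2 A w x‖ₑ) ?_
  exact (D2_cont hA).measurable.enorm

lemma kD2_le {k : E → ℝ} {c : ℝ} (hc : 0 ≤ c) (hk : ∀ w, |k w| ≤ c * gs 2 w) (x : E) :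
    ‖∫ w, k w • D2 A w x‖ₑ ≤ ENNReal.ofReal c * uA A x := by
  refine (enorm_integral_le_lintegral_enorm _).trans ?_
  unfold uA
  rw [← lintegral_const_mul' _ _ ENNReal.ofReal_ne_top]
  refine lintegral_mono fun w => ?_
  simp only
  rw [enorm_smul, ← mul_assoc]
  gcongr
  rw [gE, ← ENNReal.ofReal_mul hc, ← ofReal_norm_eq_enorm, Real.norm_eq_abs]
  exact ENNReal.ofReal_le_ofReal (hk w)

lemma half_enorm_le (v : F) : ‖(1/2:ℝ) • v‖ₑ ≤ ‖v‖ₑ := by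
  rw [enorm_smul]
  calc _ ≤ 1 * ‖v‖ₑ := by
        gcongr
        rw [← ofReal_norm_eq_enorm, ← ENNReal.ofReal_one]
        apply ENNReal.ofReal_le_ofReal; norm_num
    _ = _ := one_mul _

lemma dev_enorm : ∃ C : ℝ≥0, ∀ (A : E → F) (B : ℝ), Continuous A → (∀ x, ‖A x‖ ≤ B) → ∀ x z,
    ‖dev A x z‖ₑ ≤ C * (uA A (x + z) + uA A x + ‖z‖ₑ ^ 2 * ∫⁻ t in Ioc (0:ℝ) 1, uA A (x + t • z)) := by
  obtain ⟨C0, hC0, h0⟩ := phi_poly (E := E) 0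
  obtain ⟨C2, hC2, h2⟩ := psi_bound (E := E)
  have h0' : ∀ w : E, |phi w| ≤ C0 * gs 2 w := fun w => by
    have := h0 w
    rwa [pow_zero, one_mul, ← abs_of_pos (phi_pos w)] at this
  refine ⟨(C0 + C2).toNNReal, fun A B hA hb x z => ?_⟩
  rw [dev, dev_repr hA hb]
  have e0 : ENNReal.ofReal C0 ≤ ((C0 + C2).toNNReal : ℝ≥0∞) := ENNReal.ofReal_le_ofReal (by linarith)
  have e2 : ENNReal.ofReal C2 ≤ ((C0 + C2).toNNReal : ℝ≥0∞) := ENNReal.ofReal_le_ofReal (by linarith)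
  refine (enorm_add_le _ _).trans ?_
  rw [mul_add]
  refine add_le_add ((enorm_add_le _ _).trans ?_) ?_
  · rw [mul_add, enorm_neg]
    refine add_le_add ((half_enorm_le _).trans ((kD2_le hC0 h0' _).trans ?_))
      ((half_enorm_le _).trans ((kD2_le hC0 h0' _).trans ?_)) <;> gcongr
  · refine (enorm_integral_le_lintegral_enorm _).trans ?_
    rw [← mul_assoc, ← lintegral_const_mul' _ _ (by finiteness)]
    refine setLIntegral_mono' measurableSet_Ioc fun t ht => ?_
    rw [enorm_smul]
    have ht1 : ‖1 - t‖ₑ ≤ 1 := by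
      rw [← ofReal_norm_eq_enorm, ← ENNReal.ofReal_one]
      apply ENNReal.ofReal_le_ofReal
      rw [Real.norm_eq_abs, abs_le]; constructor <;> linarith [ht.1, ht.2]
    calc _ ≤ 1 * (ENNReal.ofReal (C2 * ‖z‖ ^ 2) * uA A (x + t • z)) := by
          gcongr
          exact (half_enorm_le _).trans (kD2_le (by positivity) (h2 z) _)
      _ = (ENNReal.ofReal C2 * ‖z‖ₑ ^ 2) * uA A (x + t • z) := by
          rw [one_mul, ENNReal.ofReal_mul hC2, ENNReal.ofReal_pow (norm_nonneg _), ofReal_norm_eq_enorm]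
      _ ≤ _ := by gcongr

lemma dorr : ∃ C : ℝ≥0, ∀ (A : E → F) (B : ℝ), Continuous A → (∀ x, ‖A x‖ ≤ B) → ∀ z,
    ∫⁻ x, ‖dev A x z‖ₑ ^ 2 ≤ C * (1 + ‖z‖ₑ ^ 4) * UU A := by
  obtain ⟨C, h⟩ := dev_enorm (E := E) (F := F)
  have hG := lint_gE (E := E) (T := 2) (by norm_num)
  lift (∫⁻ w : E, gE 2 w) to ℝ≥0 using hG.ne with G hGd
  refine ⟨8 * C ^ 2 * G, fun A B hA hb z => ?_⟩
  have hu := uA_sq hA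
  rw [← hGd] at hu
  have hm := uA_meas hA
  have hmt : Measurable (fun x => ∫⁻ t in Ioc (0:ℝ) 1, uA A (x + t • z)) := by
    refine Measurable.lintegral_prod_right' (f := fun p : E × ℝ => uA A (p.1 + p.2 • z)) ?_
    exact hm.comp (by fun_prop)
  have h3 : ∫⁻ x, (∫⁻ t in Ioc (0:ℝ) 1, uA A (x + t • z)) ^ 2 ≤ ∫⁻ x, uA A x ^ 2 := by
    have := cs_int (volume.restrict (Ioc (0:ℝ) 1)) (volume : Measure E) (k := fun _ => 1)
      (f := fun t x => uA A (x + t • z)) measurable_const (hm.comp (by fun_prop))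
    simp only [one_mul] at this
    refine this.trans ?_
    have e : ∀ t : ℝ, ∫⁻ x, uA A (x + t • z) ^ 2 = ∫⁻ x, uA A x ^ 2 := fun t =>
      lintegral_add_right_eq_self (fun x => uA A x ^ 2) (t • z)
    simp [e]
  have h1 : ∫⁻ x, uA A (x + z) ^ 2 = ∫⁻ x, uA A x ^ 2 := lintegral_add_right_eq_self (fun x => uA A x ^ 2) z
  calc ∫⁻ x, ‖dev A x z‖ₑ ^ 2 ≤ ∫⁻ x, (C:ℝ≥0∞) ^ 2 * (4 * uA A (x + z) ^ 2 + (4 * uA A x ^ 2 +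
        2 * ‖z‖ₑ ^ 4 * (∫⁻ t in Ioc (0:ℝ) 1, uA A (x + t • z)) ^ 2)) := by
        refine lintegral_mono fun x => ?_
        simp only
        refine (pow_le_pow_left' (h A B hA hb x z) 2).trans ?_
        rw [mul_pow]
        gcongr
        refine (e_add_sq _ _).trans ?_
        refine (mul_le_mul_right (add_le_add_left (e_add_sq _ _) _) 2).trans (le_of_eq ?_)
        ring
    _ = (C:ℝ≥0∞) ^ 2 * (4 * (∫⁻ x, uA A (x + z) ^ 2) + (4 * (∫⁻ x, uA A x ^ 2) +
        2 * ‖z‖ₑ ^ 4 * (∫⁻ x, (∫⁻ t in Ioc (0:ℝ) 1, uA A (x + t • z)) ^ 2))) := by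
        have m1 : Measurable fun x => uA A (x + z) := hm.comp (by fun_prop)
        rw [lintegral_const_mul _ (by fun_prop), lintegral_add_left (by fun_prop),
          lintegral_add_left (by fun_prop), lintegral_const_mul _ (by fun_prop),
          lintegral_const_mul _ (by fun_prop), lintegral_const_mul _ (by fun_prop)]
    _ ≤ (C:ℝ≥0∞) ^ 2 * (4 * (G * UU A) + (4 * (G * UU A) + 2 * ‖z‖ₑ ^ 4 * (G * UU A))) := by
        rw [h1]
        gcongr
        exact h3.trans hu
    _ = (C:ℝ≥0∞) ^ 2 * (8 + 2 * ‖z‖ₑ ^ 4) * (G * UU A) := by ring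
    _ ≤ (C:ℝ≥0∞) ^ 2 * (8 + 8 * ‖z‖ₑ ^ 4) * (G * UU A) := by
        gcongr; norm_num
    _ = _ := by push_cast; ring

lemma dev_meas (hA : Continuous A) (hb : ∀ x, ‖A x‖ ≤ B) :
    Measurable (fun p : E × E => dev A p.1 p.2) := by
  have h : StronglyMeasurable (fun p : E × E => sl A p.1 p.2) := by
    simp only [sl_apply hA hb]
    have hp := phi_cont (E := E)
    have hc : Continuous fun q : (E × E) × E => (2 * inner ℝ q.2 q.1.2 * phi q.2) • A (q.1.1 + q.2) := by
      fun_prop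
    exact hc.stronglyMeasurable.integral_prod_right'
  unfold dev
  exact (by fun_prop : Continuous fun p : E × E => A (p.1 + p.2) - A p.1).measurable.sub h.measurable
end


/-- square of L2 norm of the Gaussian difference -/
def NN (A : E → F) (ν : Measure E) (τ : ℝ) : ℝ≥0∞ := ∫⁻ x, ‖FD A ν τ x‖ₑ ^ 2

lemma ofReal_gs_int (T : ℝ) (f : E → F) :
    ENNReal.ofReal (∫ y, gs T y * ‖f y‖) ≤ ∫⁻ y, gE T y * ‖f y‖ₑ := by
  have h0 : 0 ≤ ∫ y, gs T y * ‖f y‖ :=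
    integral_nonneg fun y => mul_nonneg (gs_pos T y).le (norm_nonneg _)
  rw [← Real.enorm_of_nonneg h0]
  refine (enorm_integral_le_lintegral_enorm _).trans_eq ?_
  refine lintegral_congr fun y => ?_
  rw [enorm_mul, enorm_norm, Real.enorm_of_nonneg (gs_pos T y).le, gE]

lemma e_sum_sq {ι : Type*} (s : Finset ι) (f : ι → ℝ≥0∞) :
    (∑ i ∈ s, f i) ^ 2 ≤ (s.card : ℝ≥0∞) * ∑ i ∈ s, f i ^ 2 := by
  have := ENNReal.rpow_sum_le_const_mul_sum_rpow s f (p := 2) (by norm_num)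
  simpa [show (2:ℝ) - 1 = 1 by norm_num] using this

lemma e_add3_sq (a b c : ℝ≥0∞) : (a + b + c) ^ 2 ≤ 4 * (a ^ 2 + b ^ 2 + c ^ 2) := by
  calc _ ≤ 2 * ((a + b) ^ 2 + c ^ 2) := e_add_sq _ _
    _ ≤ 2 * (2 * (a ^ 2 + b ^ 2) + 2 * c ^ 2) := by
        gcongr
        · exact e_add_sq _ _
        · exact le_mul_of_one_le_left (zero_le) (by norm_num)
    _ = _ := by ring

lemma e_add4_sq (a b c d : ℝ≥0∞) : (a + b + c + d) ^ 2 ≤ 4 * (a ^ 2 + b ^ 2 + c ^ 2 + d ^ 2) := by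
  calc _ = ((a + b) + (c + d)) ^ 2 := by ring
    _ ≤ 2 * ((a + b) ^ 2 + (c + d) ^ 2) := e_add_sq _ _
    _ ≤ 2 * (2 * (a ^ 2 + b ^ 2) + 2 * (c ^ 2 + d ^ 2)) := by
        gcongr <;> exact e_add_sq _ _
    _ = _ := by ring

lemma W_fin {T : ℝ} (hT : 0 < T) : ∫⁻ y : E, gE T y * (1 + ‖y‖ₑ ^ 4) < ∞ := by
  obtain ⟨C, hC, h⟩ := poly_gs (E := E) 4 0 T hT
  have : ∀ y : E, gE T y * (1 + ‖y‖ₑ ^ 4) ≤ gE T y + ENNReal.ofReal C * gE (2 * T) y := by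
    intro y
    rw [mul_add, mul_one]
    refine add_le_add le_rfl ?_
    unfold gE
    rw [← ENNReal.ofReal_mul hC, ← ofReal_norm_eq_enorm, ← ENNReal.ofReal_pow (norm_nonneg _),
      ← ENNReal.ofReal_mul (gs_pos _ _).le]
    apply ENNReal.ofReal_le_ofReal
    have := h y
    simp only [zero_mul, Real.exp_zero, mul_one] at this
    linarith
  refine (lintegral_mono this).trans_lt ?_
  rw [lintegral_add_left (gE_meas T), lintegral_const_mul _ (gE_meas _)]
  exact ENNReal.add_lt_top.2 ⟨lint_gE hT, ENNReal.mul_lt_top ENNReal.ofReal_lt_top (lint_gE (by positivity))⟩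

lemma NN_conv {A : E → F} (hA : Continuous A) (ν : Measure E) [SFinite ν] (T τ : ℝ) :
    ∫⁻ x, (∫⁻ y, gE T y * ‖FD A ν τ (x + y)‖ₑ) ^ 2 ≤ (∫⁻ y : E, gE T y) ^ 2 * NN A ν τ := by
  have hm := (FD_meas (ν := ν) hA τ).measurable.enorm
  refine (cs_int volume volume (gE_meas T) (f := fun y x => ‖FD A ν τ (x + y)‖ₑ) ?_).trans ?_
  · exact hm.comp (measurable_snd.add measurable_fst)
  · have : ∀ y : E, ∫⁻ x, ‖FD A ν τ (x + y)‖ₑ ^ 2 = NN A ν τ := fun y =>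
      lintegral_add_right_eq_self (fun x => ‖FD A ν τ x‖ₑ ^ 2) y
    simp only [this]
    rw [lintegral_mul_const _ (gE_meas T), pow_two, mul_assoc]

theorem star (E F : Type*) [NormedAddCommGroup E] [InnerProductSpace ℝ E] [FiniteDimensional ℝ E]
    [MeasurableSpace E] [BorelSpace E]
    [NormedAddCommGroup F] [InnerProductSpace ℝ F] [FiniteDimensional ℝ F]
    [MeasurableSpace F] [BorelSpace F] (K : ℝ≥0) (hK : 1 ≤ K) :
    ∃ (L : ℕ) (C : ℝ≥0∞) (δ c0 : ℝ), C ≠ ∞ ∧ 0 < δ ∧ δ ≤ 1 ∧ 0 < c0 ∧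
    ∀ (ν : Measure E) [SFinite ν] (A : E → F) (B ε : ℝ), ν ≤ K • volume → volume ≤ K • ν →
    (∀ x, ‖A x‖ ≤ B) → 0 ≤ ε → c0 * ε ≤ 1 → (∀ x y, ‖A x - A y‖ ≤ ε * ‖x - y‖) →
    ∀ h : E, ‖h‖ ≤ δ → DD A h ≤ C * (ENNReal.ofReal ((‖h‖ ^ 2 + (c0 * ε) ^ 2) ^ 2) * UU A
      + (NN A ν 1 + NN A ν 2 + ∑ j ∈ Finset.range L, NN A ν (4 ^ (j + 1)))) := by
  obtain ⟨L, T, C, δ, hT, hC, hδ, hδ1, H⟩ := P_x (E := E) (F := F) K hK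
  obtain ⟨Cs, hCs, Hs⟩ := sl_bound (E := E) (F := F)
  obtain ⟨Cd, Hd⟩ := dorr (E := E) (F := F)
  set I1 : ℝ≥0∞ := ∫⁻ y : E, gE (4 * T) y with hI1
  set I2 : ℝ≥0∞ := ∫⁻ y : E, gE T y with hI2
  set W : ℝ≥0∞ := ∫⁻ y : E, gE (4 * T) y * (1 + ‖y‖ₑ ^ 4) with hW
  have fI1 : I1 ≠ ∞ := (lint_gE (by positivity)).ne
  have fI2 : I2 ≠ ∞ := (lint_gE (by positivity)).ne
  have fW : W ≠ ∞ := (W_fin (by positivity)).ne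
  set R : ℝ≥0∞ := I1 * (Cd * W) + 8 * Cd + 2 * I2 ^ 2 + 12 * L with hR
  have fR : R ≠ ∞ := by finiteness
  refine ⟨L, ENNReal.ofReal C ^ 2 * (4 * R), δ, max 1 Cs, by finiteness, hδ, hδ1, by positivity, ?_⟩
  intro ν _ A B ε h1 h2 hb hε hcε hl h hh
  have hA : Continuous A := lip_cont hl
  set ε' : ℝ := max 1 Cs * ε with hε'
  have hε0 : 0 ≤ ε' := by positivity
  have hεε : ε ≤ ε' := by
    have := mul_le_mul_of_nonneg_right (le_max_left 1 Cs) hε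
    linarith
  have hl' : ∀ x y, ‖A x - A y‖ ≤ ε' * ‖x - y‖ := fun x y => (hl x y).trans (by gcongr)
  have hs : ∀ x, ‖sl A x‖ ≤ ε' := fun x => (Hs A B ε hb hε hl x).trans
    (mul_le_mul_of_nonneg_right (le_max_right _ _) hε)
  set a : ℝ≥0∞ := ENNReal.ofReal (‖h‖ ^ 2 + ε' ^ 2) with ha
  set X : E → ℝ≥0∞ := fun x => ∫⁻ y, gE (4 * T) y * ‖dev A x y‖ₑ with hX
  set YZ : E → ℝ≥0∞ := fun x => ‖dev A x h‖ₑ + ‖dev A x (-h)‖ₑ with hYZ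
  set P : ℝ → E → ℝ≥0∞ := fun τ x => ∫⁻ y, gE T y * ‖FD A ν τ (x + y)‖ₑ with hP
  set f : ℕ → E → ℝ≥0∞ := fun j x => ‖FD A ν (4 ^ (j + 1)) x‖ₑ with hf
  have mf : ∀ j, Measurable (f j) := fun j => (FD_meas (ν := ν) hA _).measurable.enorm
  have mdev : Measurable (fun p : E × E => ‖dev A p.1 p.2‖ₑ) := (dev_meas hA hb).enorm
  have mX : Measurable X :=
    Measurable.lintegral_prod_right' (f := fun p : E × E => gE (4 * T) p.2 * ‖dev A p.1 p.2‖ₑ)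
      (((gE_meas _).comp measurable_snd).mul mdev)
  have mYZ : Measurable YZ := (mdev.comp (measurable_id.prodMk measurable_const)).add
    (mdev.comp (measurable_id.prodMk measurable_const))
  have mP : ∀ τ, Measurable (P τ) := fun τ =>
    Measurable.lintegral_prod_right' (f := fun p : E × E => gE T p.2 * ‖FD A ν τ (p.1 + p.2)‖ₑ)
      (((gE_meas _).comp measurable_snd).mul
        ((FD_meas (ν := ν) hA τ).measurable.enorm.comp (measurable_fst.add measurable_snd)))
  have key : ∀ x, ‖D2 A h x‖ₑ ≤ ENNReal.ofReal C * (a * X x + a * YZ x + (P 1 x + P 2 x)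
      + ∑ j ∈ Finset.range L, (f j x + f j (x + h) + f j (x - h))) := by
    intro x
    have := H ν ε' A h1 h2 hε0 hcε hl' x (sl A x) (hs x) h hh
    rw [← ofReal_norm_eq_enorm]
    unfold D2
    refine (ENNReal.ofReal_le_ofReal this).trans ?_
    rw [ENNReal.ofReal_mul hC]
    gcongr
    refine ENNReal.ofReal_add_le.trans (add_le_add (ENNReal.ofReal_add_le.trans
      (add_le_add (ENNReal.ofReal_add_le.trans (add_le_add ?_ ?_)) ?_)) ?_)
    · rw [ENNReal.ofReal_mul (by positivity)]
      gcongr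
      exact ofReal_gs_int (4 * T) (fun y => dev A x y)
    · rw [ENNReal.ofReal_mul (by positivity)]
      refine mul_le_mul' (ENNReal.ofReal_le_ofReal (by nlinarith [sq_nonneg ‖h‖])) ?_
      refine ENNReal.ofReal_add_le.trans (add_le_add ?_ ?_)
      · exact (ofReal_norm_eq_enorm _).le
      · rw [ofReal_norm_eq_enorm, dev, ← sub_eq_add_neg]
    · refine ENNReal.ofReal_add_le.trans (add_le_add ?_ ?_)
      · exact ofReal_gs_int T (fun y => FD A ν 1 (x + y))
      · exact ofReal_gs_int T (fun y => FD A ν 2 (x + y))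
    · rw [ENNReal.ofReal_sum_of_nonneg (fun j _ => by positivity)]
      refine Finset.sum_le_sum fun j _ => ?_
      refine ENNReal.ofReal_add_le.trans (add_le_add (ENNReal.ofReal_add_le.trans (add_le_add ?_ ?_)) ?_) <;>
      exact (ofReal_norm_eq_enorm _).le
  have iX : ∫⁻ x, X x ^ 2 ≤ I1 * (Cd * W) * UU A := by
    refine (cs_int volume volume (gE_meas (4 * T)) (f := fun y x => ‖dev A x y‖ₑ)
      (mdev.comp measurable_swap)).trans ?_
    rw [mul_assoc]
    gcongr
    calc _ ≤ ∫⁻ y, (gE (4 * T) y * (1 + ‖y‖ₑ ^ 4)) * (Cd * UU A) := by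
          refine lintegral_mono fun y => ?_
          refine (mul_le_mul_right (Hd A B hA hb y) _).trans_eq ?_
          ring
      _ = _ := by
          rw [lintegral_mul_const _ (by have := gE_meas (E := E) (4 * T); fun_prop)]
          ring
  have idev : ∀ z : E, ‖z‖ ≤ 1 → ∫⁻ x, ‖dev A x z‖ₑ ^ 2 ≤ 2 * Cd * UU A := by
    intro z hz
    refine (Hd A B hA hb z).trans ?_
    rw [mul_comm (2 : ℝ≥0∞)]
    gcongr
    have : ‖z‖ₑ ≤ 1 := by
      rw [← ofReal_norm_eq_enorm]; exact ENNReal.ofReal_le_one.2 hz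
    calc _ ≤ (1 : ℝ≥0∞) + 1 ^ 4 := by gcongr
      _ = _ := by norm_num
  have iYZ : ∫⁻ x, YZ x ^ 2 ≤ 8 * Cd * UU A := by
    calc _ ≤ ∫⁻ x, 2 * (‖dev A x h‖ₑ ^ 2 + ‖dev A x (-h)‖ₑ ^ 2) :=
          lintegral_mono fun x => e_add_sq _ _
      _ = 2 * ((∫⁻ x, ‖dev A x h‖ₑ ^ 2) + ∫⁻ x, ‖dev A x (-h)‖ₑ ^ 2) := by
          have m1 : ∀ z, Measurable fun x => ‖dev A x z‖ₑ ^ 2 := fun z =>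
            (mdev.comp (measurable_id.prodMk measurable_const)).pow_const 2
          have m2 := m1 h
          have m3 := m1 (-h)
          rw [lintegral_const_mul _ (by fun_prop), lintegral_add_left (m1 h)]
      _ ≤ 2 * (2 * Cd * UU A + 2 * Cd * UU A) := by
          gcongr
          · exact idev h (hh.trans hδ1)
          · exact idev (-h) (by rw [norm_neg]; exact hh.trans hδ1)
      _ = _ := by ring
  have iP : ∫⁻ x, (P 1 x + P 2 x) ^ 2 ≤ 2 * I2 ^ 2 * (NN A ν 1 + NN A ν 2) := by
    calc _ ≤ ∫⁻ x, 2 * (P 1 x ^ 2 + P 2 x ^ 2) := lintegral_mono fun x => e_add_sq _ _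
      _ = 2 * ((∫⁻ x, P 1 x ^ 2) + ∫⁻ x, P 2 x ^ 2) := by
          have m2 := mP 1
          have m3 := mP 2
          rw [lintegral_const_mul _ (by fun_prop),
            lintegral_add_left ((mP 1).pow_const 2)]
      _ ≤ 2 * (I2 ^ 2 * NN A ν 1 + I2 ^ 2 * NN A ν 2) := by
          gcongr
          · exact NN_conv hA ν T 1
          · exact NN_conv hA ν T 2
      _ = _ := by ring
  have mf3 : ∀ j, Measurable fun x => f j x ^ 2 + f j (x + h) ^ 2 + f j (x - h) ^ 2 := fun j => by
    have := mf j
    fun_prop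
  have iS : ∫⁻ x, (∑ j ∈ Finset.range L, (f j x + f j (x + h) + f j (x - h))) ^ 2
      ≤ 12 * L * ∑ j ∈ Finset.range L, NN A ν (4 ^ (j + 1)) := by
    calc _ ≤ ∫⁻ x, (L : ℝ≥0∞) * ∑ j ∈ Finset.range L,
            4 * (f j x ^ 2 + f j (x + h) ^ 2 + f j (x - h) ^ 2) := by
          refine lintegral_mono fun x => ?_
          refine (e_sum_sq _ _).trans ?_
          simp only [Finset.card_range]
          gcongr
          exact e_add3_sq _ _ _
      _ = (L : ℝ≥0∞) * ∑ j ∈ Finset.range L, 4 * (NN A ν (4 ^ (j + 1)) + NN A ν (4 ^ (j + 1))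
            + NN A ν (4 ^ (j + 1))) := by
          rw [lintegral_const_mul _ (Finset.measurable_fun_sum _ fun j _ => (mf3 j).const_mul 4),
            lintegral_finsetSum _ fun j _ => (mf3 j).const_mul 4]
          congr 1
          refine Finset.sum_congr rfl fun j _ => ?_
          have m1 := (mf j).pow_const 2
          have m2 : Measurable fun x => f j (x + h) ^ 2 := m1.comp (measurable_id.add_const h)
          rw [lintegral_const_mul _ (mf3 j), lintegral_add_left (by fun_prop), lintegral_add_left m1,
            lintegral_add_right_eq_self (fun x => f j x ^ 2) h,
            lintegral_sub_right_eq_self (fun x => f j x ^ 2) h]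
          rfl
      _ = _ := by
          rw [Finset.mul_sum, Finset.mul_sum]
          refine Finset.sum_congr rfl fun j _ => ?_
          ring
  have hUa : ENNReal.ofReal ((‖h‖ ^ 2 + ε' ^ 2) ^ 2) = a ^ 2 := by
    rw [ha, ENNReal.ofReal_pow (by positivity)]
  rw [hUa]
  set S := ∑ j ∈ Finset.range L, NN A ν (4 ^ (j + 1)) with hS
  calc DD A h ≤ ∫⁻ x, (ENNReal.ofReal C) ^ 2 * (4 * (a ^ 2 * X x ^ 2 + a ^ 2 * YZ x ^ 2 + (P 1 x + P 2 x) ^ 2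
      + (∑ j ∈ Finset.range L, (f j x + f j (x + h) + f j (x - h))) ^ 2)) := by
        refine lintegral_mono fun x => ?_
        refine (pow_le_pow_left₀ (zero_le) (key x) 2).trans ?_
        rw [mul_pow]
        gcongr
        refine (e_add4_sq _ _ _ _).trans_eq ?_
        rw [mul_pow, mul_pow]
    _ = (ENNReal.ofReal C) ^ 2 * (4 * (a ^ 2 * ∫⁻ x, X x ^ 2) + 4 * (a ^ 2 * ∫⁻ x, YZ x ^ 2)
        + 4 * (∫⁻ x, (P 1 x + P 2 x) ^ 2)
        + 4 * (∫⁻ x, (∑ j ∈ Finset.range L, (f j x + f j (x + h) + f j (x - h))) ^ 2)) := by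
        have n1 : Measurable fun x => a ^ 2 * X x ^ 2 := (mX.pow_const 2).const_mul _
        have n2 : Measurable fun x => a ^ 2 * YZ x ^ 2 := (mYZ.pow_const 2).const_mul _
        have n3 : Measurable fun x => (P 1 x + P 2 x) ^ 2 := ((mP 1).add (mP 2)).pow_const 2
        have n4 : Measurable fun x => (∑ j ∈ Finset.range L, (f j x + f j (x + h) + f j (x - h))) ^ 2 := by
          have := mf
          fun_prop
        rw [lintegral_const_mul _ (by fun_prop), lintegral_const_mul _ (by fun_prop),
          lintegral_add_left (by fun_prop), lintegral_add_left (by fun_prop),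
          lintegral_add_left (by fun_prop), lintegral_const_mul _ (by fun_prop),
          lintegral_const_mul _ (by fun_prop)]
        ring
    _ ≤ (ENNReal.ofReal C) ^ 2 * (4 * (a ^ 2 * (I1 * (Cd * W) * UU A)) + 4 * (a ^ 2 * (8 * Cd * UU A))
        + 4 * (2 * I2 ^ 2 * (NN A ν 1 + NN A ν 2)) + 4 * (12 * L * S)) := by gcongr
    _ ≤ _ := by
        rw [mul_assoc (ENNReal.ofReal C ^ 2)]
        refine mul_le_mul_right ?_ _
        have q1 : I1 * (Cd * W) + 8 * Cd ≤ R := by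
          rw [hR, add_assoc]; exact le_self_add
        have q2 : 2 * I2 ^ 2 ≤ R := by
          rw [hR]; exact le_add_right le_add_self
        have q3 : 12 * (L : ℝ≥0∞) ≤ R := le_add_self
        calc _ = 4 * ((I1 * (Cd * W) + 8 * Cd) * (a ^ 2 * UU A) + (2 * I2 ^ 2) * (NN A ν 1 + NN A ν 2) + 12 * L * S) := by ring
          _ ≤ 4 * (R * (a ^ 2 * UU A) + R * (NN A ν 1 + NN A ν 2) + R * S) := by gcongr
          _ = _ := by ring


/-- distance on the graph -/
def rho (A : E → F) (x y : E) : ℝ := Real.sqrt (‖x - y‖ ^ 2 + ‖A x - A y‖ ^ 2)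

/-- truncated kernel -/
def kt (m : ℕ) (t r : ℝ) : ℝ := if t < r ∧ r ≤ 2 * t then (r ^ (m + 1))⁻¹ else 0

/-- transversal truncated transform in graph coordinates -/
def TT (A : E → F) (ν : Measure E) (t : ℝ) (x : E) : F :=
  ∫ y, kt (Module.finrank ℝ E) t (rho A x y) • (A x - A y) ∂ν

/-- the multiplier -/
def mm (m : ℕ) (τ t : ℝ) : ℝ := t ^ (m + 1) * Real.exp (-(t ^ 2) / τ)

def mm' (m : ℕ) (τ t : ℝ) : ℝ :=
  ((m + 1) * t ^ m - 2 * t ^ (m + 2) / τ) * Real.exp (-(t ^ 2) / τ)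

lemma mm_deriv (m : ℕ) (τ t : ℝ) : HasDerivAt (mm m τ) (mm' m τ t) t := by
  have h1 : HasDerivAt (fun t : ℝ => t ^ (m + 1)) ((m + 1 : ℝ) * t ^ m) t := by
    simpa using hasDerivAt_pow (m + 1) t
  have h2 : HasDerivAt (fun t : ℝ => -(t ^ 2) / τ) (-(2 * t) / τ) t := by
    simpa using ((hasDerivAt_pow 2 t).neg).div_const τ
  refine (h1.mul h2.exp).congr_deriv ?_
  unfold mm'
  ring

lemma mm'_cont (m : ℕ) (τ : ℝ) : Continuous (mm' m τ) := by unfold mm'; fun_prop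

lemma mm'_bound (m : ℕ) {τ : ℝ} (hτ : 0 < τ) {t : ℝ} (ht : 0 ≤ t) :
    |mm' m τ t| ≤ (m + 5) * t ^ m * Real.exp (-(t ^ 2) / (2 * τ)) := by
  have e1 : Real.exp (-(t ^ 2) / τ) = Real.exp (-(t ^ 2) / (2 * τ)) * Real.exp (-(t ^ 2) / (2 * τ)) := by
    rw [← Real.exp_add]; congr 1; field_simp; ring
  set u := t ^ 2 / (2 * τ) with hu
  have hu0 : 0 ≤ u := by positivity
  have e2 : -(t ^ 2) / (2 * τ) = -u := by rw [hu]; ring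
  have e3 : u * Real.exp (-u) ≤ 1 := by
    rw [Real.exp_neg, mul_inv_le_iff₀ (Real.exp_pos _)]
    linarith [Real.add_one_le_exp u]
  have e4 : Real.exp (-u) ≤ 1 := Real.exp_le_one_iff.2 (by linarith)
  unfold mm'
  rw [e1, e2, abs_mul, abs_of_pos (by positivity : 0 < Real.exp (-u) * Real.exp (-u))]
  have h2 : 2 * t ^ (m + 2) / τ = 4 * u * t ^ m := by rw [hu]; field_simp; ring
  rw [h2]
  have h3 : |((m:ℝ) + 1) * t ^ m - 4 * u * t ^ m| ≤ (m + 1) * t ^ m + 4 * u * t ^ m := by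
    refine (abs_sub _ _).trans_eq ?_
    rw [abs_of_nonneg (by positivity), abs_of_nonneg (by positivity)]
  calc _ ≤ ((m + 1) * t ^ m + 4 * u * t ^ m) * (Real.exp (-u) * Real.exp (-u)) := by gcongr
    _ = t ^ m * Real.exp (-u) * ((m + 1) * Real.exp (-u) + 4 * (u * Real.exp (-u))) := by ring
    _ ≤ t ^ m * Real.exp (-u) * ((m + 1) * 1 + 4 * 1) := by gcongr
    _ = _ := by ring

lemma exp_Ioi {c : ℝ} (hc : 0 < c) : Integrable fun t : ℝ => Real.exp (-(t ^ 2) / c) := by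
  have := integrable_exp_neg_mul_sq (b := 1 / c) (by positivity)
  refine this.congr (Filter.Eventually.of_forall fun t => ?_)
  simp only
  congr 1
  ring

lemma mm'_fin (m : ℕ) {τ : ℝ} (hτ : 0 < τ) : ∫⁻ t in Ioi (0:ℝ), ‖mm' m τ t‖ₑ < ∞ := by
  obtain ⟨C, hC, h⟩ := poly_exp_bound m 0 (2 * τ) (by positivity)
  have hi : Integrable (fun t : ℝ => ((m:ℝ) + 5) * C * Real.exp (-(t ^ 2) / (2 * (2 * τ))))
    (volume.restrict (Ioi 0)) := ((exp_Ioi (c := 2 * (2 * τ)) (by positivity)).const_mul _).integrableOn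
  have : Integrable (mm' m τ) (volume.restrict (Ioi 0)) := by
    refine hi.mono' (mm'_cont m τ).aestronglyMeasurable ?_
    filter_upwards [ae_restrict_mem measurableSet_Ioi] with t ht
    have h1 := mm'_bound m hτ (le_of_lt ht)
    have h2 := h t (le_of_lt ht)
    simp only [zero_mul, Real.exp_zero, mul_one] at h2
    rw [Real.norm_eq_abs]
    refine h1.trans ?_
    rw [mul_assoc, mul_assoc]
    gcongr
  exact this.2

section
variable {A : E → F} {ν : Measure E} {K : ℝ≥0} {B ε : ℝ}

lemma rho_nonneg (x y : E) : 0 ≤ rho A x y := Real.sqrt_nonneg _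
lemma rho_sq (x y : E) : rho A x y ^ 2 = ‖x - y‖ ^ 2 + ‖A x - A y‖ ^ 2 := Real.sq_sqrt (by positivity)
lemma le_rho (x y : E) : ‖x - y‖ ≤ rho A x y :=
  Real.le_sqrt_of_sq_le (by nlinarith [sq_nonneg ‖A x - A y‖])
lemma le_rho' (x y : E) : ‖A x - A y‖ ≤ rho A x y :=
  Real.le_sqrt_of_sq_le (by nlinarith [sq_nonneg ‖x - y‖])
lemma rho_cont (hA : Continuous A) : Continuous fun p : E × E => rho A p.1 p.2 := by
  unfold rho; fun_prop

lemma kt_meas (m : ℕ) : Measurable fun p : ℝ × ℝ => kt m p.1 p.2 := by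
  unfold kt
  refine Measurable.ite ?_ (by fun_prop) measurable_const
  exact (measurableSet_lt measurable_fst measurable_snd).inter
    (measurableSet_le measurable_snd (by fun_prop))

lemma TT_meas [SFinite ν] (hA : Continuous A) :
    StronglyMeasurable fun p : ℝ × E => TT A ν p.1 p.2 := by
  unfold TT
  have h1 : Measurable fun q : (ℝ × E) × E =>
      kt (Module.finrank ℝ E) q.1.1 (rho A q.1.2 q.2) := by
    refine (kt_meas _).comp (measurable_fst.fst.prodMk ?_)
    exact (rho_cont hA).measurable.comp (measurable_fst.snd.prodMk measurable_snd)
  have h2 : Measurable fun q : (ℝ × E) × E => A q.1.2 - A q.2 := by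
    have := hA.measurable
    fun_prop
  exact (h1.smul h2).stronglyMeasurable.integral_prod_right'

lemma kt_bound (m : ℕ) {τ t r v : ℝ} (hτ : 0 < τ) (ht : 0 < t) (hv : v ≤ r) (hv0 : 0 ≤ v) :
    |mm' m τ t| * (kt m t r * v) ≤
      (m + 5) * Real.exp (-(t ^ 2) / (4 * τ)) * Real.exp (-(r ^ 2) / (16 * τ)) := by
  unfold kt
  split_ifs with h
  · have hr : 0 < r := ht.trans h.1
    have e1 : Real.exp (-(t ^ 2) / (2 * τ)) ≤ Real.exp (-(t ^ 2) / (4 * τ)) * Real.exp (-(r ^ 2) / (16 * τ)) := by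
      rw [← Real.exp_add]
      apply Real.exp_le_exp.2
      have : -(t ^ 2) / (4 * τ) + -(r ^ 2) / (16 * τ) - -(t ^ 2) / (2 * τ) = (4 * t ^ 2 - r ^ 2) / (16 * τ) := by
        field_simp; ring
      have h2 : 0 ≤ (4 * t ^ 2 - r ^ 2) / (16 * τ) := by
        apply div_nonneg _ (by positivity)
        nlinarith [h.2]
      linarith
    calc _ ≤ ((m + 5) * r ^ m * (Real.exp (-(t ^ 2) / (4 * τ)) * Real.exp (-(r ^ 2) / (16 * τ)))) *
          ((r ^ (m + 1))⁻¹ * r) := by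
          gcongr
          refine (mm'_bound m hτ ht.le).trans ?_
          gcongr
          exact h.1.le
      _ = _ := by field_simp; ring
  · simp; positivity

lemma kt_int (m : ℕ) {τ r : ℝ} (hr : 0 < r) :
    ∫ t in Ioi (0:ℝ), mm' m τ t * kt m t r =
      Real.exp (-(r ^ 2) / τ) - ((2:ℝ) ^ (m + 1))⁻¹ * Real.exp (-(r ^ 2) / (4 * τ)) := by
  have h1 : ∀ t : ℝ, mm' m τ t * kt m t r = (Ico (r / 2) r).indicator (fun t => mm' m τ t * (r ^ (m + 1))⁻¹) t := by
    intro t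
    unfold kt indicator
    have : (t < r ∧ r ≤ 2 * t) ↔ t ∈ Ico (r / 2) r := by
      constructor
      · rintro ⟨a, b⟩; exact ⟨by linarith, a⟩
      · rintro ⟨a, b⟩; exact ⟨b, by linarith⟩
    simp only [this]
    split_ifs <;> simp
  simp only [h1]
  rw [setIntegral_indicator measurableSet_Ico, inter_eq_right.2 (fun t ht => by
      have := ht.1; exact lt_of_lt_of_le (by positivity) this),
    integral_Ico_eq_integral_Ioc, ← intervalIntegral.integral_of_le (by linarith),
    intervalIntegral.integral_mul_const,
    intervalIntegral.integral_eq_sub_of_hasDerivAt (fun t _ => mm_deriv m τ t)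
      ((mm'_cont m τ).intervalIntegrable _ _)]
  unfold mm
  have : -((r / 2) ^ 2) / τ = -(r ^ 2) / (4 * τ) := by rw [div_pow]; ring
  rw [this, div_pow]
  field_simp

lemma FGi [SFinite ν] (hν : ν ≤ K • volume) (hA : Continuous A) {τ : ℝ} (hτ : 0 < τ) (x : E) :
    Integrable (fun y => Real.exp (-(‖x - y‖ ^ 2 + ‖A x - A y‖ ^ 2) / τ) • (A x - A y)) ν := by
  obtain ⟨C, hC, h⟩ := poly_exp_bound 1 0 τ hτ
  have hi : Integrable (fun y => C * gs (2 * τ) (x - y)) ν :=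
    integ_dom hν ((gs_sub_int (by linarith) x).const_mul C)
  refine hi.mono' ?_ (Filter.Eventually.of_forall fun y => ?_)
  · apply Continuous.aestronglyMeasurable; fun_prop
  · rw [norm_smul, Real.norm_of_nonneg (Real.exp_pos _).le, ← rho_sq]
    have h1 := h (rho A x y) (rho_nonneg x y)
    simp only [zero_mul, Real.exp_zero, mul_one, pow_one] at h1
    calc _ ≤ Real.exp (-rho A x y ^ 2 / τ) * rho A x y := by gcongr; exact le_rho' x y
      _ = rho A x y * Real.exp (-rho A x y ^ 2 / τ) := mul_comm _ _
      _ ≤ _ := h1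
      _ ≤ _ := by
        unfold gs
        have := le_rho (A := A) x y
        gcongr

lemma FD_eq [SFinite ν] (hν : ν ≤ K • volume) (hA : Continuous A) {τ : ℝ} (hτ : 0 < τ) (x : E) :
    FD A ν τ x = ∫ t in Ioi (0:ℝ), mm' (Module.finrank ℝ E) τ t • TT A ν t x := by
  set m := Module.finrank ℝ E with hm
  have hrc : Continuous fun y => rho A x y := (rho_cont hA).comp (by fun_prop : Continuous fun y : E => (x, y))
  have hdom : Integrable (fun p : ℝ × E => (m + 5) * Real.exp (-(p.1 ^ 2) / (4 * τ)) * gs (16 * τ) (x - p.2))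
      ((volume.restrict (Ioi 0)).prod ν) := by
    refine Integrable.mul_prod (f := fun t : ℝ => (m + 5) * Real.exp (-(t ^ 2) / (4 * τ)))
      (g := fun y => gs (16 * τ) (x - y)) ?_ ?_
    · exact ((exp_Ioi (c := 4 * τ) (by positivity)).const_mul _).integrableOn
    · exact integ_dom hν (gs_sub_int (by positivity) x)
  have hIntg : Integrable (fun p : ℝ × E => mm' m τ p.1 • (kt m p.1 (rho A x p.2) • (A x - A p.2)))
      ((volume.restrict (Ioi 0)).prod ν) := by
    refine hdom.mono' ?_ ?_
    · have h1 : Measurable fun p : ℝ × E => kt m p.1 (rho A x p.2) :=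
        (kt_meas m).comp (measurable_fst.prodMk (hrc.measurable.comp measurable_snd))
      have h2 := (mm'_cont m τ).measurable
      have h3 := hA.measurable
      exact (Measurable.smul (by fun_prop) (h1.smul (by fun_prop))).aestronglyMeasurable
    · have : ∀ᵐ p : ℝ × E ∂((volume.restrict (Ioi 0)).prod ν), p.1 ∈ Ioi (0:ℝ) :=
        Measure.quasiMeasurePreserving_fst.ae (ae_restrict_mem measurableSet_Ioi)
      filter_upwards [this] with p hp
      have h0 : 0 ≤ kt m p.1 (rho A x p.2) := by
        have := rho_nonneg (A := A) x p.2
        unfold kt; split_ifs <;> positivity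
      rw [norm_smul, norm_smul, Real.norm_eq_abs, Real.norm_of_nonneg h0]
      refine (kt_bound m hτ hp (le_rho' x p.2) (norm_nonneg _)).trans ?_
      unfold gs
      have := le_rho (A := A) x p.2
      gcongr
  calc FD A ν τ x = ∫ y, (Real.exp (-(rho A x y ^ 2) / τ) - ((2:ℝ) ^ (m + 1))⁻¹ * Real.exp (-(rho A x y ^ 2) / (4 * τ)))
          • (A x - A y) ∂ν := by
        unfold FD FG
        have i2 : Integrable (fun y => cD E • (Real.exp (-(‖x - y‖ ^ 2 + ‖A x - A y‖ ^ 2) / (4 * τ)) •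
          (A x - A y))) ν := (FGi hν hA (by positivity : 0 < 4 * τ) x).smul (cD E)
        rw [← integral_smul, ← integral_sub (FGi hν hA hτ x) i2]
        refine integral_congr_ae (Filter.Eventually.of_forall fun y => ?_)
        simp only [rho_sq, sub_smul, mul_smul]
        rfl
    _ = ∫ y, (∫ t in Ioi (0:ℝ), mm' m τ t • (kt m t (rho A x y) • (A x - A y))) ∂ν := by
        refine integral_congr_ae (Filter.Eventually.of_forall fun y => ?_)
        simp only
        rcases (rho_nonneg (A := A) x y).eq_or_lt with h | h
        · have : A x - A y = 0 := by
            have := le_rho' (A := A) x y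
            rw [← h] at this
            exact norm_le_zero_iff.1 this
          simp [this]
        · rw [← kt_int m h]
          simp only [smul_smul]
          rw [integral_smul_const]
    _ = ∫ t in Ioi (0:ℝ), ∫ y, mm' m τ t • (kt m t (rho A x y) • (A x - A y)) ∂ν :=
        (integral_integral_swap hIntg).symm
    _ = _ := by
        refine integral_congr_ae (Filter.Eventually.of_forall fun t => ?_)
        simp only [integral_smul]
        rfl

lemma FD_sq [SFinite ν] (hν : ν ≤ K • volume) (hA : Continuous A) {τ : ℝ} (hτ : 0 < τ) (x : E) :
    ‖FD A ν τ x‖ₑ ^ 2 ≤ (∫⁻ t in Ioi (0:ℝ), ‖mm' (Module.finrank ℝ E) τ t‖ₑ) *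
      ∫⁻ t in Ioi (0:ℝ), ‖mm' (Module.finrank ℝ E) τ t‖ₑ * ‖TT A ν t x‖ₑ ^ 2 := by
  rw [FD_eq hν hA hτ]
  refine le_trans ?_ (cs_pt (volume.restrict (Ioi 0)) (mm'_cont _ τ).measurable.enorm
    ((TT_meas hA).measurable.comp (measurable_id.prodMk measurable_const)).enorm)
  gcongr
  refine (enorm_integral_le_lintegral_enorm _).trans_eq ?_
  simp [enorm_smul]
end


section
variable {A : E → F} {ν : Measure E} {K : ℝ≥0} {B ε r : ℝ}

/-- rescaled function -/
def Ar (r : ℝ) (A : E → F) (x : E) : F := r⁻¹ • A (r • x)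

/-- rescaled measure -/
def nr (r : ℝ) (ν : Measure E) : Measure E :=
  ENNReal.ofReal (r ^ Module.finrank ℝ E)⁻¹ • ν.map (fun y => r⁻¹ • y)

lemma emb_smul (hr : 0 < r) : MeasurableEmbedding (fun y : E => r • y) :=
  (Homeomorph.smulOfNeZero r hr.ne').measurableEmbedding

lemma lint_scale (hr : 0 < r) (f : E → ℝ≥0∞) :
    ∫⁻ x, f (r • x) = ENNReal.ofReal (r ^ Module.finrank ℝ E)⁻¹ * ∫⁻ x, f x := by
  rw [← (emb_smul hr).lintegral_map, Measure.map_addHaar_smul _ hr.ne', lintegral_smul_measure,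
    abs_of_pos (by positivity), smul_eq_mul]

lemma nr_vol (hr : 0 < r) : nr r (volume : Measure E) = volume := by
  unfold nr
  rw [Measure.map_addHaar_smul _ (inv_ne_zero hr.ne'), smul_smul, abs_of_pos (by positivity),
    ← ENNReal.ofReal_mul (by positivity), inv_pow, inv_inv, inv_mul_cancel₀ (by positivity),
    ENNReal.ofReal_one, one_smul]

instance nr_sf [SFinite ν] : SFinite (nr r ν) := by unfold nr; infer_instance

lemma nr_mono (hr : 0 < r) {ν ν' : Measure E} (h : ν ≤ K • ν') : nr r ν ≤ K • nr r ν' := by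
  unfold nr
  rw [smul_comm]
  refine Measure.le_iff.2 fun s hs => ?_
  have h2 : ν.map (fun y => r⁻¹ • y) s ≤ (K • ν'.map (fun y => r⁻¹ • y)) s := by
    have hm : Measurable fun y : E => r⁻¹ • y := by fun_prop
    rw [Measure.smul_apply, Measure.map_apply hm hs, Measure.map_apply hm hs]
    exact h _
  rw [Measure.smul_apply, Measure.smul_apply]
  gcongr

lemma Ar_lip (hr : 0 < r) (hl : ∀ x y, ‖A x - A y‖ ≤ ε * ‖x - y‖) (x y : E) :
    ‖Ar r A x - Ar r A y‖ ≤ ε * ‖x - y‖ := by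
  unfold Ar
  rw [← smul_sub, norm_smul, norm_inv, Real.norm_of_nonneg hr.le, inv_mul_le_iff₀ hr]
  refine (hl _ _).trans_eq ?_
  rw [← smul_sub, norm_smul, Real.norm_of_nonneg hr.le]
  ring

lemma Ar_bdd (hr : 0 < r) (hb : ∀ x, ‖A x‖ ≤ B) (x : E) : ‖Ar r A x‖ ≤ r⁻¹ * B := by
  unfold Ar
  rw [norm_smul, norm_inv, Real.norm_of_nonneg hr.le]
  gcongr
  exact hb _

lemma rho_Ar (hr : 0 < r) (x y : E) : rho (Ar r A) x (r⁻¹ • y) = r⁻¹ * rho A (r • x) y := by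
  unfold rho Ar
  have h1 : x - r⁻¹ • y = r⁻¹ • (r • x - y) := by rw [smul_sub, inv_smul_smul₀ hr.ne']
  rw [h1, smul_inv_smul₀ hr.ne', ← smul_sub, norm_smul, norm_smul, norm_inv,
    Real.norm_of_nonneg hr.le, mul_pow, mul_pow, ← mul_add,
    Real.sqrt_mul (by positivity), Real.sqrt_sq (by positivity)]

lemma kt_scale (m : ℕ) (hr : 0 < r) (t s : ℝ) : kt m t (r⁻¹ * s) = r ^ (m + 1) * kt m (r * t) s := by
  unfold kt
  have : (t < r⁻¹ * s ∧ r⁻¹ * s ≤ 2 * t) ↔ (r * t < s ∧ s ≤ 2 * (r * t)) := by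
    rw [lt_inv_mul_iff₀ hr, inv_mul_le_iff₀ hr, show r * (2 * t) = 2 * (r * t) by ring]
  simp only [this]
  split_ifs
  · rw [mul_pow, mul_inv, inv_pow, inv_inv]
  · simp

lemma TT_scale (hr : 0 < r) (t : ℝ) (x : E) : TT (Ar r A) (nr r ν) t x = TT A ν (r * t) (r • x) := by
  unfold TT nr
  rw [integral_smul_measure, (emb_smul (inv_pos.2 hr)).integral_map,
    ENNReal.toReal_ofReal (by positivity), ← integral_smul]
  refine integral_congr_ae (Filter.Eventually.of_forall fun y => ?_)
  simp only [rho_Ar hr, kt_scale _ hr, Ar, smul_inv_smul₀ hr.ne']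
  rw [← smul_sub, smul_smul, smul_smul]
  congr 1
  field_simp
  ring

lemma DD_scale (hr : 0 < r) (y : E) : DD (Ar r A) y =
    ENNReal.ofReal (r ^ Module.finrank ℝ E)⁻¹ * (ENNReal.ofReal (r ^ 2)⁻¹ * DD A (r • y)) := by
  unfold DD
  have : ∀ x, ‖D2 (Ar r A) y x‖ₑ ^ 2 = ENNReal.ofReal (r ^ 2)⁻¹ * ‖D2 A (r • y) (r • x)‖ₑ ^ 2 := by
    intro x
    have h1 : D2 (Ar r A) y x = r⁻¹ • D2 A (r • y) (r • x) := by
      unfold D2 Ar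
      simp only [smul_add, smul_sub]
      rw [smul_comm (2:ℝ)]
    rw [h1, enorm_smul, mul_pow, Real.enorm_of_nonneg (by positivity), ← ENNReal.ofReal_pow (by positivity),
      inv_pow]
  simp only [this]
  rw [lintegral_const_mul' _ _ ENNReal.ofReal_ne_top, lint_scale hr (fun x => ‖D2 A (r • y) x‖ₑ ^ 2)]
  ring

/-- squared L2 norm of the truncated transform -/
def QQ (A : E → F) (ν : Measure E) (t : ℝ) : ℝ≥0∞ := ∫⁻ x, ‖TT A ν t x‖ₑ ^ 2

lemma QQ_meas [SFinite ν] (hA : Continuous A) : Measurable (QQ A ν) :=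
  Measurable.lintegral_prod_right' (f := fun p : ℝ × E => ‖TT A ν p.1 p.2‖ₑ ^ 2)
    ((TT_meas hA).measurable.enorm.pow_const 2)

/-- mass of the multiplier -/
def cm (m : ℕ) (τ : ℝ) : ℝ≥0∞ := ∫⁻ t in Ioi (0:ℝ), ‖mm' m τ t‖ₑ

lemma NN_le [SFinite ν] (hν : ν ≤ K • volume) (hA : Continuous A) {τ : ℝ} (hτ : 0 < τ) :
    NN A ν τ ≤ cm (Module.finrank ℝ E) τ *
      ∫⁻ t in Ioi (0:ℝ), ‖mm' (Module.finrank ℝ E) τ t‖ₑ * QQ A ν t := by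
  unfold NN
  refine (lintegral_mono fun x => FD_sq hν hA hτ x).trans ?_
  have m1 : Measurable fun p : E × ℝ => ‖mm' (Module.finrank ℝ E) τ p.2‖ₑ * ‖TT A ν p.2 p.1‖ₑ ^ 2 :=
    ((mm'_cont _ τ).measurable.comp measurable_snd).enorm.mul
      (((TT_meas hA).measurable.comp measurable_swap).enorm.pow_const 2)
  rw [lintegral_const_mul _ m1.lintegral_prod_right', lintegral_lintegral_swap m1.aemeasurable]
  refine mul_le_mul_right (le_of_eq ?_) _
  refine lintegral_congr fun t => ?_
  simp only
  rw [lintegral_const_mul]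
  · rfl
  · exact ((TT_meas hA).measurable.comp (measurable_const.prodMk measurable_id)).enorm.pow_const 2

lemma QQ_scale (hr : 0 < r) (t : ℝ) : QQ (Ar r A) (nr r ν) t =
    ENNReal.ofReal (r ^ Module.finrank ℝ E)⁻¹ * QQ A ν (r * t) := by
  unfold QQ
  simp only [TT_scale hr]
  exact lint_scale hr (fun x => ‖TT A ν (r * t) x‖ₑ ^ 2)

/-- scaled multiplier average -/
def RR (A : E → F) (ν : Measure E) (τ r : ℝ) : ℝ≥0∞ :=
  cm (Module.finrank ℝ E) τ * ∫⁻ t in Ioi (0:ℝ), ‖mm' (Module.finrank ℝ E) τ t‖ₑ * QQ A ν (r * t)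

lemma NN_scale [SFinite ν] (hν : ν ≤ K • volume) (hA : Continuous A) {τ : ℝ} (hτ : 0 < τ)
    (hr : 0 < r) : NN (Ar r A) (nr r ν) τ ≤ ENNReal.ofReal (r ^ Module.finrank ℝ E)⁻¹ * RR A ν τ r := by
  have h1 : nr r ν ≤ K • volume := by
    have := nr_mono hr hν
    rwa [nr_vol hr] at this
  refine (NN_le h1 (by unfold Ar; fun_prop) hτ).trans_eq ?_
  simp only [QQ_scale hr]
  unfold RR
  have : ∀ t, ‖mm' (Module.finrank ℝ E) τ t‖ₑ * (ENNReal.ofReal (r ^ Module.finrank ℝ E)⁻¹ * QQ A ν (r * t))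
    = ENNReal.ofReal (r ^ Module.finrank ℝ E)⁻¹ * (‖mm' (Module.finrank ℝ E) τ t‖ₑ * QQ A ν (r * t)) := by
    intro t; ring
  simp only [this]
  rw [lintegral_const_mul' _ _ ENNReal.ofReal_ne_top]
  ring
end

theorem star_r (E F : Type*) [NormedAddCommGroup E] [InnerProductSpace ℝ E] [FiniteDimensional ℝ E]
    [MeasurableSpace E] [BorelSpace E]
    [NormedAddCommGroup F] [InnerProductSpace ℝ F] [FiniteDimensional ℝ F]
    [MeasurableSpace F] [BorelSpace F] (K : ℝ≥0) (hK : 1 ≤ K) :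
    ∃ (L : ℕ) (C : ℝ≥0∞) (δ c0 : ℝ), C ≠ ∞ ∧ 0 < δ ∧ δ ≤ 1 ∧ 0 < c0 ∧
    ∀ (ν : Measure E) [SFinite ν] (A : E → F) (B ε : ℝ), ν ≤ K • volume → volume ≤ K • ν →
    (∀ x, ‖A x‖ ≤ B) → 0 ≤ ε → c0 * ε ≤ 1 → (∀ x y, ‖A x - A y‖ ≤ ε * ‖x - y‖) →
    ∀ h : E, ‖h‖ ≤ δ → ∀ r : ℝ, 0 < r → ENNReal.ofReal (r ^ 2)⁻¹ * DD A (r • h) ≤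
      C * (ENNReal.ofReal ((‖h‖ ^ 2 + (c0 * ε) ^ 2) ^ 2) *
        (∫⁻ y, gE 2 y * (ENNReal.ofReal (r ^ 2)⁻¹ * DD A (r • y)))
      + (RR A ν 1 r + RR A ν 2 r + ∑ j ∈ Finset.range L, RR A ν (4 ^ (j + 1)) r)) := by
  obtain ⟨L, C, δ, c0, hC, hδ, hδ1, hc0, H⟩ := star E F K hK
  refine ⟨L, C, δ, c0, hC, hδ, hδ1, hc0, ?_⟩
  intro ν _ A B ε h1 h2 hb hε hcε hl h hh r hr
  have hA : Continuous A := lip_cont hl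
  have g1 : nr r ν ≤ K • volume := by
    have := nr_mono hr h1
    rwa [nr_vol hr] at this
  have g2 : volume ≤ K • nr r ν := by
    have := nr_mono hr h2
    rwa [nr_vol hr] at this
  have := H (nr r ν) (Ar r A) (r⁻¹ * B) ε g1 g2 (Ar_bdd hr hb) hε hcε (Ar_lip hr hl) h hh
  set q := ENNReal.ofReal (r ^ Module.finrank ℝ E)⁻¹ with hq
  have hq0 : q ≠ 0 := by
    rw [hq, Ne, ENNReal.ofReal_eq_zero, not_le]; positivity
  have hqt : q ≠ ∞ := ENNReal.ofReal_ne_top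
  rw [← ENNReal.mul_le_mul_iff_right hq0 hqt]
  rw [DD_scale hr] at this
  refine this.trans ?_
  have hU : UU (Ar r A) = q * ∫⁻ y, gE 2 y * (ENNReal.ofReal (r ^ 2)⁻¹ * DD A (r • y)) := by
    unfold UU
    simp only [DD_scale hr]
    rw [← lintegral_const_mul' _ _ hqt]
    refine lintegral_congr fun y => ?_
    ring
  rw [hU]
  calc _ ≤ C * (ENNReal.ofReal ((‖h‖ ^ 2 + (c0 * ε) ^ 2) ^ 2) *
        (q * ∫⁻ y, gE 2 y * (ENNReal.ofReal (r ^ 2)⁻¹ * DD A (r • y)))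
      + (q * RR A ν 1 r + q * RR A ν 2 r + ∑ j ∈ Finset.range L, q * RR A ν (4 ^ (j + 1)) r)) := by
        gcongr
        · exact NN_scale h1 hA one_pos hr
        · exact NN_scale h1 hA two_pos hr
        · exact NN_scale h1 hA (by positivity) hr
    _ = _ := by
        rw [← Finset.mul_sum]
        ring


/-- the measure `dr/r` on the positive half line -/
def mh : Measure ℝ := (volume.restrict (Ioi 0)).withDensity (fun r => ENNReal.ofReal r⁻¹)

instance mh_sf : SFinite mh := by unfold mh; infer_instance

lemma mh_lint (f : ℝ → ℝ≥0∞) (hf : Measurable f) :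
    ∫⁻ r, f r ∂mh = ∫⁻ r in Ioi (0:ℝ), ENNReal.ofReal r⁻¹ * f r := by
  unfold mh
  rw [lintegral_withDensity_eq_lintegral_mul _ (by fun_prop) hf]
  rfl

lemma mh_pos : ∀ᵐ r ∂mh, 0 < r :=
  (withDensity_absolutelyContinuous _ _).ae_le (ae_restrict_mem measurableSet_Ioi)

lemma mh_scale {t : ℝ} (ht : 0 < t) (f : ℝ → ℝ≥0∞) (hf : Measurable f) :
    ∫⁻ r, f (r * t) ∂mh = ∫⁻ r, f r ∂mh := by
  rw [mh_lint _ hf, mh_lint (fun r => f (r * t)) (hf.comp (by fun_prop))]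
  rw [← lintegral_indicator measurableSet_Ioi, ← lintegral_indicator measurableSet_Ioi]
  set H : ℝ → ℝ≥0∞ := (Ioi (0:ℝ)).indicator fun r => ENNReal.ofReal r⁻¹ * f r with hH
  have h1 : ∀ r, (Ioi (0:ℝ)).indicator (fun r => ENNReal.ofReal r⁻¹ * f (r * t)) r =
      ENNReal.ofReal t * H (r * t) := by
    intro r
    rw [hH]
    unfold indicator
    simp only [mem_Ioi, mul_pos_iff_of_pos_right ht]
    split_ifs with h
    · rw [← mul_assoc, ← ENNReal.ofReal_mul ht.le]
      congr 2
      field_simp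
    · simp
  have hHm : Measurable H := Measurable.indicator (by fun_prop) measurableSet_Ioi
  simp only [h1]
  rw [lintegral_const_mul' _ _ ENNReal.ofReal_ne_top, ← lintegral_map hHm (by fun_prop),
    Real.map_volume_mul_right ht.ne', lintegral_smul_measure, smul_eq_mul, ← mul_assoc,
    ← ENNReal.ofReal_mul ht.le, abs_of_pos (by positivity), mul_inv_cancel₀ ht.ne',
    ENNReal.ofReal_one, one_mul]

/-- square function of second differences in direction `h` -/
def JJ (A : E → F) (h : E) : ℝ≥0∞ := ∫⁻ r, ENNReal.ofReal (r ^ 2)⁻¹ * DD A (r • h) ∂mh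

/-- the square function integral -/
def SS (A : E → F) (ν : Measure E) : ℝ≥0∞ := ∫⁻ t, QQ A ν t ∂mh

lemma DD_meas {A : E → F} (hA : Continuous A) : Measurable (DD A) :=
  Measurable.lintegral_prod_right' (f := fun p : E × E => ‖D2 A p.1 p.2‖ₑ ^ 2)
    ((D2_cont hA).measurable.enorm.pow_const 2)

lemma RR_meas {A : E → F} (hA : Continuous A) (ν : Measure E) [SFinite ν] (τ : ℝ) : Measurable (RR A ν τ) := by
  unfold RR
  refine Measurable.const_mul ?_ _
  refine Measurable.lintegral_prod_right' (f := fun p : ℝ × ℝ =>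
    ‖mm' (Module.finrank ℝ E) τ p.2‖ₑ * QQ A ν (p.1 * p.2)) ?_
  exact ((mm'_cont _ τ).measurable.comp measurable_snd).enorm.mul ((QQ_meas hA).comp (by fun_prop))

lemma RR_int {A : E → F} (hA : Continuous A) (ν : Measure E) [SFinite ν] (τ : ℝ) :
    ∫⁻ r, RR A ν τ r ∂mh = cm (Module.finrank ℝ E) τ ^ 2 * SS A ν := by
  unfold RR
  have m1 : Measurable fun p : ℝ × ℝ => ‖mm' (Module.finrank ℝ E) τ p.2‖ₑ * QQ A ν (p.1 * p.2) :=
    ((mm'_cont _ τ).measurable.comp measurable_snd).enorm.mul ((QQ_meas hA).comp (by fun_prop))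
  rw [lintegral_const_mul _ m1.lintegral_prod_right', lintegral_lintegral_swap m1.aemeasurable, pow_two,
    mul_assoc]
  congr 1
  rw [cm, ← lintegral_mul_const _ (mm'_cont _ τ).measurable.enorm]
  refine lintegral_congr_ae ?_
  filter_upwards [ae_restrict_mem measurableSet_Ioi] with t ht
  have m2 : Measurable fun x : ℝ => QQ A ν (x * t) := (QQ_meas hA).comp (by fun_prop)
  rw [lintegral_const_mul _ m2, mh_scale ht _ (QQ_meas hA)]
  rfl

theorem star_J (E F : Type*) [NormedAddCommGroup E] [InnerProductSpace ℝ E] [FiniteDimensional ℝ E]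
    [MeasurableSpace E] [BorelSpace E]
    [NormedAddCommGroup F] [InnerProductSpace ℝ F] [FiniteDimensional ℝ F]
    [MeasurableSpace F] [BorelSpace F] (K : ℝ≥0) (hK : 1 ≤ K) :
    ∃ (C : ℝ≥0∞) (δ c0 : ℝ), C ≠ ∞ ∧ 0 < δ ∧ δ ≤ 1 ∧ 0 < c0 ∧
    ∀ (ν : Measure E) [SFinite ν] (A : E → F) (B ε : ℝ), ν ≤ K • volume → volume ≤ K • ν →
    (∀ x, ‖A x‖ ≤ B) → 0 ≤ ε → c0 * ε ≤ 1 → (∀ x y, ‖A x - A y‖ ≤ ε * ‖x - y‖) →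
    ∀ h : E, ‖h‖ ≤ δ → JJ A h ≤
      C * (ENNReal.ofReal ((‖h‖ ^ 2 + (c0 * ε) ^ 2) ^ 2) * (∫⁻ y, gE 2 y * JJ A y) + SS A ν) := by
  obtain ⟨L, C, δ, c0, hC, hδ, hδ1, hc0, H⟩ := star_r E F K hK
  set n := Module.finrank ℝ E with hn
  set R : ℝ≥0∞ := cm n 1 ^ 2 + cm n 2 ^ 2 + ∑ j ∈ Finset.range L, cm n (4 ^ (j + 1)) ^ 2 with hR
  have hcm : ∀ τ : ℝ, 0 < τ → cm n τ ≠ ∞ := fun τ hτ => (mm'_fin n hτ).ne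
  have hRt : R ≠ ∞ := by
    refine ENNReal.add_ne_top.2 ⟨ENNReal.add_ne_top.2 ⟨ENNReal.pow_ne_top (hcm _ one_pos),
      ENNReal.pow_ne_top (hcm _ two_pos)⟩, ?_⟩
    exact ENNReal.sum_ne_top.2 fun j _ => ENNReal.pow_ne_top (hcm _ (by positivity))
  refine ⟨C * (1 + R), δ, c0, by finiteness, hδ, hδ1, hc0, ?_⟩
  intro ν _ A B ε h1 h2 hb hε hcε hl h hh
  have hA : Continuous A := lip_cont hl
  set a := ENNReal.ofReal ((‖h‖ ^ 2 + (c0 * ε) ^ 2) ^ 2) with ha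
  have m0 : Measurable fun p : ℝ × E => ENNReal.ofReal (p.1 ^ 2)⁻¹ * DD A (p.1 • p.2) :=
    Measurable.mul (by fun_prop) ((DD_meas hA).comp (by fun_prop))
  have m1 : Measurable fun p : ℝ × E => gE 2 p.2 * (ENNReal.ofReal (p.1 ^ 2)⁻¹ * DD A (p.1 • p.2)) :=
    ((gE_meas 2).comp measurable_snd).mul m0
  have mR := RR_meas hA ν
  have mR1 := mR 1
  have mR2 := mR 2
  have mS : Measurable fun r => ∑ j ∈ Finset.range L, RR A ν (4 ^ (j + 1)) r :=
    Finset.measurable_fun_sum _ fun j _ => mR _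
  have mI : Measurable fun r => ∫⁻ y, gE 2 y * (ENNReal.ofReal (r ^ 2)⁻¹ * DD A (r • y)) :=
    m1.lintegral_prod_right'
  calc JJ A h ≤ ∫⁻ r, C * (a * (∫⁻ y, gE 2 y * (ENNReal.ofReal (r ^ 2)⁻¹ * DD A (r • y)))
      + (RR A ν 1 r + RR A ν 2 r + ∑ j ∈ Finset.range L, RR A ν (4 ^ (j + 1)) r)) ∂mh := by
        refine lintegral_mono_ae ?_
        filter_upwards [mh_pos] with r hr
        exact H ν A B ε h1 h2 hb hε hcε hl h hh r hr
    _ = C * (a * (∫⁻ y, gE 2 y * JJ A y) + R * SS A ν) := by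
        rw [lintegral_const_mul _ (by fun_prop), lintegral_add_left (by fun_prop),
          lintegral_add_left (by fun_prop), lintegral_add_left (by fun_prop),
          lintegral_const_mul _ mI, RR_int hA, RR_int hA,
          lintegral_finsetSum _ fun j _ => mR _, lintegral_lintegral_swap m1.aemeasurable]
        simp only [RR_int hA]
        rw [← Finset.sum_mul]
        congr 2
        · congr 1
          refine lintegral_congr fun y => ?_
          rw [lintegral_const_mul]
          · rfl
          · exact m0.comp (measurable_id.prodMk measurable_const)
        · rw [hR]; ring
    _ ≤ C * ((1 + R) * (a * (∫⁻ y, gE 2 y * JJ A y)) + (1 + R) * SS A ν) := by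
        refine mul_le_mul_right (add_le_add ?_ ?_) _
        · exact le_mul_of_one_le_left zero_le le_self_add
        · exact mul_le_mul_left le_add_self _
    _ = _ := by ring


section frullani
open Filter Topology
variable {A : E → F} {L : ℝ≥0} {R : ℝ}

/-- normalised first difference energy -/
def EE (A : E → F) (v : E) (t : ℝ) : ℝ≥0∞ := ENNReal.ofReal (t ^ 2)⁻¹ * ∫⁻ x, ‖A (x + t • v) - A x‖ₑ ^ 2

/-- directional energy -/
def GV (A : E → F) (v : E) : ℝ≥0∞ := ∫⁻ x, ‖fderiv ℝ A x v‖ₑ ^ 2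

/-- Dirichlet energy -/
def GG (A : E → F) : ℝ≥0∞ := ∫⁻ x, ‖fderiv ℝ A x‖ₑ ^ 2

lemma enorm_sq_ofReal (a : F) : ‖a‖ₑ ^ 2 = ENNReal.ofReal (‖a‖ ^ 2) := by
  rw [← ofReal_norm_eq_enorm, ENNReal.ofReal_pow (norm_nonneg _)]

lemma par_enorm (a b : F) : ‖a + b‖ₑ ^ 2 + ‖a - b‖ₑ ^ 2 = 2 * (‖a‖ₑ ^ 2 + ‖b‖ₑ ^ 2) := by
  simp only [enorm_sq_ofReal]
  rw [← ENNReal.ofReal_add (by positivity) (by positivity),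
    ← ENNReal.ofReal_add (by positivity) (by positivity), parallelogram_law_with_norm ℝ,
    ENNReal.ofReal_mul (by norm_num)]
  norm_num

lemma EE_par (hA : Continuous A) (v : E) {t : ℝ} (ht : 0 < t) :
    ENNReal.ofReal (t ^ 2)⁻¹ * DD A (t • v) + 4 * EE A v (2 * t) = 4 * EE A v t := by
  have c1 : ENNReal.ofReal (t ^ 2)⁻¹ = 4 * ENNReal.ofReal ((2 * t) ^ 2)⁻¹ := by
    rw [show (4 : ℝ≥0∞) = ENNReal.ofReal 4 by norm_num, ← ENNReal.ofReal_mul (by norm_num)]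
    congr 1
    field_simp
    norm_num
  have main : DD A (t • v) + ∫⁻ x, ‖A (x + (2 * t) • v) - A x‖ₑ ^ 2 =
      4 * ∫⁻ x, ‖A (x + t • v) - A x‖ₑ ^ 2 := by
    have h1 : DD A (t • v) = ∫⁻ x, ‖(A (x + (2 * t) • v) - A (x + t • v)) - (A (x + t • v) - A x)‖ₑ ^ 2 := by
      unfold DD
      rw [← lintegral_add_right_eq_self (fun x => ‖D2 A (t • v) x‖ₑ ^ 2) (t • v)]
      refine lintegral_congr fun x => ?_
      congr 2
      unfold D2
      rw [show x + t • v + t • v = x + (2 * t) • v by rw [two_mul, add_smul]; abel,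
        add_sub_cancel_right, two_smul]
      abel
    have h2 : ∫⁻ x, ‖A (x + (2 * t) • v) - A (x + t • v)‖ₑ ^ 2 = ∫⁻ x, ‖A (x + t • v) - A x‖ₑ ^ 2 := by
      rw [← lintegral_add_right_eq_self (fun x => ‖A (x + t • v) - A x‖ₑ ^ 2) (t • v)]
      refine lintegral_congr fun x => ?_
      rw [show x + t • v + t • v = x + (2 * t) • v by rw [two_mul, add_smul]; abel]
    have hA' := hA.measurable
    rw [h1, ← lintegral_add_left (by fun_prop)]
    calc _ = ∫⁻ x, 2 * (‖A (x + (2 * t) • v) - A (x + t • v)‖ₑ ^ 2 + ‖A (x + t • v) - A x‖ₑ ^ 2) := by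
          refine lintegral_congr fun x => ?_
          rw [← par_enorm, sub_add_sub_cancel, add_comm]
      _ = _ := by
          rw [lintegral_const_mul _ (by fun_prop), lintegral_add_left (by fun_prop), h2]
          ring
  unfold EE
  calc _ = ENNReal.ofReal (t ^ 2)⁻¹ * (DD A (t • v) + ∫⁻ x, ‖A (x + (2 * t) • v) - A x‖ₑ ^ 2) := by
        rw [mul_add, ← mul_assoc, ← c1]
    _ = _ := by rw [main]; ring

lemma EE_two (hA : Continuous A) (v : E) {t : ℝ} (ht : 0 < t) : EE A v (2 * t) ≤ EE A v t := by
  have h := EE_par hA v ht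
  have h2 : 4 * EE A v (2 * t) ≤ 4 * EE A v t := h ▸ le_add_self
  rwa [ENNReal.mul_le_mul_iff_right (by norm_num) (by norm_num)] at h2

lemma EE_meas (hA : Continuous A) (v : E) : Measurable (EE A v) := by
  unfold EE
  have hA' := hA.measurable
  refine Measurable.mul (by fun_prop) ?_
  refine Measurable.lintegral_prod_right' (f := fun p : ℝ × E => ‖A (p.2 + p.1 • v) - A p.2‖ₑ ^ 2) ?_
  fun_prop

lemma EE_lim (hL : LipschitzWith L A) (hR : ∀ x, R < ‖x‖ → A x = 0) (v : E) :
    Tendsto (EE A v) (𝓝[>] 0) (𝓝 (GV A v)) := by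
  have hA := hL.continuous
  have hA' := hA.measurable
  have e1 : ∀ᶠ t in 𝓝[>] (0:ℝ), ∫⁻ x, ‖t⁻¹ • (A (x + t • v) - A x)‖ₑ ^ 2 = EE A v t := by
    filter_upwards [self_mem_nhdsWithin] with t ht
    have ht' : (0:ℝ) < t := ht
    unfold EE
    rw [← lintegral_const_mul' _ _ ENNReal.ofReal_ne_top]
    refine lintegral_congr fun x => ?_
    rw [enorm_smul, mul_pow, Real.enorm_of_nonneg (by positivity), ← ENNReal.ofReal_pow (by positivity), inv_pow]
  refine Tendsto.congr' e1 ?_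
  refine tendsto_lintegral_filter_of_dominated_convergence
    ((closedBall (0:E) (R + ‖v‖)).indicator fun _ => (L * ‖v‖ₑ) ^ 2) ?_ ?_ ?_ ?_
  · exact Eventually.of_forall fun t => by fun_prop
  · have : Ioc (0:ℝ) 1 ∈ 𝓝[>] (0:ℝ) := Ioc_mem_nhdsGT one_pos
    filter_upwards [this] with t ht
    refine Eventually.of_forall fun x => ?_
    by_cases hx : x ∈ closedBall (0:E) (R + ‖v‖)
    · rw [indicator_of_mem hx]
      gcongr
      rw [← ofReal_norm_eq_enorm, ← ofReal_norm_eq_enorm, ← ENNReal.ofReal_coe_nnreal,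
        ← ENNReal.ofReal_mul (by positivity)]
      apply ENNReal.ofReal_le_ofReal
      rw [norm_smul, norm_inv, Real.norm_of_nonneg ht.1.le, inv_mul_le_iff₀ ht.1]
      have := hL.norm_sub_le (x + t • v) x
      rw [add_sub_cancel_left, norm_smul, Real.norm_of_nonneg ht.1.le] at this
      linarith
    · rw [indicator_of_notMem hx]
      rw [mem_closedBall_zero_iff, not_le] at hx
      have h1 : ‖t • v‖ ≤ ‖v‖ := by
        rw [norm_smul, Real.norm_of_nonneg ht.1.le]
        exact mul_le_of_le_one_left (norm_nonneg _) ht.2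
      have h2 : A x = 0 := hR x (by linarith [norm_nonneg v])
      have h3 : A (x + t • v) = 0 := hR _ (by
        have := norm_sub_le (x + t • v) (t • v)
        rw [add_sub_cancel_right] at this
        linarith)
      simp [h2, h3]
  · rw [lintegral_indicator measurableSet_closedBall, setLIntegral_const]
    have : volume (closedBall (0:E) (R + ‖v‖)) < ∞ := measure_closedBall_lt_top
    finiteness
  · filter_upwards [hL.ae_differentiableAt (μ := volume)] with x hx
    have h := (hx.hasFDerivAt.hasLineDerivAt v).tendsto_slope_zero_right
    exact (((ENNReal.continuous_pow 2).comp continuous_enorm).tendsto _).comp h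

lemma EE_le (hL : LipschitzWith L A) (hR : ∀ x, R < ‖x‖ → A x = 0) (v : E) {t : ℝ} (ht : 0 < t) :
    EE A v t ≤ GV A v := by
  have h1 : ∀ k : ℕ, EE A v t ≤ EE A v (t * (1 / 2) ^ k) := by
    intro k
    induction k with
    | zero => simp
    | succ k ih =>
      refine ih.trans ?_
      have := EE_two hL.continuous v (t := t * (1 / 2) ^ (k + 1)) (by positivity)
      rwa [show 2 * (t * (1 / 2) ^ (k + 1)) = t * (1 / 2) ^ k by rw [pow_succ]; ring] at this
  have h2 : Tendsto (fun k : ℕ => t * (1 / 2 : ℝ) ^ k) atTop (𝓝[>] 0) := by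
    refine tendsto_nhdsWithin_iff.2 ⟨?_, Eventually.of_forall fun k => by simp only [mem_Ioi]; positivity⟩
    have := (tendsto_pow_atTop_nhds_zero_of_lt_one (r := (1 / 2 : ℝ)) (by norm_num) (by norm_num)).const_mul t
    simpa using this
  exact ge_of_tendsto' ((EE_lim hL hR v).comp h2) h1

lemma EE_inf (hA : Continuous A) (hR : ∀ x, R < ‖x‖ → A x = 0) {B : ℝ} (hb : ∀ x, ‖A x‖ ≤ B) (v : E) :
    Tendsto (EE A v) atTop (𝓝 0) := by
  set M : ℝ≥0∞ := ∫⁻ x, ‖A x‖ₑ ^ 2 with hM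
  have hMf : M ≠ ∞ := by
    have : M ≤ ∫⁻ x, (closedBall (0:E) R).indicator (fun _ => ENNReal.ofReal B ^ 2) x := by
      refine lintegral_mono fun x => ?_
      by_cases hx : x ∈ closedBall (0:E) R
      · rw [indicator_of_mem hx, ← ofReal_norm_eq_enorm]
        gcongr
        exact hb x
      · rw [indicator_of_notMem hx]
        rw [mem_closedBall_zero_iff, not_le] at hx
        simp [hR x hx]
    refine ne_top_of_le_ne_top ?_ this
    rw [lintegral_indicator measurableSet_closedBall, setLIntegral_const]
    have : volume (closedBall (0:E) R) < ∞ := measure_closedBall_lt_top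
    finiteness
  have h1 : ∀ t, EE A v t ≤ ENNReal.ofReal (t ^ 2)⁻¹ * (4 * M) := by
    intro t
    unfold EE
    gcongr
    have hA' := hA.measurable
    calc _ ≤ ∫⁻ x, 2 * (‖A (x + t • v)‖ₑ ^ 2 + ‖A x‖ₑ ^ 2) := by
          refine lintegral_mono fun x => ?_
          refine le_trans ?_ (e_add_sq _ _)
          gcongr
          exact enorm_sub_le
      _ = _ := by
          rw [lintegral_const_mul _ (by fun_prop), lintegral_add_left (by fun_prop),
            lintegral_add_right_eq_self (fun x => ‖A x‖ₑ ^ 2)]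
          rw [← hM]; ring
  have h2 : Tendsto (fun t : ℝ => ENNReal.ofReal (t ^ 2)⁻¹ * (4 * M)) atTop (𝓝 0) := by
    have h3 : Tendsto (fun t : ℝ => (t ^ 2)⁻¹) atTop (𝓝 0) := tendsto_inv_atTop_zero.comp (tendsto_pow_atTop two_ne_zero)
    have h4 := ENNReal.tendsto_ofReal h3
    rw [ENNReal.ofReal_zero] at h4
    have h5 := ENNReal.Tendsto.mul_const (b := 4 * M) h4 (Or.inr (by finiteness))
    rwa [zero_mul] at h5
  exact tendsto_of_tendsto_of_tendsto_of_le_of_le tendsto_const_nhds h2 (fun t => zero_le) h1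

/-- logarithmic mass of a dyadic interval -/
def kap : ℝ≥0∞ := mh (Ioc 1 2)

lemma mh_Ioc {a b : ℝ} (ha : 0 < a) : mh (Ioc a b) = ∫⁻ r in Ioc a b, ENNReal.ofReal r⁻¹ := by
  unfold mh
  rw [withDensity_apply _ measurableSet_Ioc, Measure.restrict_restrict measurableSet_Ioc,
    inter_eq_left.2 (fun r hr => mem_Ioi.2 (lt_trans ha hr.1) : Ioc a b ⊆ Ioi 0)]

lemma mh_fin {a b : ℝ} (ha : 0 < a) : mh (Ioc a b) ≠ ∞ := by
  rw [mh_Ioc ha]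
  have : ∫⁻ r in Ioc a b, ENNReal.ofReal r⁻¹ ≤ ∫⁻ r in Ioc a b, ENNReal.ofReal a⁻¹ := by
    refine setLIntegral_mono' measurableSet_Ioc fun r hr => ?_
    apply ENNReal.ofReal_le_ofReal
    exact inv_anti₀ ha hr.1.le
  refine ne_top_of_le_ne_top ?_ this
  rw [setLIntegral_const, Real.volume_Ioc]
  finiteness

lemma kap_ne : kap ≠ ∞ := mh_fin one_pos

lemma kap_pos : kap ≠ 0 := by
  unfold kap
  rw [mh_Ioc one_pos]
  have : ∫⁻ r in Ioc (1:ℝ) 2, ENNReal.ofReal 2⁻¹ ≤ ∫⁻ r in Ioc (1:ℝ) 2, ENNReal.ofReal r⁻¹ := by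
    refine setLIntegral_mono' measurableSet_Ioc fun r hr => ?_
    apply ENNReal.ofReal_le_ofReal
    exact inv_anti₀ (by linarith [hr.1]) hr.2
  refine (lt_of_lt_of_le ?_ this).ne'
  rw [setLIntegral_const, Real.volume_Ioc, ← ENNReal.ofReal_mul (by norm_num)]
  exact ENNReal.ofReal_pos.2 (by norm_num)

lemma mh_dy {a : ℝ} (ha : 0 < a) : mh (Ioc a (2 * a)) = kap := by
  unfold kap
  have h := mh_scale (inv_pos.2 ha) ((Ioc (1:ℝ) 2).indicator fun _ => 1)
    (measurable_const.indicator measurableSet_Ioc)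
  rw [lintegral_indicator_const measurableSet_Ioc, one_mul] at h
  rw [← h, ← one_mul (mh _), ← lintegral_indicator_const measurableSet_Ioc]
  refine lintegral_congr fun r => ?_
  unfold indicator
  have : r ∈ Ioc a (2 * a) ↔ r * a⁻¹ ∈ Ioc (1:ℝ) 2 := by
    rw [mem_Ioc, mem_Ioc, ← div_eq_mul_inv, one_lt_div ha, div_le_iff₀ ha]
  simp only [this]

lemma fru (hL : LipschitzWith L A) (hR : ∀ x, R < ‖x‖ → A x = 0) (v : E) (hG : GV A v ≠ ∞) {a b : ℝ} (ha : 0 < a)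
    (hab : 2 * a ≤ b) :
    (∫⁻ r in Ioc a b, ENNReal.ofReal (r ^ 2)⁻¹ * DD A (r • v) ∂mh) + 4 * (∫⁻ r in Ioc b (2 * b), EE A v r ∂mh)
      = 4 * ∫⁻ r in Ioc a (2 * a), EE A v r ∂mh := by
  have hA := hL.continuous
  have mE := EE_meas hA v
  set M := ∫⁻ r in Ioc (2 * a) b, EE A v r ∂mh with hM
  have hMf : M ≠ ∞ := by
    have : M ≤ ∫⁻ r in Ioc (2 * a) b, GV A v ∂mh :=
      setLIntegral_mono' measurableSet_Ioc fun r hr => EE_le hL hR v (by linarith [hr.1])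
    refine ne_top_of_le_ne_top ?_ this
    rw [setLIntegral_const]
    have := mh_fin (a := 2 * a) (b := b) (by positivity)
    finiteness
  have h1 : ∫⁻ r in Ioc a b, EE A v (2 * r) ∂mh = ∫⁻ r in Ioc (2 * a) (2 * b), EE A v r ∂mh := by
    rw [← lintegral_indicator measurableSet_Ioc, ← lintegral_indicator measurableSet_Ioc,
      ← mh_scale two_pos _ (mE.indicator measurableSet_Ioc)]
    refine lintegral_congr fun r => ?_
    unfold indicator
    have : r ∈ Ioc a b ↔ r * 2 ∈ Ioc (2 * a) (2 * b) := by
      rw [mem_Ioc, mem_Ioc]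
      constructor <;> rintro ⟨h, h'⟩ <;> constructor <;> linarith
    simp only [this, mul_comm (2:ℝ) r]
    split_ifs <;> rfl
  have h2 : (∫⁻ r in Ioc a b, ENNReal.ofReal (r ^ 2)⁻¹ * DD A (r • v) ∂mh) +
      4 * ∫⁻ r in Ioc a b, EE A v (2 * r) ∂mh = 4 * ∫⁻ r in Ioc a b, EE A v r ∂mh := by
    have m1 : Measurable fun r : ℝ => ENNReal.ofReal (r ^ 2)⁻¹ * DD A (r • v) :=
      Measurable.mul (by fun_prop) ((DD_meas hA).comp (by fun_prop))
    rw [← lintegral_const_mul _ (by fun_prop), ← lintegral_const_mul _ (by fun_prop), ← lintegral_add_left m1]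
    exact setLIntegral_congr_fun measurableSet_Ioc fun r hr => EE_par hA v (ha.trans hr.1)
  have h3 : ∫⁻ r in Ioc (2 * a) (2 * b), EE A v r ∂mh = M + ∫⁻ r in Ioc b (2 * b), EE A v r ∂mh := by
    rw [← Ioc_union_Ioc_eq_Ioc hab (by linarith), lintegral_union measurableSet_Ioc]
    rw [Set.disjoint_left]
    intro x h1 h2
    exact absurd h2.1 (not_lt.2 h1.2)
  have h4 : ∫⁻ r in Ioc a b, EE A v r ∂mh = (∫⁻ r in Ioc a (2 * a), EE A v r ∂mh) + M := by
    rw [← Ioc_union_Ioc_eq_Ioc (by linarith) hab, lintegral_union measurableSet_Ioc]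
    rw [Set.disjoint_left]
    intro x h1 h2
    exact absurd h2.1 (not_lt.2 h1.2)
  rw [h1, h3, h4] at h2
  have h5 : 4 * M ≠ ∞ := by finiteness
  rw [← ENNReal.add_left_inj h5]
  calc _ = _ := by ring
    _ = _ := h2
    _ = _ := by ring

lemma JJ_le (hL : LipschitzWith L A) (hR : ∀ x, R < ‖x‖ → A x = 0) (v : E) (hG : GV A v ≠ ∞) :
    JJ A v ≤ 4 * kap * GV A v := by
  have h0 : (⋃ k : ℕ, Ioc ((k + 2 : ℝ)⁻¹) (k + 2)) = Ioi (0:ℝ) := by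
    ext r
    simp only [mem_iUnion, mem_Ioc, mem_Ioi]
    constructor
    · rintro ⟨k, h1, h2⟩
      exact lt_trans (by positivity) h1
    · intro hr
      obtain ⟨k, hk⟩ := exists_nat_gt (max r r⁻¹)
      refine ⟨k, ?_, ?_⟩
      · rw [inv_lt_comm₀ (by positivity) hr]
        linarith [le_max_right r r⁻¹]
      · linarith [le_max_left r r⁻¹]
  have hd : Directed (· ⊆ ·) fun k : ℕ => Ioc ((k + 2 : ℝ)⁻¹) (k + 2) := by
    refine Monotone.directed_le fun i j hij => ?_
    have hij' : (i:ℝ) ≤ j := by exact_mod_cast hij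
    refine Ioc_subset_Ioc ?_ (by linarith)
    exact inv_anti₀ (by positivity) (by linarith)
  unfold JJ
  rw [← Measure.restrict_eq_self_of_ae_mem (s := Ioi (0:ℝ)) mh_pos, ← h0,
    setLIntegral_iUnion_of_directed _ hd]
  refine iSup_le fun k => ?_
  have ha : (0:ℝ) < (k + 2 : ℝ)⁻¹ := by positivity
  have hk0 : (0:ℝ) ≤ k := by positivity
  have hab : 2 * (k + 2 : ℝ)⁻¹ ≤ k + 2 := by
    have : (k + 2 : ℝ)⁻¹ ≤ 2⁻¹ := inv_anti₀ (by norm_num) (by linarith)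
    linarith
  have h := fru hL hR v hG ha hab
  calc _ ≤ 4 * ∫⁻ r in Ioc ((k + 2 : ℝ)⁻¹) (2 * (k + 2 : ℝ)⁻¹), EE A v r ∂mh := by
        rw [← h]; exact le_self_add
    _ ≤ 4 * ∫⁻ r in Ioc ((k + 2 : ℝ)⁻¹) (2 * (k + 2 : ℝ)⁻¹), GV A v ∂mh := by
        refine mul_le_mul_right ?_ _
        exact setLIntegral_mono' measurableSet_Ioc fun r hr => EE_le hL hR v (ha.trans hr.1)
    _ = _ := by rw [setLIntegral_const, mh_dy ha]; ring

lemma le_JJ (hL : LipschitzWith L A) (hR : ∀ x, R < ‖x‖ → A x = 0) {B : ℝ} (hb : ∀ x, ‖A x‖ ≤ B)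
    (v : E) (hG : GV A v ≠ ∞) :
    kap * GV A v ≤ JJ A v := by
  rcases eq_or_ne (GV A v) 0 with h0 | h0
  · simp [h0]
  have hk := kap_ne
  have e1 := (EE_lim hL hR v).eventually (lt_mem_nhds (ENNReal.half_lt_self h0 hG))
  have e2 := (EE_inf hL.continuous hR hb v).eventually (gt_mem_nhds
    (show 0 < GV A v / 4 from (ENNReal.div_pos h0 (by norm_num))))
  obtain ⟨a', ha', h1⟩ := mem_nhdsGT_iff_exists_Ioc_subset.1 e1
  obtain ⟨b', h2⟩ := eventually_atTop.1 e2
  have ha0 : (0:ℝ) < a' := ha'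
  set a := a' / 2 with hae
  have ha : 0 < a := by positivity
  set b := max b' (2 * a) with hbe
  have hab : 2 * a ≤ b := le_max_right _ _
  have h := fru hL hR v hG ha hab
  have hZ : 2 * (kap * GV A v) ≤ 4 * ∫⁻ r in Ioc a (2 * a), EE A v r ∂mh := by
    have : ∫⁻ r in Ioc a (2 * a), GV A v / 2 ∂mh ≤ ∫⁻ r in Ioc a (2 * a), EE A v r ∂mh :=
      setLIntegral_mono' measurableSet_Ioc fun r hr => le_of_lt (h1 ⟨ha.trans hr.1, by
        have := hr.2; rw [hae] at this; linarith⟩)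
    rw [setLIntegral_const, mh_dy ha] at this
    refine le_trans (le_of_eq ?_) (mul_le_mul_right this 4)
    rw [show (4 : ℝ≥0∞) = 2 * 2 by norm_num]
    calc _ = 2 * kap * (GV A v) := by ring
      _ = 2 * kap * (2 * (GV A v / 2)) := by rw [ENNReal.mul_div_cancel (by norm_num) (by norm_num)]
      _ = _ := by ring
  have hY : 4 * (∫⁻ r in Ioc b (2 * b), EE A v r ∂mh) ≤ kap * GV A v := by
    have : ∫⁻ r in Ioc b (2 * b), EE A v r ∂mh ≤ ∫⁻ r in Ioc b (2 * b), GV A v / 4 ∂mh :=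
      setLIntegral_mono' measurableSet_Ioc fun r hr => le_of_lt (h2 r ((le_max_left _ _).trans hr.1.le))
    rw [setLIntegral_const, mh_dy (by linarith)] at this
    refine le_trans (mul_le_mul_right this 4) (le_of_eq ?_)
    rw [← mul_assoc, ENNReal.mul_div_cancel (by norm_num) (by norm_num), mul_comm]
  have hX : (∫⁻ r in Ioc a b, ENNReal.ofReal (r ^ 2)⁻¹ * DD A (r • v) ∂mh) ≤ JJ A v :=
    setLIntegral_le_lintegral _ _
  have hkG : kap * GV A v ≠ ∞ := by finiteness
  rw [← ENNReal.add_le_add_iff_right hkG]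
  calc kap * GV A v + kap * GV A v = 2 * (kap * GV A v) := by ring
    _ ≤ _ := hZ
    _ = _ := h.symm
    _ ≤ _ := add_le_add hX hY
end frullani


section asm

lemma op_sq (T : E →L[ℝ] F) :
    ‖T‖ ^ 2 ≤ ∑ i, ‖T (stdOrthonormalBasis ℝ E i)‖ ^ 2 := by
  set b := stdOrthonormalBasis ℝ E
  have h0 : 0 ≤ ∑ i, ‖T (b i)‖ ^ 2 := Finset.sum_nonneg fun i _ => by positivity
  have : ‖T‖ ≤ Real.sqrt (∑ i, ‖T (b i)‖ ^ 2) := by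
    refine T.opNorm_le_bound (Real.sqrt_nonneg _) fun v => ?_
    have e1 : T v = ∑ i, (inner ℝ (b i) v) • T (b i) := by
      conv_lhs => rw [← b.sum_repr' v]
      rw [map_sum]
      simp only [map_smul]
    have e2 : ‖v‖ = Real.sqrt (∑ i, |inner ℝ (b i) v| ^ 2) := by
      rw [← Real.sqrt_sq (norm_nonneg v), ← b.sum_sq_norm_inner_right v]
      rfl
    rw [e1, e2, mul_comm]
    refine (norm_sum_le _ _).trans ?_
    simp only [norm_smul, Real.norm_eq_abs]
    exact Real.sum_mul_le_sqrt_mul_sqrt _ _ _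
  calc ‖T‖ ^ 2 ≤ Real.sqrt (∑ i, ‖T (b i)‖ ^ 2) ^ 2 := by gcongr
    _ = _ := Real.sq_sqrt h0

lemma GG_le_sum (A : E → F) : GG A ≤ ∑ i, GV A (stdOrthonormalBasis ℝ E i) := by
  unfold GG GV
  rw [← lintegral_finsetSum _ (fun i _ => (measurable_fderiv_apply_const ℝ A _).enorm.pow_const 2)]
  refine lintegral_mono fun x => ?_
  simp only [enorm_sq_ofReal]
  rw [← ENNReal.ofReal_sum_of_nonneg (fun i _ => by positivity), ← ofReal_norm_eq_enorm,
    ← ENNReal.ofReal_pow (norm_nonneg _)]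
  exact ENNReal.ofReal_le_ofReal (op_sq _)

lemma GV_le (A : E → F) (v : E) : GV A v ≤ ‖v‖ₑ ^ 2 * GG A := by
  unfold GG GV
  rw [← lintegral_const_mul' _ _ (by finiteness)]
  refine lintegral_mono fun x => ?_
  rw [← mul_pow]
  gcongr
  rw [mul_comm]
  exact ContinuousLinearMap.le_opNorm_enorm _ _

lemma GV_smul (A : E → F) (v : E) (t : ℝ) : GV A (t • v) = ENNReal.ofReal (t ^ 2) * GV A v := by
  unfold GV
  rw [← lintegral_const_mul' _ _ (by finiteness)]
  refine lintegral_congr fun x => ?_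
  rw [map_smul, enorm_smul, mul_pow, enorm_sq_ofReal t, Real.norm_eq_abs, sq_abs]

lemma GG_fin {A : E → F} {L : ℝ≥0} (hL : LipschitzWith L A) (hc : HasCompactSupport A) : GG A ≠ ∞ := by
  have hc' := hc.fderiv (𝕜 := ℝ)
  have h1 : GG A ≤ ∫⁻ x, (tsupport (fderiv ℝ A)).indicator (fun _ => (L:ℝ≥0∞) ^ 2) x := by
    unfold GG
    refine lintegral_mono fun x => ?_
    by_cases hx : x ∈ tsupport (fderiv ℝ A)
    · rw [indicator_of_mem hx]
      gcongr
      have := norm_fderiv_le_of_lipschitz ℝ hL (x₀ := x)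
      rw [← ofReal_norm_eq_enorm, ← ENNReal.ofReal_coe_nnreal]
      exact ENNReal.ofReal_le_ofReal this
    · rw [indicator_of_notMem hx, image_eq_zero_of_notMem_tsupport hx,
        ← ofReal_norm_eq_enorm, norm_zero]
      simp
  refine ne_top_of_le_ne_top ?_ h1
  rw [lintegral_indicator (isClosed_tsupport _).measurableSet, setLIntegral_const]
  have : volume (tsupport (fderiv ℝ A)) < ∞ := hc'.isCompact.measure_lt_top
  finiteness

theorem core (E F : Type*) [NormedAddCommGroup E] [InnerProductSpace ℝ E] [FiniteDimensional ℝ E]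
    [MeasurableSpace E] [BorelSpace E]
    [NormedAddCommGroup F] [InnerProductSpace ℝ F] [FiniteDimensional ℝ F]
    [MeasurableSpace F] [BorelSpace F] (K : ℝ≥0) (hK : 1 ≤ K) :
    ∃ ε₀ c : ℝ, 0 < ε₀ ∧ 0 < c ∧
    ∀ (ν : Measure E) [SFinite ν] (A : E → F) (ε : ℝ), ν ≤ K • volume → volume ≤ K • ν →
    HasCompactSupport A → 0 ≤ ε → ε ≤ ε₀ → LipschitzWith ε.toNNReal A →
    ENNReal.ofReal c * GG A ≤ SS A ν := by
  obtain ⟨C, δ, c0, hC, hδ, hδ1, hc0, H⟩ := star_J E F K hK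
  set N : ℝ≥0∞ := (Module.finrank ℝ E : ℝ≥0∞) with hN
  have fN : N ≠ ∞ := ENNReal.natCast_ne_top _
  set W : ℝ≥0∞ := ∫⁻ y : E, gE 2 y * (1 + ‖y‖ₑ ^ 4) with hW
  have fW : W ≠ ∞ := (W_fin two_pos).ne
  set M : ℝ := (N * C * 16 * W).toReal with hM
  have hM0 : 0 ≤ M := ENNReal.toReal_nonneg
  have hMe : N * C * 16 * W = ENNReal.ofReal M := (ENNReal.ofReal_toReal (by finiteness)).symm
  set s : ℝ := min δ (1 / (2 * (M + 1))) with hs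
  have hs0 : 0 < s := lt_min hδ (by positivity)
  have hsδ : s ≤ δ := min_le_left _ _
  have hs1 : s ≤ 1 := hsδ.trans hδ1
  have hsM : s ^ 2 * M ≤ 1 / 2 := by
    have h1 : s ^ 2 ≤ 1 / (2 * (M + 1)) := by
      have : s ≤ 1 / (2 * (M + 1)) := min_le_right _ _
      nlinarith
    calc s ^ 2 * M ≤ 1 / (2 * (M + 1)) * M := by gcongr
      _ ≤ 1 / 2 := by
        rw [div_mul_eq_mul_div, div_le_div_iff₀ (by positivity) (by norm_num)]
        linarith
  set D : ℝ≥0∞ := ENNReal.ofReal (s ^ 2) with hD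
  have hD0 : D ≠ 0 := (ENNReal.ofReal_pos.2 (by positivity)).ne'
  have fD : D ≠ ∞ := ENNReal.ofReal_ne_top
  have fk := kap_ne
  have pk := kap_pos
  set c' : ℝ≥0∞ := kap * D / 2 / (N * C + 1) with hc'
  have fc' : c' ≠ ∞ := by
    refine ENNReal.div_ne_top (ENNReal.div_ne_top (by finiteness) (by norm_num)) (by simp)
  have pc' : c' ≠ 0 := by
    refine (ENNReal.div_pos (ENNReal.div_pos (mul_ne_zero pk hD0) (by norm_num)).ne' (by finiteness)).ne'
  refine ⟨s / c0, c'.toReal, by positivity, ENNReal.toReal_pos pc' fc', ?_⟩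
  intro ν _ A ε h1 h2 hcs hε hεs hL
  rw [ENNReal.ofReal_toReal fc']
  have hcε : c0 * ε ≤ s := by
    rw [le_div_iff₀ hc0] at hεs
    linarith
  have hA := hL.continuous
  obtain ⟨B, hB⟩ := hA.bounded_above_of_compact_support hcs
  obtain ⟨R, hR⟩ : ∃ R : ℝ, ∀ x, R < ‖x‖ → A x = 0 := by
    obtain ⟨R, hR⟩ := hcs.isCompact.isBounded.subset_closedBall (0:E)
    refine ⟨R, fun x hx => image_eq_zero_of_notMem_tsupport fun h => ?_⟩
    have := hR h
    rw [mem_closedBall_zero_iff] at this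
    linarith
  have hl : ∀ x y, ‖A x - A y‖ ≤ ε * ‖x - y‖ := fun x y => by
    have := hL.norm_sub_le x y
    rwa [Real.coe_toNNReal _ hε] at this
  have fG : GG A ≠ ∞ := GG_fin hL hcs
  have fV : ∀ v, GV A v ≠ ∞ := fun v => ne_top_of_le_ne_top (by finiteness) (GV_le A v)
  have hI : ∫⁻ y, gE 2 y * JJ A y ≤ 4 * kap * GG A * W := by
    have m : Measurable fun y : E => gE 2 y * (1 + ‖y‖ₑ ^ 4) := (gE_meas 2).mul (by fun_prop)
    rw [hW, ← lintegral_const_mul _ m]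
    refine lintegral_mono fun y => ?_
    have e1 : ‖y‖ₑ ^ 2 ≤ 1 + ‖y‖ₑ ^ 4 := by
      rcases le_total ‖y‖ₑ 1 with h | h
      · exact (pow_le_one₀ zero_le h).trans le_self_add
      · exact (pow_le_pow_right₀ h (by norm_num)).trans le_add_self
    calc gE 2 y * JJ A y ≤ gE 2 y * (4 * kap * ((1 + ‖y‖ₑ ^ 4) * GG A)) := by
          gcongr
          refine (JJ_le hL hR y (fV y)).trans ?_
          gcongr
          refine (GV_le A y).trans ?_
          gcongr
      _ = _ := by ring
  have hi : ∀ i, kap * (D * GV A (stdOrthonormalBasis ℝ E i)) ≤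
      C * (4 * D ^ 2 * (4 * kap * GG A * W) + SS A ν) := by
    intro i
    have nb : ‖s • stdOrthonormalBasis ℝ E i‖ = s := by
      rw [norm_smul, OrthonormalBasis.norm_eq_one, mul_one, Real.norm_of_nonneg hs0.le]
    have := H ν A B ε h1 h2 hB hε (hcε.trans hs1) hl (s • stdOrthonormalBasis ℝ E i) (by rw [nb]; exact hsδ)
    rw [← GV_smul]
    refine (le_JJ hL hR hB _ (fV _)).trans (this.trans ?_)
    gcongr
    rw [nb, hD, ← ENNReal.ofReal_pow (by positivity), show (4 : ℝ≥0∞) = ENNReal.ofReal 4 by norm_num,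
      ← ENNReal.ofReal_mul (by norm_num)]
    apply ENNReal.ofReal_le_ofReal
    have h5 : (c0 * ε) ^ 2 ≤ s ^ 2 := by gcongr
    calc (s ^ 2 + (c0 * ε) ^ 2) ^ 2 ≤ (s ^ 2 + s ^ 2) ^ 2 := by gcongr
      _ = _ := by ring
  have hsum : kap * D * GG A ≤ (kap * D * GG A) / 2 + N * C * SS A ν := by
    calc kap * D * GG A ≤ kap * D * ∑ i, GV A (stdOrthonormalBasis ℝ E i) := by gcongr; exact GG_le_sum A
      _ = ∑ i, kap * (D * GV A (stdOrthonormalBasis ℝ E i)) := by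
          rw [Finset.mul_sum]; simp only [mul_assoc]
      _ ≤ ∑ _i : Fin (Module.finrank ℝ E), C * (4 * D ^ 2 * (4 * kap * GG A * W) + SS A ν) :=
          Finset.sum_le_sum fun i _ => hi i
      _ = (kap * D * GG A) * (D * (N * C * 16 * W)) + N * C * SS A ν := by
          rw [Finset.sum_const, Finset.card_univ, Fintype.card_fin, nsmul_eq_mul, ← hN]
          ring
      _ ≤ _ := by
          rw [div_eq_mul_inv]
          gcongr
          rw [hMe, hD, ← ENNReal.ofReal_mul (by positivity)]
          refine (ENNReal.ofReal_le_ofReal hsM).trans (le_of_eq ?_)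
          rw [one_div, ENNReal.ofReal_inv_of_pos two_pos]
          norm_num
  have fx : kap * D * GG A / 2 ≠ ∞ := ENNReal.div_ne_top (by finiteness) (by norm_num)
  have hhalf : kap * D * GG A / 2 ≤ N * C * SS A ν := by
    conv_lhs at hsum => rw [← ENNReal.add_halves (kap * D * GG A)]
    exact (ENNReal.add_le_add_iff_left fx).1 hsum
  have hq : c' * GG A = (kap * D * GG A / 2) / (N * C + 1) := by
    rw [hc']; simp only [div_eq_mul_inv]; ring
  rw [hq]
  refine ENNReal.div_le_of_le_mul' (hhalf.trans ?_)
  gcongr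
  exact le_self_add
end asm


end core

section graph
variable {n d : ℕ}

/-- projection to the first coordinates -/
def pj (hnd : n ≤ d) : EuclideanSpace ℝ (Fin d) →ₗ[ℝ] EuclideanSpace ℝ (Fin n) where
  toFun z := WithLp.toLp 2 fun i => z (Fin.castLE hnd i)
  map_add' x y := by ext i; simp
  map_smul' c x := by ext i; simp

/-- projection to the last coordinates -/
def qj (hnd : n ≤ d) : EuclideanSpace ℝ (Fin d) →ₗ[ℝ] EuclideanSpace ℝ (Fin (d - n)) where
  toFun z := WithLp.toLp 2 fun j => z ⟨n + j, by have := j.isLt; omega⟩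
  map_add' x y := by ext i; simp
  map_smul' c x := by ext i; simp

lemma sum_split (hnd : n ≤ d) (f : Fin d → ℝ) :
    ∑ i, f i = ∑ i : Fin n, f (Fin.castLE hnd i) +
      ∑ j : Fin (d - n), f ⟨n + j, by have := j.isLt; omega⟩ := by
  rw [← (finCongr (show n + (d - n) = d by omega)).sum_comp, Fin.sum_univ_add]
  rfl

lemma norm_split (hnd : n ≤ d) (z : EuclideanSpace ℝ (Fin d)) :
    ‖z‖ ^ 2 = ‖pj hnd z‖ ^ 2 + ‖qj hnd z‖ ^ 2 := by
  simp only [EuclideanSpace.norm_sq_eq]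
  rw [sum_split hnd]
  rfl

lemma norm_perp (hnd : n ≤ d) (z : EuclideanSpace ℝ (Fin d)) : ‖projPerp n d z‖ = ‖qj hnd z‖ := by
  have h1 : pj hnd (projPerp n d z) = 0 := by
    ext i
    simp [pj, projPerp]
  have h2 : qj hnd (projPerp n d z) = qj hnd z := by
    ext i
    simp [qj, projPerp]
  have := norm_split hnd (projPerp n d z)
  rw [h1, h2, norm_zero] at this
  exact (sq_eq_sq₀ (norm_nonneg _) (norm_nonneg _)).1 (by linarith)

variable (hnd : n ≤ d) (A : EuclideanSpace ℝ (Fin n) → EuclideanSpace ℝ (Fin (d - n)))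

lemma pj_graph (x : EuclideanSpace ℝ (Fin n)) : pj hnd (graphMap n d hnd A x) = x := by
  ext i
  simp [pj, graphMap]

lemma qj_graph (x : EuclideanSpace ℝ (Fin n)) : qj hnd (graphMap n d hnd A x) = A x := by
  ext i
  simp [qj, graphMap]

lemma graph_rho (x y : EuclideanSpace ℝ (Fin n)) :
    ‖graphMap n d hnd A x - graphMap n d hnd A y‖ = rho A x y := by
  unfold rho
  rw [← Real.sqrt_sq (norm_nonneg (graphMap n d hnd A x - graphMap n d hnd A y)), norm_split hnd,
    map_sub, map_sub, pj_graph, pj_graph, qj_graph, qj_graph]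

lemma pj_lip : LipschitzWith 1 (pj hnd) := by
  refine LipschitzWith.of_dist_le_mul fun x y => ?_
  rw [dist_eq_norm, dist_eq_norm, ← map_sub, NNReal.coe_one, one_mul]
  have := norm_split hnd (x - y)
  exact (sq_le_sq₀ (norm_nonneg _) (norm_nonneg _)).1 (by nlinarith [sq_nonneg ‖qj hnd (x - y)‖])

variable {A}

lemma graph_lip (hA : LipschitzWith 1 A) : LipschitzWith 2 (graphMap n d hnd A) := by
  refine LipschitzWith.of_dist_le_mul fun x y => ?_
  rw [dist_eq_norm, dist_eq_norm, graph_rho]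
  unfold rho
  have h := hA.norm_sub_le x y
  rw [NNReal.coe_one, one_mul] at h
  refine Real.sqrt_le_iff.2 ⟨by positivity, ?_⟩
  simp only [NNReal.coe_ofNat]
  nlinarith [norm_nonneg (A x - A y), norm_nonneg (x - y)]

lemma graph_emb (hA : LipschitzWith 1 A) : MeasurableEmbedding (graphMap n d hnd A) :=
  (graph_lip hnd hA).continuous.measurableEmbedding
    (Function.LeftInverse.injective (pj_graph hnd A))

lemma graph_image (B : Set (EuclideanSpace ℝ (Fin n))) :
    (pj hnd ⁻¹' B) ∩ graphSet n d hnd A = graphMap n d hnd A '' B := by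
  ext z
  constructor
  · rintro ⟨h1, x, rfl⟩
    rw [mem_preimage, pj_graph] at h1
    exact ⟨x, h1, rfl⟩
  · rintro ⟨x, hx, rfl⟩
    exact ⟨by rw [mem_preimage, pj_graph]; exact hx, x, rfl⟩

lemma haus_up (hA : LipschitzWith 1 A) (B : Set (EuclideanSpace ℝ (Fin n))) :
    μH[(n:ℝ)] (graphMap n d hnd A '' B) ≤ 2 ^ n * μH[(n:ℝ)] B := by
  have := (graph_lip hnd hA).hausdorffMeasure_image_le (d := (n:ℝ)) (by positivity) B
  simpa using this

lemma haus_lo (B : Set (EuclideanSpace ℝ (Fin n))) :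
    μH[(n:ℝ)] B ≤ μH[(n:ℝ)] (graphMap n d hnd A '' B) := by
  have := (pj_lip hnd).hausdorffMeasure_image_le (d := (n:ℝ)) (by positivity) (graphMap n d hnd A '' B)
  rw [image_image] at this
  simpa [pj_graph] using this

lemma vol_haus (n : ℕ) : ∃ q : ℝ≥0, q ≠ 0 ∧
    (volume : Measure (EuclideanSpace ℝ (Fin n))) = q • μH[(n:ℝ)] := by
  refine ⟨_, Measure.addHaarScalarFactor_volume_hausdorffMeasure_ne_zero n, ?_⟩
  have h := EuclideanSpace.euclideanHausdorffMeasure_eq_volume n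
  rw [Measure.euclideanHausdorffMeasure_def] at h
  exact h.symm

/-- pushed measure -/
def nuP (hnd : n ≤ d) (A : EuclideanSpace ℝ (Fin n) → EuclideanSpace ℝ (Fin (d - n)))
    (g : EuclideanSpace ℝ (Fin d) → ℝ) : Measure (EuclideanSpace ℝ (Fin n)) :=
  (graphMeasure n d hnd A g).map (pj hnd)

variable {g : EuclideanSpace ℝ (Fin d) → ℝ} {C₁ : ℝ}

lemma pj_meas : Measurable (pj hnd) := (pj_lip hnd).continuous.measurable

lemma graphSet_meas (hA : LipschitzWith 1 A) : MeasurableSet (graphSet n d hnd A) :=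
  (graph_emb hnd hA).measurableSet_range

lemma nuP_apply (hA : LipschitzWith 1 A) {B : Set (EuclideanSpace ℝ (Fin n))} (hB : MeasurableSet B) :
    nuP hnd A g B = ∫⁻ z in graphMap n d hnd A '' B, ENNReal.ofReal (g z) ∂μH[(n:ℝ)] := by
  unfold nuP graphMeasure
  rw [Measure.map_apply (pj_meas hnd) hB, withDensity_apply _ (pj_meas hnd hB),
    Measure.restrict_restrict (pj_meas hnd hB), graph_image]

lemma nuP_le (hA : LipschitzWith 1 A) (hg : ∀ z ∈ graphSet n d hnd A, C₁⁻¹ ≤ g z ∧ g z ≤ C₁)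
    {B : Set (EuclideanSpace ℝ (Fin n))} (hB : MeasurableSet B) :
    nuP hnd A g B ≤ ENNReal.ofReal C₁ * (2 ^ n * μH[(n:ℝ)] B) := by
  rw [nuP_apply hnd hA hB]
  calc _ ≤ ∫⁻ z in graphMap n d hnd A '' B, ENNReal.ofReal C₁ ∂μH[(n:ℝ)] := by
        refine setLIntegral_mono' ((graph_emb hnd hA).measurableSet_image.2 hB) ?_
        rintro z ⟨x, hx, rfl⟩
        exact ENNReal.ofReal_le_ofReal (hg _ ⟨x, rfl⟩).2
    _ ≤ _ := by
        rw [setLIntegral_const]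
        gcongr
        exact haus_up hnd hA B

lemma le_nuP (hA : LipschitzWith 1 A) (hC : 0 < C₁) (hg : ∀ z ∈ graphSet n d hnd A, C₁⁻¹ ≤ g z ∧ g z ≤ C₁)
    {B : Set (EuclideanSpace ℝ (Fin n))} (hB : MeasurableSet B) :
    μH[(n:ℝ)] B ≤ ENNReal.ofReal C₁ * nuP hnd A g B := by
  rw [nuP_apply hnd hA hB]
  have h1 : ENNReal.ofReal C₁⁻¹ * μH[(n:ℝ)] B ≤
      ∫⁻ z in graphMap n d hnd A '' B, ENNReal.ofReal (g z) ∂μH[(n:ℝ)] := by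
    calc _ ≤ ∫⁻ z in graphMap n d hnd A '' B, ENNReal.ofReal C₁⁻¹ ∂μH[(n:ℝ)] := by
          rw [setLIntegral_const]
          gcongr
          exact haus_lo hnd B
      _ ≤ _ := by
          refine setLIntegral_mono' ((graph_emb hnd hA).measurableSet_image.2 hB) ?_
          rintro z ⟨x, hx, rfl⟩
          exact ENNReal.ofReal_le_ofReal (hg _ ⟨x, rfl⟩).1
  refine le_trans (le_of_eq ?_) (mul_le_mul_right h1 _)
  rw [← mul_assoc, ← ENNReal.ofReal_mul hC.le, mul_inv_cancel₀ hC.ne']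
  simp

/-- comparability with the volume -/
lemma nuP_comp (n : ℕ) (C₁ : ℝ) (hC : 0 < C₁) : ∃ K : ℝ≥0, 1 ≤ K ∧ ∀ (d : ℕ) (hnd : n ≤ d)
    (A : EuclideanSpace ℝ (Fin n) → EuclideanSpace ℝ (Fin (d - n))) (g : EuclideanSpace ℝ (Fin d) → ℝ),
    LipschitzWith 1 A → (∀ z ∈ graphSet n d hnd A, C₁⁻¹ ≤ g z ∧ g z ≤ C₁) →
    nuP hnd A g ≤ K • volume ∧ volume ≤ K • nuP hnd A g := by
  obtain ⟨q, hq, hv⟩ := vol_haus n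
  have hv' : ∀ B, (volume : Measure (EuclideanSpace ℝ (Fin n))) B = q * μH[(n:ℝ)] B := fun B => by
    rw [hv]; rfl
  refine ⟨max 1 (max (C₁.toNNReal * 2 ^ n * q⁻¹) (q * C₁.toNNReal)), le_max_left _ _, ?_⟩
  set K : ℝ≥0 := max 1 (max (C₁.toNNReal * 2 ^ n * q⁻¹) (q * C₁.toNNReal)) with hK
  have k1 : C₁.toNNReal * 2 ^ n * q⁻¹ ≤ K := (le_max_left _ _).trans (le_max_right _ _)
  have k2 : q * C₁.toNNReal ≤ K := (le_max_right _ _).trans (le_max_right _ _)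
  intro d hnd A g hA hg
  constructor
  · refine Measure.le_iff.2 fun B hB => (nuP_le hnd hA hg hB).trans ?_
    change _ ≤ (K : ℝ≥0∞) * volume B
    have e : ENNReal.ofReal C₁ * (2 ^ n * μH[(n:ℝ)] B) =
        ((C₁.toNNReal * 2 ^ n * q⁻¹ : ℝ≥0) : ℝ≥0∞) * volume B := by
      rw [hv' B]
      push_cast
      rw [ENNReal.coe_inv hq]
      have : (q:ℝ≥0∞)⁻¹ * q = 1 := ENNReal.inv_mul_cancel (by simpa using hq) (by simp)
      calc _ = ENNReal.ofReal C₁ * 2 ^ n * 1 * μH[(n:ℝ)] B := by ring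
        _ = _ := by rw [← this]; unfold ENNReal.ofReal; ring
    rw [e]
    gcongr
  · refine Measure.le_iff.2 fun B hB => ?_
    rw [hv']
    change _ ≤ (K : ℝ≥0∞) * nuP hnd A g B
    calc _ ≤ (q:ℝ≥0∞) * (ENNReal.ofReal C₁ * nuP hnd A g B) := by
          gcongr
          exact le_nuP hnd hA hC hg hB
      _ = ((q * C₁.toNNReal : ℝ≥0) : ℝ≥0∞) * nuP hnd A g B := by
          push_cast; unfold ENNReal.ofReal; ring
      _ ≤ _ := by gcongr

lemma nuP_map (hA : LipschitzWith 1 A) :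
    (nuP hnd A g).map (graphMap n d hnd A) = graphMeasure n d hnd A g := by
  unfold nuP
  rw [Measure.map_map (graph_emb hnd hA).measurable (pj_meas hnd)]
  conv_rhs => rw [← Measure.map_id (μ := graphMeasure n d hnd A g)]
  refine Measure.map_congr ?_
  have h : ∀ᵐ z ∂graphMeasure n d hnd A g, z ∈ graphSet n d hnd A :=
    (withDensity_absolutelyContinuous _ _).ae_le (ae_restrict_mem (graphSet_meas hnd hA))
  filter_upwards [h] with z hz
  obtain ⟨x, rfl⟩ := hz
  simp [pj_graph]

lemma riesz_TT (hA : LipschitzWith 1 A) {K : ℝ≥0} (hK : nuP hnd A g ≤ K • volume)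
    (x : EuclideanSpace ℝ (Fin n)) {t : ℝ} (ht : 0 < t) :
    ‖projPerp n d (truncRiesz d n (graphMeasure n d hnd A g) (graphMap n d hnd A x) t (2 * t))‖ =
      ‖TT A (nuP hnd A g) t x‖ := by
  rw [norm_perp hnd]
  congr 1
  set ν := nuP hnd A g with hν
  set G := graphMap n d hnd A with hG
  have hGe : MeasurableEmbedding G := graph_emb hnd hA
  have hGc : Continuous G := (graph_lip hnd hA).continuous
  have hdist : ∀ y, dist (G x) (G y) = rho A x y := fun y => by rw [dist_eq_norm, graph_rho]
  unfold truncRiesz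
  rw [← nuP_map hnd hA, hGe.setIntegral_map]
  set S : Set (EuclideanSpace ℝ (Fin n)) := G ⁻¹' {y | t < dist (G x) y ∧ dist (G x) y ≤ 2 * t} with hS
  have hSm : MeasurableSet S := by
    refine hGe.measurable (MeasurableSet.inter ?_ ?_)
    · exact (isOpen_lt continuous_const (continuous_const.dist continuous_id)).measurableSet
    · exact (isClosed_le (continuous_const.dist continuous_id) continuous_const).measurableSet
  have hSf : ν S ≠ ∞ := by
    have h1 : S ⊆ closedBall x (2 * t) := by
      rintro y ⟨_, h2⟩
      rw [mem_closedBall, dist_comm]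
      have := (pj_lip hnd).dist_le_mul (G x) (G y)
      rw [hG, pj_graph, pj_graph] at this
      simp only [NNReal.coe_one, one_mul] at this
      exact this.trans h2
    refine ne_top_of_le_ne_top ?_ ((hK S).trans (mul_le_mul_right (measure_mono h1) _))
    have : volume (closedBall x (2 * t)) < ∞ := measure_closedBall_lt_top
    change (K : ℝ≥0∞) * volume (closedBall x (2 * t)) ≠ ∞
    finiteness
  have hIntg : IntegrableOn (fun y => rieszKernel d n (G x) (G y)) S ν := by
    refine Measure.integrableOn_of_bounded (M := t ^ (-((n:ℝ) + 1)) * (2 * t)) hSf ?_ ?_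
    · unfold rieszKernel
      have hGm := hGe.measurable
      have : Measurable fun y => ‖G x - G y‖ ^ (-((n:ℝ) + 1)) • (G x - G y) := by fun_prop
      exact this.aestronglyMeasurable
    · refine (ae_restrict_mem hSm).mono fun y hy => ?_
      obtain ⟨h1, h2⟩ := hy
      unfold rieszKernel
      rw [norm_smul, ← dist_eq_norm, Real.norm_of_nonneg (by positivity)]
      refine mul_le_mul ?_ h2 dist_nonneg (by positivity)
      exact Real.rpow_le_rpow_of_nonpos ht h1.le (by have : (0:ℝ) ≤ n := by positivity
                                                     linarith)
  have hq := (qj hnd).toContinuousLinearMap.integral_comp_comm hIntg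
  rw [LinearMap.coe_toContinuousLinearMap'] at hq
  rw [← hq]
  unfold TT
  rw [← integral_indicator hSm]
  refine integral_congr_ae (Filter.Eventually.of_forall fun y => ?_)
  simp only
  unfold kt
  by_cases hy : y ∈ S
  · rw [indicator_of_mem hy]
    obtain ⟨h1, h2⟩ := hy
    rw [hdist] at h1 h2
    rw [if_pos ⟨h1, h2⟩]
    unfold rieszKernel
    rw [map_smul, map_sub, hG, qj_graph, qj_graph, graph_rho, finrank_euclideanSpace_fin]
    congr 1
    rw [Real.rpow_neg (by linarith), ← Nat.cast_add_one, Real.rpow_natCast]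
  · rw [indicator_of_notMem hy, if_neg, zero_smul]
    intro h
    apply hy
    simp only [hS, mem_preimage, mem_setOf_eq, hdist]
    exact h


lemma l2_eq (hA : LipschitzWith 1 A) {K : ℝ≥0} (hK : nuP hnd A g ≤ K • volume) [SFinite (nuP hnd A g)] :
    l2Norm (graphMeasure n d hnd A g) (sqFnPerp n d (graphMeasure n d hnd A g)) =
      (∫⁻ x, ∫⁻ t, ‖TT A (nuP hnd A g) t x‖ₑ ^ 2 ∂mh ∂(nuP hnd A g)) ^ (1 / 2 : ℝ) := by
  have hm := TT_meas (ν := nuP hnd A g) hA.continuous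
  unfold l2Norm
  congr 1
  conv_lhs => rw [← nuP_map hnd hA]
  rw [(graph_emb hnd hA).lintegral_map]
  refine lintegral_congr fun x => ?_
  rw [nuP_map hnd hA]
  unfold sqFnPerp
  rw [← ENNReal.rpow_natCast, ← ENNReal.rpow_mul, show (1 / 2 : ℝ) * ((2 : ℕ) : ℝ) = 1 by norm_num,
    ENNReal.rpow_one]
  have m1 : Measurable fun t => ‖TT A (nuP hnd A g) t x‖ₑ ^ 2 :=
    ((hm.measurable.comp (measurable_id.prodMk measurable_const)).enorm).pow_const 2
  rw [mh_lint _ m1]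
  refine setLIntegral_congr_fun measurableSet_Ioi fun t ht => ?_
  have ht' : 0 < t := ht
  rw [riesz_TT hnd hA hK x ht', enorm_sq_ofReal, ← ENNReal.ofReal_mul (by positivity), div_eq_inv_mul]

lemma SS_le_l2 (hA : LipschitzWith 1 A) {K : ℝ≥0} (hK : volume ≤ K • nuP hnd A g) [SFinite (nuP hnd A g)] :
    SS A (nuP hnd A g) ≤ K * ∫⁻ x, ∫⁻ t, ‖TT A (nuP hnd A g) t x‖ₑ ^ 2 ∂mh ∂(nuP hnd A g) := by
  have hm := TT_meas (ν := nuP hnd A g) hA.continuous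
  unfold SS QQ
  have m1 : Measurable fun p : ℝ × EuclideanSpace ℝ (Fin n) => ‖TT A (nuP hnd A g) p.1 p.2‖ₑ ^ 2 :=
    hm.measurable.enorm.pow_const 2
  rw [lintegral_lintegral_swap m1.aemeasurable]
  calc _ ≤ ∫⁻ x, ∫⁻ t, ‖TT A (nuP hnd A g) t x‖ₑ ^ 2 ∂mh ∂(K • nuP hnd A g) := lintegral_mono' hK le_rfl
    _ = _ := by rw [lintegral_smul_measure]; rfl

lemma grad_eq (A : EuclideanSpace ℝ (Fin n) → EuclideanSpace ℝ (Fin (d - n))) :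
    gradL2 n (d - n) A = (GG A) ^ (1 / 2 : ℝ) := by
  unfold gradL2 GG
  rw [eLpNorm_eq_lintegral_rpow_enorm_toReal (by norm_num) (by norm_num)]
  simp

end graph

theorem stmt4 (n d : ℕ) (hn : 0 < n) (hnd : n ≤ d) (C₁ : ℝ) (hC₁ : 0 < C₁) :
    ∀ C₂ : ℝ, 0 < C₂ →
    ∃ ε₀ c : ℝ, 0 < ε₀ ∧ 0 < c ∧
      ∀ (A : EuclideanSpace ℝ (Fin n) → EuclideanSpace ℝ (Fin (d - n)))
        (g : EuclideanSpace ℝ (Fin d) → ℝ),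
        HasCompactSupport A →
        LipschitzWith (Real.toNNReal ε₀) A →
        (∀ z ∈ graphSet n d hnd A, C₁⁻¹ ≤ g z ∧ g z ≤ C₁) →
        eLpNorm (fun z => g z - 1) 2 (μH[(n:ℝ)].restrict (graphSet n d hnd A))
          ≤ ENNReal.ofReal C₂ * gradL2 n (d - n) A →
        ENNReal.ofReal c * gradL2 n (d - n) A
          ≤ l2Norm (graphMeasure n d hnd A g) (sqFnPerp n d (graphMeasure n d hnd A g)) := by
  intro C₂ _
  obtain ⟨K, hK1, hK⟩ := nuP_comp n C₁ hC₁
  obtain ⟨ε, c, hε, hc, H⟩ := core (EuclideanSpace ℝ (Fin n)) (EuclideanSpace ℝ (Fin (d - n))) K hK1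
  have hKp : (0:ℝ) < K := lt_of_lt_of_le one_pos (by exact_mod_cast hK1)
  refine ⟨min ε 1, Real.sqrt (c / K), by positivity, by positivity, ?_⟩
  intro A g hcs hL hg _
  have hL1 : LipschitzWith 1 A := hL.weaken (by
    rw [Real.toNNReal_le_one]
    exact min_le_right _ _)
  obtain ⟨h1, h2⟩ := hK d hnd A g hL1 hg
  have hsf : SigmaFinite (nuP hnd A g) := by
    have : SigmaFinite (K • (volume : Measure (EuclideanSpace ℝ (Fin n)))) := inferInstance
    exact Measure.sigmaFinite_of_le _ h1
  have key := H (nuP hnd A g) A (min ε 1) h1 h2 hcs (by positivity) (min_le_left _ _) hL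
  have key2 := key.trans (SS_le_l2 hnd hL1 h2)
  rw [l2_eq hnd hL1 h1, grad_eq]
  have e : ENNReal.ofReal (Real.sqrt (c / K)) = (ENNReal.ofReal (c / K)) ^ (1 / 2 : ℝ) := by
    rw [Real.sqrt_eq_rpow, ENNReal.ofReal_rpow_of_nonneg (by positivity) (by norm_num)]
  rw [e, ← ENNReal.mul_rpow_of_nonneg _ _ (by norm_num)]
  refine ENNReal.rpow_le_rpow ?_ (by norm_num)
  rw [ENNReal.ofReal_div_of_pos hKp, ENNReal.ofReal_coe_nnreal]
  have e2 : ENNReal.ofReal c / K * GG A = (ENNReal.ofReal c * GG A) / K := by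
    simp only [div_eq_mul_inv]; ring
  rw [e2]
  exact ENNReal.div_le_of_le_mul' key2
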